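/- Let p be a prime, F a field of characteristic p, and A a central simple F-algebra with exp A = p. Let L/F be a p-extension. Then λ_p(A) ≤ (λ_p(A_L) + 1)·[L:F] − 1. -/

import Mathlib

open scoped TensorProduct

/-- A finite-dimensional central simple algebra over a field `F`. -/
def IsCSA (F A : Type) [Field F] [Ring A] [Algebra F A] : Prop :=
  Algebra.IsCentral F A ∧ IsSimpleRing A ∧ FiniteDimensional F A

/-- An `F`-algebra is split if it is isomorphic to a matrix algebra over `F`. -/
def IsSplitAlg (F A : Type) [Field F] [Ring A] [Algebra F A] : Prop :=
  ∃ n : ℕ, 0 < n ∧ Nonempty (A ≃ₐ[F] Matrix (Fin n) (Fin n) F)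

/-- Brauer equivalence of two algebras over a field `F`. -/
def IsBrauerEquiv (F A B : Type) [Field F] [Ring A] [Algebra F A] [Ring B] [Algebra F B] :
    Prop :=
  ∃ n m : ℕ, 0 < n ∧ 0 < m ∧
    Nonempty ((Matrix (Fin n) (Fin n) A) ≃ₐ[F] (Matrix (Fin m) (Fin m) B))

/-- `A` has exponent `e`: `e` is the least positive integer such that the `e`-fold tensor
power of `A` over `F` is split. -/
def HasExponent (F A : Type) [Field F] [Ring A] [Algebra F A] (e : ℕ) : Prop :=
  0 < e ∧ IsSplitAlg F (⨂[F] _ : Fin e, A) ∧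
    ∀ k : ℕ, 0 < k → IsSplitAlg F (⨂[F] _ : Fin k, A) → e ≤ k

/-- `A` has (Schur) index `d`: `A` is isomorphic to a matrix algebra over a division
algebra of dimension `d ^ 2` over `F`. -/
def HasIndex (F A : Type) [Field F] [Ring A] [Algebra F A] (d : ℕ) : Prop :=
  ∃ (D : Type) (_ : DivisionRing D) (_ : Algebra F D) (m : ℕ), 0 < m ∧
    Nonempty (A ≃ₐ[F] Matrix (Fin m) (Fin m) D) ∧ Module.finrank F D = d ^ 2

/-- The (Schur) index of `A` is at most `d`. -/
def IndexLE (F A : Type) [Field F] [Ring A] [Algebra F A] (d : ℕ) : Prop :=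
  ∃ e : ℕ, e ≤ d ∧ HasIndex F A e

/-- `A` is the cyclic (symbol) algebra `[a, b)_{p,F}` of degree `p` in characteristic `p`:
it has dimension `p ^ 2` over `F` and is generated by elements `i`, `j` subject to
`i ^ p - i = a`, `j ^ p = b`, `j * i = (i - 1) * j`. -/
def IsCyclicAlgWith (p : ℕ) (F A : Type) [Field F] [Ring A] [Algebra F A] (a b : F) : Prop :=
  b ≠ 0 ∧ Module.finrank F A = p ^ 2 ∧
    ∃ i j : A, i ^ p - i = algebraMap F A a ∧ j ^ p = algebraMap F A b ∧
      j * i = (i - 1) * j ∧ Algebra.adjoin F {i, j} = ⊤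

/-- `A` is a cyclic algebra of degree `p`, i.e. of the form `[a, b)_{p,F}`. -/
def IsCyclicPAlg (p : ℕ) (F A : Type) [Field F] [Ring A] [Algebra F A] : Prop :=
  ∃ a b : F, IsCyclicAlgWith p F A a b

/-- The `p`-symbol length of `A` is at most `m`: `A` is Brauer equivalent to a tensor
product of at most `m` cyclic `F`-algebras of degree `p`. -/
def SymbolLengthLE (p : ℕ) (F A : Type) [Field F] [Ring A] [Algebra F A] (m : ℕ) : Prop :=
  ∃ k : ℕ, k ≤ m ∧ ∃ (D : Fin k → Type) (_ : ∀ i, Ring (D i)) (_ : ∀ i, Algebra F (D i)),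
    (∀ i, IsCyclicPAlg p F (D i)) ∧ IsBrauerEquiv F A (⨂[F] i, D i)

/-- `M` is a compositum `LK` of `L` and `K` over `F`: it is generated as an `F`-algebra by
the images of `L` and `K`. -/
def IsCompositum (F L K M : Type) [Field F] [Field L] [Field K] [Field M]
    [Algebra F L] [Algebra F K] [Algebra F M] [Algebra L M] [Algebra K M]
    [IsScalarTower F L M] [IsScalarTower F K M] : Prop :=
  (IsScalarTower.toAlgHom F L M).range ⊔ (IsScalarTower.toAlgHom F K M).range = ⊤

/-- A cyclic algebra of degree `m` over `F`: a central simple `F`-algebra of degree `m`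
containing a cyclic field extension of `F` of degree `m` (as a maximal subfield). -/
def IsCyclicAlgebra (F A : Type) [Field F] [Ring A] [Algebra F A] (m : ℕ) : Prop :=
  IsCSA F A ∧ Module.finrank F A = m ^ 2 ∧
  ∃ (L : Type) (_ : Field L) (_ : Algebra F L), IsGalois F L ∧ IsCyclic (L ≃ₐ[F] L) ∧
    Module.finrank F L = m ∧ Nonempty (L →ₐ[F] A)

/-- `L/F` is a `p`-extension: there is a tower of intermediate fields from `F` to `L`
each step of which is a cyclic extension of degree `p`. -/
def IsPExtension (p : ℕ) (F L : Type) [Field F] [Field L] [Algebra F L] : Prop :=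
  ∃ (n : ℕ) (T : Fin (n + 1) → IntermediateField F L),
    T 0 = ⊥ ∧ T (Fin.last n) = ⊤ ∧
    ∀ i : Fin n, ∃ h : T i.castSucc ≤ T i.succ,
      IsGalois (T i.castSucc) (IntermediateField.extendScalars h) ∧
      IsCyclic ((IntermediateField.extendScalars h) ≃ₐ[T i.castSucc]
        (IntermediateField.extendScalars h)) ∧
      Module.finrank (T i.castSucc) (IntermediateField.extendScalars h) = p

/-- `F` is `p`-cyclic reducible: for every central simple `F`-algebra `A` of exponent `p`
and every purely inseparable extension `K/F` with `K ^ p ⊆ F`, either `A_K` is split, or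
there is a separable extension `L/F` of degree `ind (A_K) / p` such that `A_{LK}` is
Brauer equivalent to a cyclic `LK`-algebra of degree `p`. -/
def IsPCyclicReducible (p : ℕ) (F : Type) [Field F] : Prop :=
  ∀ (A : Type) [Ring A] [Algebra F A], IsCSA F A → HasExponent F A p →
  ∀ (K : Type) [Field K] [Algebra F K], IsPurelyInseparable F K →
    (∀ z : K, z ^ p ∈ (algebraMap F K).range) →
    IsSplitAlg K (K ⊗[F] A) ∨
    ∃ d : ℕ, HasIndex K (K ⊗[F] A) (p * d) ∧
      ∃ (L : Type) (_ : Field L) (_ : Algebra F L), Algebra.IsSeparable F L ∧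
        Module.finrank F L = d ∧
        ∃ (M : Type) (_ : Field M) (_ : Algebra F M) (_ : Algebra L M) (_ : Algebra K M)
          (_ : IsScalarTower F L M) (_ : IsScalarTower F K M),
          IsCompositum F L K M ∧
          ∃ (C : Type) (_ : Ring C) (_ : Algebra M C),
            IsCyclicPAlg p M C ∧ IsBrauerEquiv M (M ⊗[F] A) C

/-- `F` is `p`-reducible: for every central simple `F`-algebra `A` of exponent `p`
and every purely inseparable extension `K/F` with `K ^ p ⊆ F`, either `A_K` is split, or
there is a separable extension `L/F` of degree `ind (A_K) / p` with `ind A_{LK} = p`. -/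
def IsPReducible (p : ℕ) (F : Type) [Field F] : Prop :=
  ∀ (A : Type) [Ring A] [Algebra F A], IsCSA F A → HasExponent F A p →
  ∀ (K : Type) [Field K] [Algebra F K], IsPurelyInseparable F K →
    (∀ z : K, z ^ p ∈ (algebraMap F K).range) →
    IsSplitAlg K (K ⊗[F] A) ∨
    ∃ d : ℕ, HasIndex K (K ⊗[F] A) (p * d) ∧
      ∃ (L : Type) (_ : Field L) (_ : Algebra F L), Algebra.IsSeparable F L ∧
        Module.finrank F L = d ∧
        ∃ (M : Type) (_ : Field M) (_ : Algebra F M) (_ : Algebra L M) (_ : Algebra K M)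
          (_ : IsScalarTower F L M) (_ : IsScalarTower F K M),
          IsCompositum F L K M ∧ HasIndex M (M ⊗[F] A) p

section Full

variable {F M A ι κ : Type*} [Field F] [Field M] [Algebra F M] [Ring A] [Algebra F A]
  [Fintype ι] [DecidableEq ι] [Fintype κ] [DecidableEq κ]

/-- A matrix representation of `A` over an extension field `M` of `F` which induces an
isomorphism of `M ⊗ A` with the full matrix algebra. -/
def IsFullRep (ρ : A →ₐ[F] Matrix ι ι M) : Prop :=
  Submodule.span M (Set.range ρ) = ⊤ ∧ Module.finrank F A = Fintype.card ι ^ 2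

/-- The `M`-linear extension of a matrix representation. -/
noncomputable def scalarExt (ρ : A →ₐ[F] Matrix ι ι M) : M ⊗[F] A →ₐ[M] Matrix ι ι M :=
  Algebra.TensorProduct.lift (Algebra.ofId M _) ρ fun m a =>
    show Commute (algebraMap M _ m) (ρ a) from Algebra.commutes m (ρ a)

lemma scalarExt_tmul (ρ : A →ₐ[F] Matrix ι ι M) (m : M) (a : A) :
    scalarExt ρ (m ⊗ₜ a) = m • ρ a := by
  rw [Algebra.smul_def]
  exact Algebra.TensorProduct.lift_tmul _ _ _ m a

lemma IsFullRep.finite [Nonempty ι] {ρ : A →ₐ[F] Matrix ι ι M} (h : IsFullRep ρ) :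
    Module.Finite F A :=
  Module.finite_of_finrank_pos (by rw [h.2]; exact pow_pos Fintype.card_pos 2)

lemma IsFullRep.bijective [Nonempty ι] {ρ : A →ₐ[F] Matrix ι ι M} (h : IsFullRep ρ) :
    Function.Bijective (scalarExt ρ) := by
  have := h.finite
  have hs : Function.Surjective (scalarExt ρ) := by
    have : LinearMap.range (scalarExt ρ).toLinearMap = ⊤ := by
      rw [eq_top_iff, ← h.1, Submodule.span_le]
      rintro _ ⟨a, rfl⟩
      exact ⟨1 ⊗ₜ a, by simp [scalarExt_tmul]⟩
    exact LinearMap.range_eq_top.mp this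
  refine ⟨?_, hs⟩
  have hd : Module.finrank M (M ⊗[F] A) = Module.finrank M (Matrix ι ι M) := by
    rw [Module.finrank_baseChange, h.2, Module.finrank_matrix]; simp [sq]
  exact (LinearMap.injective_iff_surjective_of_finrank_eq_finrank hd
    (f := (scalarExt ρ).toLinearMap)).mpr hs

lemma IsFullRep.injective [Nonempty ι] {ρ : A →ₐ[F] Matrix ι ι M} (h : IsFullRep ρ) :
    Function.Injective ρ := by
  intro a b hab
  have h1 : (1 : M) ⊗ₜ[F] a = 1 ⊗ₜ b := h.bijective.1 (by simp [scalarExt_tmul, hab])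
  exact Algebra.TensorProduct.includeRight_injective (R := F) (A := M) (B := A)
    (FaithfulSMul.algebraMap_injective F M) h1

lemma IsFullRep.of_bijective {ρ : A →ₐ[F] Matrix ι ι M}
    (h : Function.Bijective (scalarExt ρ)) : IsFullRep ρ := by
  constructor
  · rw [eq_top_iff]
    rintro X -
    obtain ⟨t, rfl⟩ := h.2 X
    induction t using TensorProduct.induction_on with
    | zero => simp
    | tmul m a =>
      rw [scalarExt_tmul]
      exact Submodule.smul_mem _ _ (Submodule.subset_span ⟨a, rfl⟩)
    | add x y hx hy => rw [map_add]; exact Submodule.add_mem _ hx hy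
  · have := (LinearEquiv.ofBijective (scalarExt ρ).toLinearMap h).finrank_eq
    rw [Module.finrank_baseChange, Module.finrank_matrix] at this
    simpa [sq] using this

/-- Any two full representations of the same size are conjugate. -/
lemma IsFullRep.exists_conj [Nonempty ι] {ρ ρ' : A →ₐ[F] Matrix ι ι M}
    (h : IsFullRep ρ) (h' : IsFullRep ρ') :
    ∃ P : (Matrix ι ι M)ˣ, ∀ a, (P : Matrix ι ι M) * ρ a = ρ' a * P := by
  let e := (AlgEquiv.ofBijective _ h.bijective).symm.trans (AlgEquiv.ofBijective _ h'.bijective)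
  have he : ∀ a, e (ρ a) = ρ' a := by
    intro a
    have : (AlgEquiv.ofBijective _ h.bijective).symm (ρ a) = 1 ⊗ₜ a := by
      rw [AlgEquiv.symm_apply_eq]; simp [scalarExt_tmul]
    simp [e, this, scalarExt_tmul]
  let t : Matrix ι ι M ≃ₐ[M] Module.End M (ι → M) := Matrix.toLinAlgEquiv'
  obtain ⟨T, hT⟩ := ((t.symm.trans e).trans t).eq_linearEquivConjAlgEquiv
  have key : ∀ a, T.toLinearMap ∘ₗ t (ρ a) = t (ρ' a) ∘ₗ T.toLinearMap := by
    intro a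
    have := DFunLike.congr_fun hT (t (ρ a))
    simp only [AlgEquiv.trans_apply, AlgEquiv.symm_apply_apply, he,
      LinearEquiv.conjAlgEquiv_apply] at this
    rw [this]
    exact LinearMap.ext fun v => by simp
  refine ⟨⟨t.symm T.toLinearMap, t.symm T.symm.toLinearMap, ?_, ?_⟩, fun a => t.injective ?_⟩
  · rw [← map_mul]; convert map_one t.symm; exact LinearMap.ext fun v => by simp
  · rw [← map_mul]; convert map_one t.symm; exact LinearMap.ext fun v => by simp
  · have h1 : t (t.symm T.toLinearMap * ρ a) = T.toLinearMap ∘ₗ t (ρ a) := by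
      rw [map_mul, AlgEquiv.apply_symm_apply]; rfl
    have h2 : t (ρ' a * t.symm T.toLinearMap) = t (ρ' a) ∘ₗ T.toLinearMap := by
      rw [map_mul, AlgEquiv.apply_symm_apply]; rfl
    exact h1.trans ((key a).trans h2.symm)

/-- A matrix commuting with a full representation is scalar. -/
lemma IsFullRep.exists_scalar [Nonempty ι] {ρ : A →ₐ[F] Matrix ι ι M} (h : IsFullRep ρ)
    {X : Matrix ι ι M} (hX : ∀ a, X * ρ a = ρ a * X) : ∃ m : M, X = m • 1 := by
  have hc : ∀ Y : Matrix ι ι M, Commute Y X := by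
    intro Y
    have hY : Y ∈ Submodule.span M (Set.range ρ) := h.1 ▸ Submodule.mem_top
    induction hY using Submodule.span_induction with
    | mem x hx => obtain ⟨a, rfl⟩ := hx; exact (hX a).symm
    | zero => exact Commute.zero_left _
    | add x y _ _ hx hy => exact hx.add_left hy
    | smul m x _ hx => exact hx.smul_left m
  obtain ⟨m, hm⟩ := Matrix.mem_range_scalar_of_commute_single (M := X) fun i j _ => hc _
  exact ⟨m, by rw [← hm]; ext; simp [Matrix.scalar_apply, Matrix.diagonal_apply, Matrix.one_apply]⟩

/-- Two invertible intertwiners of full representations differ by a scalar. -/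
lemma IsFullRep.exists_unit_smul [Nonempty ι] {ρ ρ' : A → Matrix ι ι M}
    {ρ₀ : A →ₐ[F] Matrix ι ι M} (h : IsFullRep ρ₀) (h₀ : ∀ a, ρ₀ a = ρ' a)
    {P Q : (Matrix ι ι M)ˣ} (hP : ∀ a, (P : Matrix ι ι M) * ρ a = ρ' a * P)
    (hQ : ∀ a, (Q : Matrix ι ι M) * ρ a = ρ' a * Q) :
    ∃ m : Mˣ, (P : Matrix ι ι M) = (m : M) • (Q : Matrix ι ι M) := by
  have hcomm : ∀ a, ((P * Q⁻¹ : (Matrix ι ι M)ˣ) : Matrix ι ι M) * ρ₀ a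
      = ρ₀ a * ((P * Q⁻¹ : (Matrix ι ι M)ˣ) : Matrix ι ι M) := by
    intro a
    have hQ' : ((Q⁻¹ : (Matrix ι ι M)ˣ) : Matrix ι ι M) * ρ' a
        = ρ a * ((Q⁻¹ : (Matrix ι ι M)ˣ) : Matrix ι ι M) := by
      rw [Units.inv_mul_eq_iff_eq_mul, ← mul_assoc, hQ, mul_assoc, Units.mul_inv, mul_one]
    rw [h₀, Units.val_mul, mul_assoc, hQ', ← mul_assoc, hP, mul_assoc]
  obtain ⟨m, hm⟩ := h.exists_scalar hcomm
  have hPQ : (P : Matrix ι ι M) = m • (Q : Matrix ι ι M) := by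
    have : (P : Matrix ι ι M) = ((P * Q⁻¹ : (Matrix ι ι M)ˣ) : Matrix ι ι M) * Q := by
      rw [← Units.val_mul]; simp
    rw [this, hm]; simp
  have hm0 : m ≠ 0 := by
    rintro rfl
    rw [zero_smul] at hPQ
    exact P.ne_zero hPQ
  exact ⟨Units.mk0 m hm0, hPQ⟩

/-- Reindexing a representation. -/
noncomputable def reindexRep (e : ι ≃ κ) (ρ : A →ₐ[F] Matrix ι ι M) : A →ₐ[F] Matrix κ κ M :=
  ((Matrix.reindexAlgEquiv M M e).restrictScalars F).toAlgHom.comp ρ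

lemma IsFullRep.reindex (e : ι ≃ κ) {ρ : A →ₐ[F] Matrix ι ι M} (h : IsFullRep ρ) :
    IsFullRep (reindexRep e ρ) := by
  refine ⟨?_, by rw [h.2, Fintype.card_congr e]⟩
  have : Set.range (reindexRep e ρ)
      = (Matrix.reindexAlgEquiv M M e).toLinearMap '' Set.range ρ := by
    rw [← Set.range_comp]; rfl
  rw [this, Submodule.span_image, h.1, Submodule.map_top, LinearMap.range_eq_top]
  exact (Matrix.reindexAlgEquiv M M e).surjective

end Full

section Twist

variable {F M A B ι κ G : Type*} [Field F] [Field M] [Algebra F M] [Ring A] [Algebra F A]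
  [Ring B] [Algebra F B] [Fintype ι] [DecidableEq ι] [Fintype κ] [DecidableEq κ]
  [Group G] [MulSemiringAction G M]

/-- The entrywise action of a group on matrices. -/
def galMap (σ : G) : Matrix ι ι M →+* Matrix ι ι M :=
  (MulSemiringAction.toRingHom G M σ).mapMatrix

lemma galMap_apply (σ : G) (X : Matrix ι ι M) (i j : ι) : galMap σ X i j = σ • X i j := rfl

lemma galMap_smul (σ : G) (m : M) (X : Matrix ι ι M) :
    galMap σ (m • X) = (σ • m) • galMap σ X := by
  ext i j; simp [galMap_apply, smul_mul']

lemma galMap_mul_apply (σ τ : G) (X : Matrix ι ι M) :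
    galMap (σ * τ) X = galMap σ (galMap τ X) := by
  ext i j; simp [galMap_apply, mul_smul]

lemma galMap_inv_apply (σ : G) (X : Matrix ι ι M) : galMap σ (galMap σ⁻¹ X) = X := by
  ext i j; simp [galMap_apply]

/-- A full representation together with a twisted family of intertwiners `g` with factor set
`f` between the Galois conjugates of the representation. -/
def IsTwistedRep (ρ : A →ₐ[F] Matrix ι ι M) (g : G → (Matrix ι ι M)ˣ) (f : G → G → M) : Prop :=
  IsFullRep ρ ∧ (∀ σ a, (g σ : Matrix ι ι M) * galMap σ (ρ a) = ρ a * g σ) ∧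
    ∀ σ τ, (g σ : Matrix ι ι M) * galMap σ (g τ : Matrix ι ι M)
      = f σ τ • (g (σ * τ) : Matrix ι ι M)

variable (F A) in
/-- The factor set `f` describes the algebra `A`, split by `M`. -/
def HasTwistedRep (f : G → G → M) : Prop :=
  ∃ n : ℕ, 0 < n ∧ ∃ (ρ : A →ₐ[F] Matrix (Fin n) (Fin n) M) (g : G → (Matrix (Fin n) (Fin n) M)ˣ),
    IsTwistedRep ρ g f

lemma IsTwistedRep.hasTwistedRep [Nonempty ι] {ρ : A →ₐ[F] Matrix ι ι M}
    {g : G → (Matrix ι ι M)ˣ} {f : G → G → M} (h : IsTwistedRep ρ g f) :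
    HasTwistedRep F A f := by
  let e := Fintype.equivFin ι
  have hg : ∀ (σ : G) (X : Matrix ι ι M), galMap σ (Matrix.reindexAlgEquiv M M e X)
      = Matrix.reindexAlgEquiv M M e (galMap σ X) := by
    intro σ X; ext i j; simp [galMap_apply]
  refine ⟨Fintype.card ι, Fintype.card_pos, reindexRep e ρ,
    fun σ => Units.map (Matrix.reindexAlgEquiv M M e : Matrix ι ι M →* _) (g σ),
    h.1.reindex e, fun σ a => ?_, fun σ τ => ?_⟩
  · have := congrArg (Matrix.reindexAlgEquiv M M e) (h.2.1 σ a)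
    rw [map_mul, map_mul, ← hg] at this
    exact this
  · have := congrArg (Matrix.reindexAlgEquiv M M e) (h.2.2 σ τ)
    rw [map_mul, map_smul, ← hg] at this
    exact this

lemma HasTwistedRep.ne_zero {f : G → G → M} (h : HasTwistedRep F A f) (σ τ : G) :
    f σ τ ≠ 0 := by
  obtain ⟨n, hn, ρ, g, h⟩ := h
  have : Nonempty (Fin n) := ⟨⟨0, hn⟩⟩
  intro h0
  have h1 := h.2.2 σ τ
  rw [h0, zero_smul] at h1
  have : galMap σ (g τ : Matrix (Fin n) (Fin n) M) = 0 := by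
    simpa using congrArg (fun X => ((g σ)⁻¹ : (Matrix (Fin n) (Fin n) M)ˣ).val * X) h1
  have h2 : IsUnit (galMap σ (g τ : Matrix (Fin n) (Fin n) M)) := (g τ).isUnit.map _
  exact h2.ne_zero this

/-- The Galois conjugate of a representation. -/
def galRep [SMulCommClass G F M] (σ : G) (ρ : A →ₐ[F] Matrix ι ι M) : A →ₐ[F] Matrix ι ι M :=
  { (galMap σ).comp ρ.toRingHom with
    commutes' := fun c => by
      ext i j
      by_cases h : i = j <;>
        simp [galMap_apply, Matrix.algebraMap_matrix_apply, h, Algebra.algebraMap_eq_smul_one,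
          smul_comm] }

lemma galRep_apply [SMulCommClass G F M] (σ : G) (ρ : A →ₐ[F] Matrix ι ι M) (a : A) :
    galRep σ ρ a = galMap σ (ρ a) := rfl

lemma IsFullRep.galRep [SMulCommClass G F M] (σ : G) {ρ : A →ₐ[F] Matrix ι ι M}
    (h : IsFullRep ρ) : IsFullRep (galRep σ ρ) := by
  refine ⟨?_, h.2⟩
  rw [eq_top_iff]
  rintro X -
  have hX : galMap σ⁻¹ X ∈ Submodule.span M (Set.range ρ) := h.1 ▸ Submodule.mem_top
  rw [← galMap_inv_apply σ X]
  generalize galMap σ⁻¹ X = Y at hX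
  induction hX using Submodule.span_induction with
  | mem x hx => obtain ⟨a, rfl⟩ := hx; exact Submodule.subset_span ⟨a, rfl⟩
  | zero => simp
  | add x y _ _ hx hy => rw [map_add]; exact Submodule.add_mem _ hx hy
  | smul m x _ hx => rw [galMap_smul]; exact Submodule.smul_mem _ _ hx

/-- Every full representation is twisted by some factor set. -/
lemma IsFullRep.exists_isTwistedRep (G : Type*) [Group G] [MulSemiringAction G M]
    [SMulCommClass G F M] [Nonempty ι]
    {ρ : A →ₐ[F] Matrix ι ι M} (h : IsFullRep ρ) :
    ∃ (g : G → (Matrix ι ι M)ˣ) (f : G → G → M), IsTwistedRep ρ g f := by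
  choose g hg using fun σ : G => (h.galRep σ).exists_conj h
  have key : ∀ σ τ : G, ∃ m : Mˣ, ((g σ * Units.map (galMap σ).toMonoidHom (g τ) :
      (Matrix ι ι M)ˣ) : Matrix ι ι M) = (m : M) • (g (σ * τ) : Matrix ι ι M) := by
    intro σ τ
    refine h.exists_unit_smul (ρ := fun a => galMap (σ * τ) (ρ a)) (ρ' := ρ) (fun _ => rfl)
      (fun a => ?_) (fun a => hg (σ * τ) a)
    have h1 := congrArg (galMap σ) (hg τ a)
    rw [map_mul, map_mul, galRep_apply] at h1
    rw [Units.val_mul, galMap_mul_apply, mul_assoc]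
    refine (congrArg _ h1).trans ?_
    rw [← mul_assoc, ← mul_assoc]
    exact congrArg (· * _) (hg σ a)
  choose f hf using key
  exact ⟨g, fun σ τ => f σ τ, h, hg, fun σ τ => hf σ τ⟩

/-- Two factor sets of the same algebra are cohomologous. -/
lemma HasTwistedRep.exists_coboundary {f f' : G → G → M} (h : HasTwistedRep F A f)
    (h' : HasTwistedRep F A f') :
    ∃ ν : G → M, (∀ σ, ν σ ≠ 0) ∧
      ∀ σ τ, f' σ τ * ν (σ * τ) = f σ τ * (ν σ * σ • ν τ) := by
  obtain ⟨n, hn, ρ, g, hρ, hg, hf⟩ := h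
  obtain ⟨n', hn', ρ', g', hρ', hg', hf'⟩ := h'
  obtain rfl : n = n' := by
    have := hρ.2.symm.trans hρ'.2
    simp only [Fintype.card_fin] at this
    exact Nat.pow_left_injective (n := 2) (by norm_num) this
  have : Nonempty (Fin n) := ⟨⟨0, hn⟩⟩
  obtain ⟨P, hP⟩ := hρ.exists_conj hρ'
  have key : ∀ σ : G, ∃ m : Mˣ, ((g' σ * Units.map (galMap σ).toMonoidHom P :
      (Matrix (Fin n) (Fin n) M)ˣ) : Matrix (Fin n) (Fin n) M)
        = (m : M) • ((P * g σ : (Matrix (Fin n) (Fin n) M)ˣ) : Matrix (Fin n) (Fin n) M) := by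
    intro σ
    refine hρ'.exists_unit_smul (ρ := fun a => galMap σ (ρ a)) (ρ' := ρ') (fun _ => rfl)
      (fun a => ?_) (fun a => ?_)
    · have h1 := congrArg (galMap σ) (hP a)
      rw [map_mul, map_mul] at h1
      rw [Units.val_mul, mul_assoc]
      refine (congrArg _ h1).trans ?_
      rw [← mul_assoc, ← mul_assoc]
      exact congrArg (· * _) (hg' σ a)
    · rw [Units.val_mul, mul_assoc, hg, ← mul_assoc, hP, mul_assoc]
  choose ν hν using key
  have hν' : ∀ σ, (g' σ : Matrix (Fin n) (Fin n) M) * galMap σ (P : Matrix (Fin n) (Fin n) M)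
      = (ν σ : M) • ((P : Matrix (Fin n) (Fin n) M) * g σ) := hν
  refine ⟨fun σ => ν σ, fun σ => (ν σ).ne_zero, fun σ τ => ?_⟩
  have e1 : (g' σ : Matrix (Fin n) (Fin n) M) * galMap σ ((g' τ : Matrix (Fin n) (Fin n) M)
      * galMap τ (P : Matrix (Fin n) (Fin n) M)) = (f' σ τ * (ν (σ * τ) : M)) •
        ((P : Matrix (Fin n) (Fin n) M) * g (σ * τ)) := by
    rw [map_mul, ← mul_assoc, hf', ← galMap_mul_apply, smul_mul_assoc, hν', smul_smul]
  have e2 : (g' σ : Matrix (Fin n) (Fin n) M) * galMap σ ((g' τ : Matrix (Fin n) (Fin n) M)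
      * galMap τ (P : Matrix (Fin n) (Fin n) M)) = (f σ τ * ((ν σ : M) * σ • (ν τ : M))) •
        ((P : Matrix (Fin n) (Fin n) M) * g (σ * τ)) := by
    rw [hν', galMap_smul, map_mul, mul_smul_comm, ← mul_assoc, hν', smul_mul_assoc, mul_assoc, hf,
      mul_smul_comm, smul_smul, smul_smul]
    congr 1; ring
  have e3 := e1.symm.trans e2
  have hne : ((P * g (σ * τ) : (Matrix (Fin n) (Fin n) M)ˣ) : Matrix (Fin n) (Fin n) M) ≠ 0 :=
    Units.ne_zero _
  exact smul_left_injective M hne e3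

/-- Changing the factor set by a coboundary. -/
lemma HasTwistedRep.of_coboundary {f f' : G → G → M} (h : HasTwistedRep F A f)
    {ν : G → M} (hν : ∀ σ, ν σ ≠ 0)
    (hf : ∀ σ τ, f' σ τ * ν (σ * τ) = f σ τ * (ν σ * σ • ν τ)) : HasTwistedRep F A f' := by
  obtain ⟨n, hn, ρ, g, hρ, hg, hf'⟩ := h
  refine ⟨n, hn, ρ, fun σ => Units.map
    (algebraMap M (Matrix (Fin n) (Fin n) M) : M →* _) (Units.mk0 (ν σ) (hν σ)) * g σ,
      hρ, fun σ a => ?_, fun σ τ => ?_⟩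
  · simp [Algebra.algebraMap_eq_smul_one, hg]
  · simp only [Units.val_mul, Units.coe_map, MonoidHom.coe_coe, Units.val_mk0,
      Algebra.algebraMap_eq_smul_one, smul_mul_assoc, one_mul, galMap_smul, mul_smul_comm, hf',
      smul_smul]
    rw [hf]; congr 1; ring

lemma HasTwistedRep.congr {f : G → G → M} (h : HasTwistedRep F A f) (e : A ≃ₐ[F] B) :
    HasTwistedRep F B f := by
  obtain ⟨n, hn, ρ, g, hρ, hg, hf⟩ := h
  refine ⟨n, hn, ρ.comp e.symm.toAlgHom, g, ⟨?_, ?_⟩, fun σ a => hg σ _, hf⟩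
  · rw [← hρ.1]; congr 1
    exact e.symm.surjective.range_comp ρ
  · rw [← hρ.2, e.toLinearEquiv.finrank_eq]

end Twist

section PiKron

variable {F M S G : Type*} [Field F] [Field M] [Algebra F M] [Fintype S] [DecidableEq S]
  {κ : S → Type*} [∀ s, Fintype (κ s)] [∀ s, DecidableEq (κ s)]
  {D : S → Type*} [∀ s, Ring (D s)] [∀ s, Algebra F (D s)] [Group G] [MulSemiringAction G M]

/-- The Kronecker product of a finite family of square matrices. -/
def piKron : (∀ s, Matrix (κ s) (κ s) M) →* Matrix (∀ s, κ s) (∀ s, κ s) M where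
  toFun X := Matrix.of fun x y => ∏ s, X s (x s) (y s)
  map_one' := by
    ext x y
    rw [Matrix.of_apply]
    by_cases h : x = y
    · subst h; simp
    · obtain ⟨s, hs⟩ := Function.ne_iff.mp h
      rw [Matrix.one_apply_ne h]
      exact Finset.prod_eq_zero (Finset.mem_univ s) (Matrix.one_apply_ne hs)
  map_mul' X Y := by
    ext x y
    simp only [Matrix.of_apply, Matrix.mul_apply, Pi.mul_apply]
    rw [Finset.prod_univ_sum]
    simp [Finset.prod_mul_distrib]

lemma piKron_apply (X : ∀ s, Matrix (κ s) (κ s) M) (x y : ∀ s, κ s) :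
    piKron X x y = ∏ s, X s (x s) (y s) := rfl

variable (R : Type*) [CommSemiring R] [Algebra R M] in
/-- The Kronecker product of a family of matrices as a multilinear map. -/
def piKronMultilinear :
    MultilinearMap R (fun s => Matrix (κ s) (κ s) M) (Matrix (∀ s, κ s) (∀ s, κ s) M) where
  toFun X := piKron X
  map_update_add' X s Y Z := by
    ext x y
    simp only [Matrix.add_apply, piKron_apply]
    rw [← Finset.mul_prod_erase _ _ (Finset.mem_univ s), ← Finset.mul_prod_erase _ _
      (Finset.mem_univ s), ← Finset.mul_prod_erase _ _ (Finset.mem_univ s)]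
    simp only [Function.update_self, Matrix.add_apply, add_mul]
    congr 2 <;> exact Finset.prod_congr rfl fun t ht => by
      rw [Function.update_of_ne (Finset.ne_of_mem_erase ht),
        Function.update_of_ne (Finset.ne_of_mem_erase ht)]
  map_update_smul' X s c Y := by
    ext x y
    simp only [Matrix.smul_apply, piKron_apply]
    rw [← Finset.mul_prod_erase _ _ (Finset.mem_univ s), ← Finset.mul_prod_erase _ _
      (Finset.mem_univ s)]
    simp only [Function.update_self, Matrix.smul_apply, smul_mul_assoc]
    congr 2; exact Finset.prod_congr rfl fun t ht => by
      rw [Function.update_of_ne (Finset.ne_of_mem_erase ht),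
        Function.update_of_ne (Finset.ne_of_mem_erase ht)]

lemma piKron_smul (c : S → M) (X : ∀ s, Matrix (κ s) (κ s) M) :
    piKron (fun s => c s • X s) = (∏ s, c s) • piKron X :=
  (piKronMultilinear M).map_smul_univ c X

/-- The tensor product of a family of matrix representations. -/
noncomputable def piRep (ρ : ∀ s, D s →ₐ[F] Matrix (κ s) (κ s) M) :
    (⨂[F] s, D s) →ₐ[F] Matrix (∀ s, κ s) (∀ s, κ s) M :=
  PiTensorProduct.liftAlgHom
    ((piKronMultilinear F).compLinearMap fun s => (ρ s).toLinearMap)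
    (by
      have : (fun s => (ρ s).toLinearMap ((1 : ∀ s, D s) s)) =
        (1 : ∀ s, Matrix (κ s) (κ s) M) := by ext s : 1; simp
      rw [MultilinearMap.compLinearMap_apply, this]
      exact map_one piKron)
    (by
      intro x y
      simp only [MultilinearMap.compLinearMap_apply]
      have : (fun s => (ρ s).toLinearMap ((x * y) s)) =
        (fun s => (ρ s).toLinearMap (x s)) * (fun s => (ρ s).toLinearMap (y s)) := by
          ext s : 1; simp
      rw [this]
      exact map_mul piKron _ _)

lemma piRep_tprod (ρ : ∀ s, D s →ₐ[F] Matrix (κ s) (κ s) M) (d : ∀ s, D s) :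
    piRep ρ (PiTensorProduct.tprod F d) = piKron fun s => ρ s (d s) := by
  simp [piRep, PiTensorProduct.liftAlgHom]
  rfl

lemma IsFullRep.piRep [∀ s, Nonempty (κ s)] {ρ : ∀ s, D s →ₐ[F] Matrix (κ s) (κ s) M}
    (h : ∀ s, IsFullRep (ρ s)) : IsFullRep (piRep ρ) := by
  constructor
  · rw [eq_top_iff]
    have key : ∀ X : ∀ s, Matrix (κ s) (κ s) M,
        piKron X ∈ Submodule.span M (Set.range (_root_.piRep ρ)) := by
      intro X
      have hX : ∀ s, X s ∈ Submodule.span M (Set.range (ρ s)) := fun s =>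
        (h s).1 ▸ Submodule.mem_top
      simp only [Finsupp.mem_span_range_iff_exists_finsupp] at hX
      choose c hc using hX
      have hX' : X = fun s => ∑ d ∈ (c s).support, c s d • ρ s d := by
        ext s : 1; rw [← hc s]; rfl
      rw [hX']
      have := (piKronMultilinear (κ := κ) (M := M) M).map_sum_finset
        (fun s d => c s d • ρ s d) (fun s => (c s).support)
      refine (congrArg (· ∈ _) this).mpr (Submodule.sum_mem _ fun r _ => ?_)
      rw [MultilinearMap.map_smul_univ]
      exact Submodule.smul_mem _ _ (Submodule.subset_span ⟨_, piRep_tprod ρ r⟩)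
    rintro X -
    rw [Matrix.matrix_eq_sum_single X]
    refine Submodule.sum_mem _ fun x _ => Submodule.sum_mem _ fun y _ => ?_
    have : Matrix.single x y (X x y) =
        X x y • piKron fun s => Matrix.single (x s) (y s) (1 : M) := by
      ext u v
      rw [Matrix.smul_apply, piKron_apply]
      by_cases huv : x = u ∧ y = v
      · obtain ⟨rfl, rfl⟩ := huv; simp
      · rw [Matrix.single_apply_of_ne (h := huv)]
        have : ∃ s, ¬ (x s = u s ∧ y s = v s) := by
          by_contra! hcon
          exact huv ⟨funext fun s => (hcon s).1, funext fun s => (hcon s).2⟩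
        obtain ⟨s, hs⟩ := this
        have h0 : ∏ s, Matrix.single (x s) (y s) (1 : M) (u s) (v s) = 0 :=
          Finset.prod_eq_zero (Finset.mem_univ s)
            (Matrix.single_apply_of_ne (x s) (y s) 1 (u s) (v s) hs)
        rw [h0, smul_zero]
    rw [this]
    exact Submodule.smul_mem _ _ (key _)
  · have := fun s => (h s).finite
    rw [Module.finrank_eq_card_basis (Basis.piTensorProduct fun s => Module.finBasis F (D s))]
    simp [(h _).2, Finset.prod_pow]

lemma HasTwistedRep.pi [SMulCommClass G F M] {f : S → G → G → M}
    (h : ∀ s, HasTwistedRep F (D s) (f s)) :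
    HasTwistedRep F (⨂[F] s, D s) (fun σ τ => ∏ s, f s σ τ) := by
  choose n hn ρ g hρ hg hf using h
  have : ∀ s, Nonempty (Fin (n s)) := fun s => ⟨⟨0, hn s⟩⟩
  have hgal : ∀ (σ : G) (X : ∀ s, Matrix (Fin (n s)) (Fin (n s)) M),
      galMap σ (piKron X) = piKron fun s => galMap σ (X s) := by
    intro σ X; ext x y; simp [galMap_apply, piKron_apply, Finset.smul_prod']
  refine IsTwistedRep.hasTwistedRep (ρ := _root_.piRep ρ)
    (g := fun σ => Units.map piKron (MulEquiv.piUnits.symm fun s => g s σ))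
    ⟨IsFullRep.piRep hρ, fun σ a => ?_, fun σ τ => ?_⟩
  · induction a using PiTensorProduct.induction_on with
    | smul_tprod r d =>
      rw [← galRep_apply, map_smul, map_smul, mul_smul_comm, smul_mul_assoc, galRep_apply,
        piRep_tprod, hgal]
      congr 1
      change piKron (fun s => (g s σ : Matrix (Fin (n s)) (Fin (n s)) M)) * piKron _ =
        piKron _ * piKron (fun s => (g s σ : Matrix (Fin (n s)) (Fin (n s)) M))
      rw [← map_mul, ← map_mul]
      congr 1
      ext s : 1
      exact hg s σ (d s)
    | add x y hx hy => rw [map_add, map_add, mul_add, hx, hy, add_mul]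
  · change piKron (fun s => (g s σ : Matrix (Fin (n s)) (Fin (n s)) M))
      * galMap σ (piKron fun s => (g s τ : Matrix (Fin (n s)) (Fin (n s)) M))
      = (∏ s, f s σ τ) • piKron fun s => (g s (σ * τ) : Matrix (Fin (n s)) (Fin (n s)) M)
    rw [hgal, ← map_mul, ← piKron_smul]
    congr 1
    ext s : 1
    exact hf s σ τ

end PiKron

section Bin

open scoped Kronecker

variable {F M A B ι κ G : Type*} [Field F] [Field M] [Algebra F M] [Ring A] [Algebra F A]
  [Ring B] [Algebra F B] [Fintype ι] [DecidableEq ι] [Fintype κ] [DecidableEq κ]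
  [Group G] [MulSemiringAction G M]

/-- The tensor product of two matrix representations. -/
noncomputable def tensorRep (ρ : A →ₐ[F] Matrix ι ι M) (ρ' : B →ₐ[F] Matrix κ κ M) :
    A ⊗[F] B →ₐ[F] Matrix (ι × κ) (ι × κ) M :=
  Algebra.TensorProduct.lift
    (AlgHom.ofLinearMap (((Matrix.kroneckerBilinear (R := F)).flip (1 : Matrix κ κ M)) ∘ₗ
        ρ.toLinearMap)
      (by simp [Matrix.kroneckerBilinear]) (fun x y => by
        simp [Matrix.kroneckerBilinear, ← Matrix.mul_kronecker_mul]))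
    (AlgHom.ofLinearMap ((Matrix.kroneckerBilinear (R := F) (1 : Matrix ι ι M)) ∘ₗ ρ'.toLinearMap)
      (by simp [Matrix.kroneckerBilinear]) (fun x y => by
        simp [Matrix.kroneckerBilinear, ← Matrix.mul_kronecker_mul]))
    (fun a b => by
      simp [Matrix.kroneckerBilinear, Commute, SemiconjBy, ← Matrix.mul_kronecker_mul])

lemma tensorRep_tmul (ρ : A →ₐ[F] Matrix ι ι M) (ρ' : B →ₐ[F] Matrix κ κ M) (a : A) (b : B) :
    tensorRep ρ ρ' (a ⊗ₜ b) = ρ a ⊗ₖ ρ' b := by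
  simp [tensorRep, Matrix.kroneckerBilinear, ← Matrix.mul_kronecker_mul]

lemma IsFullRep.tensorRep [Nonempty ι] [Nonempty κ] {ρ : A →ₐ[F] Matrix ι ι M}
    {ρ' : B →ₐ[F] Matrix κ κ M} (h : IsFullRep ρ) (h' : IsFullRep ρ') :
    IsFullRep (tensorRep ρ ρ') := by
  have := h.finite
  have := h'.finite
  constructor
  · have hle : Submodule.map₂ (Matrix.kroneckerBilinear (R := M)) (⊤ : Submodule M (Matrix ι ι M))
        (⊤ : Submodule M (Matrix κ κ M)) ≤
        Submodule.span M (Set.range (_root_.tensorRep ρ ρ')) := by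
      rw [← h.1, ← h'.1, Submodule.map₂_span_span, Submodule.span_le]
      rintro _ ⟨_, ⟨a, rfl⟩, _, ⟨b, rfl⟩, rfl⟩
      exact Submodule.subset_span ⟨a ⊗ₜ b, tensorRep_tmul ρ ρ' a b⟩
    rw [eq_top_iff]
    rintro X -
    rw [Matrix.matrix_eq_sum_single X]
    refine Submodule.sum_mem _ fun x _ => Submodule.sum_mem _ fun y _ => hle ?_
    have : Matrix.single x y (X x y) = Matrix.kroneckerBilinear (R := M)
        (Matrix.single x.1 y.1 (X x y)) (Matrix.single x.2 y.2 1) := by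
      simp [Matrix.kroneckerBilinear, Matrix.single_kronecker_single]
    rw [this]
    exact Submodule.apply_mem_map₂ _ trivial trivial
  · rw [Module.finrank_tensorProduct, h.2, h'.2]; simp [mul_pow]

lemma galMap_kronecker (σ : G) (X : Matrix ι ι M) (Y : Matrix κ κ M) :
    galMap σ (X ⊗ₖ Y) = galMap σ X ⊗ₖ galMap σ Y := by
  ext x y; simp [galMap_apply, smul_mul']

/-- The Kronecker product of invertible matrices. -/
def kronUnits (X : (Matrix ι ι M)ˣ) (Y : (Matrix κ κ M)ˣ) : (Matrix (ι × κ) (ι × κ) M)ˣ where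
  val := (X : Matrix ι ι M) ⊗ₖ (Y : Matrix κ κ M)
  inv := ((X⁻¹ : (Matrix ι ι M)ˣ) : Matrix ι ι M) ⊗ₖ ((Y⁻¹ : (Matrix κ κ M)ˣ) : Matrix κ κ M)
  val_inv := by rw [← Matrix.mul_kronecker_mul]; simp
  inv_val := by rw [← Matrix.mul_kronecker_mul]; simp

lemma HasTwistedRep.tensor [SMulCommClass G F M] {f f' : G → G → M} (h : HasTwistedRep F A f)
    (h' : HasTwistedRep F B f') :
    HasTwistedRep F (A ⊗[F] B) (fun σ τ => f σ τ * f' σ τ) := by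
  obtain ⟨n, hn, ρ, g, hρ, hg, hf⟩ := h
  obtain ⟨n', hn', ρ', g', hρ', hg', hf'⟩ := h'
  have : Nonempty (Fin n) := ⟨⟨0, hn⟩⟩
  have : Nonempty (Fin n') := ⟨⟨0, hn'⟩⟩
  refine IsTwistedRep.hasTwistedRep (ρ := _root_.tensorRep ρ ρ')
    (g := fun σ => kronUnits (g σ) (g' σ)) ⟨hρ.tensorRep hρ', fun σ t => ?_, fun σ τ => ?_⟩
  · induction t using TensorProduct.induction_on with
    | zero => simp
    | tmul a b =>
      rw [tensorRep_tmul, galMap_kronecker]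
      change ((g σ).val ⊗ₖ (g' σ).val) * _
        = _ * ((g σ).val ⊗ₖ (g' σ).val)
      rw [← Matrix.mul_kronecker_mul, ← Matrix.mul_kronecker_mul, hg, hg']
    | add x y hx hy => rw [map_add, map_add, mul_add, hx, hy, add_mul]
  · change ((g σ).val ⊗ₖ (g' σ).val) *
      galMap σ ((g τ).val ⊗ₖ (g' τ).val) =
      (f σ τ * f' σ τ) • ((g (σ * τ)).val ⊗ₖ (g' (σ * τ)).val)
    rw [galMap_kronecker, ← Matrix.mul_kronecker_mul, hf, hf', Matrix.smul_kronecker,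
      Matrix.kronecker_smul, smul_smul]

/-- The transposed representation of the opposite algebra. -/
noncomputable def opRep (ρ : A →ₐ[F] Matrix ι ι M) : Aᵐᵒᵖ →ₐ[F] Matrix ι ι M :=
  ((Matrix.transposeAlgEquiv ι F M).symm.toAlgHom.comp (AlgHom.op ρ) )

lemma IsFullRep.opRep {ρ : A →ₐ[F] Matrix ι ι M} (h : IsFullRep ρ) : IsFullRep (opRep ρ) := by
  constructor
  · have : Set.range (_root_.opRep ρ) =
        (Matrix.transposeLinearEquiv ι ι M M).toLinearMap '' Set.range ρ := by
      rw [← Set.range_comp]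
      exact MulOpposite.unop_surjective.range_comp (fun a => (ρ a).transpose)
    rw [this, Submodule.span_image, h.1, Submodule.map_top, LinearMap.range_eq_top]
    exact (Matrix.transposeLinearEquiv ι ι M M).surjective
  · rw [← h.2, (MulOpposite.opLinearEquiv F : A ≃ₗ[F] Aᵐᵒᵖ).finrank_eq]

lemma galMap_transpose (σ : G) (X : Matrix ι ι M) :
    galMap σ X.transpose = (galMap σ X).transpose := rfl

/-- The inverse transpose of an invertible matrix. -/
def invTranspose (X : (Matrix ι ι M)ˣ) : (Matrix ι ι M)ˣ where
  val := ((X⁻¹ : (Matrix ι ι M)ˣ) : Matrix ι ι M).transpose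
  inv := (X : Matrix ι ι M).transpose
  val_inv := by rw [← Matrix.transpose_mul]; simp
  inv_val := by rw [← Matrix.transpose_mul]; simp

lemma HasTwistedRep.op {f : G → G → M} (h : HasTwistedRep F A f) :
    HasTwistedRep F Aᵐᵒᵖ (fun σ τ => (f σ τ)⁻¹) := by
  have hne := h.ne_zero
  obtain ⟨n, hn, ρ, g, hρ, hg, hf⟩ := h
  refine ⟨n, hn, _root_.opRep ρ, fun σ => invTranspose (g σ), hρ.opRep, fun σ a => ?_,
    fun σ τ => ?_⟩
  · change ((g σ)⁻¹).val.transpose * galMap σ (ρ a.unop).transpose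
      = (ρ a.unop).transpose * ((g σ)⁻¹).val.transpose
    rw [galMap_transpose, ← Matrix.transpose_mul, ← Matrix.transpose_mul]
    congr 1
    rw [Units.eq_inv_mul_iff_mul_eq, ← mul_assoc, hg, mul_assoc, Units.mul_inv, mul_one]
  · change ((g σ)⁻¹).val.transpose * galMap σ (((g τ)⁻¹).val.transpose)
      = (f σ τ)⁻¹ • ((g (σ * τ))⁻¹).val.transpose
    rw [galMap_transpose, ← Matrix.transpose_mul, ← Matrix.transpose_smul]
    congr 1
    have e1 : (galMap σ ((g τ)⁻¹).val * ((g σ)⁻¹).val) * ((g σ).val * galMap σ (g τ).val) = 1 := by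
      rw [mul_assoc, Units.inv_mul_cancel_left, ← map_mul, Units.inv_mul, map_one]
    rw [hf, mul_smul_comm] at e1
    have e2 := congrArg (fun X => (f σ τ)⁻¹ • (X * ((g (σ * τ))⁻¹).val)) e1
    simp only [smul_mul_assoc, smul_smul, inv_mul_cancel₀ (hne σ τ), one_smul,
      Units.mul_inv_cancel_right, one_mul] at e2
    exact e2

/-- The entrywise inclusion of matrices over the base field. -/
noncomputable def mapRep : Matrix ι ι F →ₐ[F] Matrix ι ι M := (Algebra.ofId F M).mapMatrix

lemma isFullRep_mapRep : IsFullRep (mapRep : Matrix ι ι F →ₐ[F] Matrix ι ι M) := by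
  constructor
  · rw [eq_top_iff]
    rintro X -
    rw [Matrix.matrix_eq_sum_single X]
    refine Submodule.sum_mem _ fun x _ => Submodule.sum_mem _ fun y _ => ?_
    have : Matrix.single x y (X x y) = X x y • (mapRep (Matrix.single x y (1 : F)) :
        Matrix ι ι M) := by
      simp [mapRep, AlgHom.mapMatrix_apply, Matrix.smul_single]
    rw [this]
    exact Submodule.smul_mem _ _ (Submodule.subset_span ⟨_, rfl⟩)
  · rw [Module.finrank_matrix]; simp [sq]

lemma hasTwistedRep_matrix [SMulCommClass G F M] [Nonempty ι] :
    HasTwistedRep F (Matrix ι ι F) (fun _ _ : G => (1 : M)) := by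
  have h1 : IsTwistedRep (mapRep : Matrix ι ι F →ₐ[F] Matrix ι ι M) (fun _ : G => 1)
      (fun _ _ => 1) := by
    refine ⟨isFullRep_mapRep, fun σ a => ?_, fun σ τ => by simp⟩
    have : galMap σ (mapRep a : Matrix ι ι M) = mapRep a := by
      ext i j
      change σ • algebraMap F M (a i j) = algebraMap F M (a i j)
      rw [Algebra.algebraMap_eq_smul_one, smul_comm, smul_one]
    rw [this, Units.val_one, one_mul, mul_one]
  exact h1.hasTwistedRep

lemma HasTwistedRep.matrix [SMulCommClass G F M] [Nonempty ι] {f : G → G → M}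
    (h : HasTwistedRep F A f) : HasTwistedRep F (Matrix ι ι A) f := by
  have := (h.tensor (hasTwistedRep_matrix (ι := ι))).congr (matrixEquivTensor ι F A).symm
  simpa using this

end Bin

section Split

variable {F M A B ι : Type*} [Field F] [Field M] [Algebra F M] [Ring A] [Algebra F A]
  [Ring B] [Algebra F B] [Fintype ι] [DecidableEq ι]

/-- Dedekind independence of the elements of the Galois group. -/
lemma eq_zero_of_sum_mul_apply_eq_zero [Fintype (M ≃ₐ[F] M)] {k : (M ≃ₐ[F] M) → M}
    (h : ∀ c, ∑ τ, k τ * τ c = 0) (τ : M ≃ₐ[F] M) : k τ = 0 := by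
  have hli : LinearIndependent M (fun τ : M ≃ₐ[F] M => (τ : M →* M) : _ → M → M) := by
    have := (linearIndependent_monoidHom M M).comp (fun τ : M ≃ₐ[F] M => (τ : M →* M))
      (fun a b hab => AlgEquiv.ext fun x => DFunLike.congr_fun hab x)
    exact this
  exact Fintype.linearIndependent_iff.mp hli k (by ext c; simpa using h c) τ

/-- Hilbert 90 for the general linear group. -/
lemma exists_unit_mul_galMap_eq [FiniteDimensional F M]
    (g : (M ≃ₐ[F] M) → (Matrix ι ι M)ˣ)
    (hg : ∀ σ τ, (g σ).val * galMap σ (g τ).val = (g (σ * τ)).val) :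
    ∃ P : (Matrix ι ι M)ˣ, ∀ σ, (g σ).val * galMap σ P.val = P.val := by
  have : Fintype (M ≃ₐ[F] M) := Fintype.ofFinite _
  let gv : (M ≃ₐ[F] M) → (ι → M) → (ι → M) := fun τ x i => τ (x i)
  let θ : (ι → M) → (ι → M) := fun x => ∑ τ, (g τ).val.mulVec (gv τ x)
  have hspan : Submodule.span M (Set.range θ) = ⊤ := by
    by_contra hne
    obtain ⟨u, hu, hle⟩ := Submodule.exists_le_ker_of_lt_top _ (lt_top_iff_ne_top.mpr hne)
    have hk : ∀ x τ, u ((g τ).val.mulVec (gv τ x)) = 0 := by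
      intro x
      refine eq_zero_of_sum_mul_apply_eq_zero (k := fun τ => u ((g τ).val.mulVec (gv τ x)))
        fun c => ?_
      have h0 : u (θ (c • x)) = 0 := hle (Submodule.subset_span ⟨_, rfl⟩)
      rw [map_sum] at h0
      rw [← h0]
      refine Finset.sum_congr rfl fun τ _ => ?_
      have : gv τ (c • x) = τ c • gv τ x := by ext i; simp [gv]
      rw [this, Matrix.mulVec_smul, map_smul, smul_eq_mul, mul_comm]
    refine hu (LinearMap.ext fun v => ?_)
    have := hk ((g 1)⁻¹.val.mulVec v) 1
    have h1 : gv 1 ((g 1)⁻¹.val.mulVec v) = (g 1)⁻¹.val.mulVec v := rfl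
    rw [h1, Matrix.mulVec_mulVec, Units.mul_inv, Matrix.one_mulVec] at this
    simpa using this
  let b := Module.Basis.ofSpan hspan.ge
  have : Finite ((linearIndepOn_empty M id).extend (Set.empty_subset (Set.range θ))) :=
    Module.Finite.finite_basis b
  have hb : ∀ i, b i ∈ Set.range θ := fun i => Module.Basis.ofSpan_subset hspan.ge ⟨i, rfl⟩
  let e := b.indexEquiv (Pi.basisFun M ι)
  let c := b.reindex e
  have hc : ∀ i, ∃ x, θ x = c i := fun i => by simpa [c] using hb (e.symm i)
  choose x hx using hc
  let P : Matrix ι ι M := Matrix.of fun i j => c j i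
  have hP : IsUnit P := by
    rw [← Matrix.linearIndependent_cols_iff_isUnit]
    exact c.linearIndependent
  refine ⟨hP.unit, fun σ => ?_⟩
  rw [IsUnit.unit_spec]
  have hX : P = ∑ τ, (g τ).val * galMap τ (Matrix.of fun i j => x j i) := by
    ext i j
    have := congrFun (hx j) i
    simp only [P, Matrix.of_apply, ← this, θ, Finset.sum_apply, Matrix.sum_apply]
    rfl
  rw [hX, map_sum, Finset.mul_sum]
  refine Fintype.sum_equiv (Equiv.mulLeft σ) _ _ fun τ => ?_
  rw [map_mul, ← mul_assoc, hg, ← galMap_mul_apply]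
  rfl

/-- An algebra with trivial factor set is split. -/
lemma HasTwistedRep.exists_algEquiv_matrix [FiniteDimensional F M] [IsGalois F M]
    (h : HasTwistedRep F A (fun _ _ : M ≃ₐ[F] M => (1 : M))) :
    ∃ n : ℕ, 0 < n ∧ Nonempty (A ≃ₐ[F] Matrix (Fin n) (Fin n) F) := by
  obtain ⟨n, hn, ρ, g, hρ, hg, hf⟩ := h
  have : Nonempty (Fin n) := ⟨⟨0, hn⟩⟩
  have := hρ.finite
  obtain ⟨P, hP⟩ := exists_unit_mul_galMap_eq g (fun σ τ => by rw [hf, one_smul])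
  let ι : Matrix (Fin n) (Fin n) F →ₐ[F] Matrix (Fin n) (Fin n) M := mapRep
  have hι : Function.Injective ι := fun X Y hXY => by
    ext i j
    exact (algebraMap F M).injective (congrFun (congrFun hXY i) j)
  have hinv : Function.Injective fun X : Matrix (Fin n) (Fin n) M => P⁻¹.val * X * P.val := by
    intro X Y hXY
    exact (Units.mul_right_inj P⁻¹).mp ((Units.mul_left_inj P).mp hXY)
  let φ : A →ₐ[F] Matrix (Fin n) (Fin n) M :=
    { toFun := fun a => P⁻¹.val * ρ a * P.val
      map_one' := by simp
      map_zero' := by simp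
      map_add' := by simp [mul_add, add_mul]
      map_mul' := fun x y => by
        simp only [map_mul, mul_assoc, Units.mul_inv_cancel_left]
      commutes' := fun r => by
        rw [AlgHom.commutes, mul_assoc, Algebra.commutes, ← mul_assoc, Units.inv_mul, one_mul] }
  have hφ : ∀ a, φ a ∈ ι.range := by
    intro a
    have hfix : ∀ σ : M ≃ₐ[F] M, galMap σ (φ a) = φ a := by
      intro σ
      have e1 : galMap σ P.val * galMap σ (φ a) = galMap σ (ρ a) * galMap σ P.val := by
        rw [← map_mul, ← map_mul]
        congr 1
        simp [φ, mul_assoc]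
      have e2 : P.val * galMap σ (φ a) = ρ a * P.val := by
        rw [← hP σ, mul_assoc, e1, ← mul_assoc, hg, mul_assoc]
      change _ = P⁻¹.val * ρ a * P.val
      rw [mul_assoc, ← e2, Units.inv_mul_cancel_left]
    have hent : ∀ i j, ∃ c : F, algebraMap F M c = φ a i j := by
      intro i j
      have : φ a i j ∈ Set.range (algebraMap F M) :=
        (IsGalois.mem_range_algebraMap_iff_fixed _).mpr fun σ =>
          congrFun (congrFun (hfix σ) i) j
      exact this
    choose c hc using hent
    exact ⟨Matrix.of c, by ext i j; exact hc i j⟩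
  let ψ : A →ₐ[F] Matrix (Fin n) (Fin n) F :=
    (AlgEquiv.ofInjective ι hι).symm.toAlgHom.comp (φ.codRestrict _ hφ)
  have hψ : Function.Injective ψ := by
    refine (AlgEquiv.ofInjective ι hι).symm.injective.comp ?_
    intro a b hab
    exact hρ.injective (hinv (congrArg Subtype.val hab))
  have hfr : Module.finrank F A = Module.finrank F (Matrix (Fin n) (Fin n) F) := by
    rw [hρ.2, Module.finrank_matrix]; simp [sq]
  have hbij : Function.Bijective ψ :=
    ⟨hψ, (LinearMap.injective_iff_surjective_of_finrank_eq_finrank hfr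
      (f := ψ.toLinearMap)).mp hψ⟩
  exact ⟨n, hn, ⟨AlgEquiv.ofBijective ψ hbij⟩⟩

/-- Algebras with the same factor set are Brauer equivalent. -/
lemma HasTwistedRep.exists_matrix_algEquiv_matrix [FiniteDimensional F M] [IsGalois F M]
    {f : (M ≃ₐ[F] M) → (M ≃ₐ[F] M) → M} (hA : HasTwistedRep F A f) (hB : HasTwistedRep F B f) :
    ∃ n m : ℕ, 0 < n ∧ 0 < m ∧
      Nonempty ((Matrix (Fin n) (Fin n) A) ≃ₐ[F] (Matrix (Fin m) (Fin m) B)) := by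
  have hne := hA.ne_zero
  have h1 := hA.tensor hB.op
  have h2 := hB.tensor hB.op
  simp only [mul_inv_cancel₀ (hne _ _)] at h1 h2
  obtain ⟨r, hr, ⟨e1⟩⟩ := h1.exists_algEquiv_matrix
  obtain ⟨s, hs, ⟨e2⟩⟩ := h2.exists_algEquiv_matrix
  refine ⟨s, r, hs, hr, ⟨?_⟩⟩
  exact (matrixEquivTensor (Fin s) F A).trans <|
    (Algebra.TensorProduct.congr AlgEquiv.refl
      (e2.symm.trans (Algebra.TensorProduct.comm F B Bᵐᵒᵖ))).trans <|
    (Algebra.TensorProduct.assoc F F F A Bᵐᵒᵖ B).symm.trans <|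
    (Algebra.TensorProduct.congr e1 AlgEquiv.refl).trans <|
    (Algebra.TensorProduct.comm F _ B).trans (matrixEquivTensor (Fin r) F B).symm

end Split

section Change

variable {F₀ F M M' A B ι G G' : Type*} [Field F₀] [Field F] [Field M] [Algebra F M]
  [Algebra F₀ F] [Algebra F₀ M] [IsScalarTower F₀ F M] [Field M'] [Algebra F M']
  [Ring A] [Algebra F A] [Ring B] [Algebra F₀ B]
  [Group G] [MulSemiringAction G M] [Group G'] [MulSemiringAction G' M']
  [Fintype ι] [DecidableEq ι]

/-- Extension of scalars of a matrix representation to an intermediate field. -/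
noncomputable def baseRep (F : Type*) [Field F] [Algebra F M] [Algebra F₀ F]
    [IsScalarTower F₀ F M] (ρ : B →ₐ[F₀] Matrix ι ι M) : F ⊗[F₀] B →ₐ[F] Matrix ι ι M :=
  Algebra.TensorProduct.lift (Algebra.ofId F _) ρ fun m a =>
    show Commute (algebraMap F _ m) (ρ a) from Algebra.commutes m (ρ a)

lemma baseRep_tmul (ρ : B →ₐ[F₀] Matrix ι ι M) (c : F) (b : B) :
    baseRep F ρ (c ⊗ₜ b) = c • ρ b := by
  rw [Algebra.smul_def]
  exact Algebra.TensorProduct.lift_tmul _ _ _ c b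

lemma IsFullRep.baseRep {ρ : B →ₐ[F₀] Matrix ι ι M} (h : IsFullRep ρ) :
    IsFullRep (baseRep F ρ) := by
  refine ⟨?_, by rw [Module.finrank_baseChange, h.2]⟩
  rw [eq_top_iff, ← h.1, Submodule.span_le]
  rintro _ ⟨b, rfl⟩
  exact Submodule.subset_span ⟨1 ⊗ₜ b, by rw [baseRep_tmul, one_smul]⟩

lemma IsTwistedRep.baseRep [SMulCommClass G F M] {ρ : B →ₐ[F₀] Matrix ι ι M}
    {g : G → (Matrix ι ι M)ˣ} {f : G → G → M} (h : IsTwistedRep ρ g f) :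
    IsTwistedRep (baseRep F ρ) g f := by
  refine ⟨h.1.baseRep, fun σ t => ?_, h.2.2⟩
  induction t using TensorProduct.induction_on with
  | zero => simp
  | tmul c b =>
    have : galMap σ (c • ρ b) = c • galMap σ (ρ b) := by
      ext i j; simp [galMap_apply, smul_comm]
    rw [baseRep_tmul, this, mul_smul_comm, smul_mul_assoc, h.2.1]
  | add x y hx hy => rw [map_add, map_add, mul_add, hx, hy, add_mul]

/-- Restriction of a full representation of a scalar extension. -/
lemma IsFullRep.comp_includeRight {ρ : F ⊗[F₀] B →ₐ[F] Matrix ι ι M} (h : IsFullRep ρ) :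
    IsFullRep ((ρ.restrictScalars F₀).comp
      (Algebra.TensorProduct.includeRight : B →ₐ[F₀] F ⊗[F₀] B)) := by
  refine ⟨?_, by rw [← h.2, Module.finrank_baseChange]⟩
  rw [eq_top_iff, ← h.1, Submodule.span_le]
  rintro _ ⟨t, rfl⟩
  induction t using TensorProduct.induction_on with
  | zero => simp
  | tmul c b =>
    have : ρ (c ⊗ₜ b) = algebraMap F M c • ρ (1 ⊗ₜ b) := by
      rw [algebraMap_smul, ← map_smul, TensorProduct.smul_tmul', smul_eq_mul, mul_one]
    rw [this]
    exact Submodule.smul_mem _ _ (Submodule.subset_span ⟨b, rfl⟩)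
  | add x y hx hy => rw [map_add]; exact Submodule.add_mem _ hx hy

/-- Inflation of factor sets along an extension of splitting fields. -/
lemma IsTwistedRep.inflate {ρ : A →ₐ[F] Matrix ι ι M} {g : G → (Matrix ι ι M)ˣ} {f : G → G → M}
    (h : IsTwistedRep ρ g f) (j : M →ₐ[F] M') (π : G' →* G)
    (hj : ∀ σ m, j (π σ • m) = σ • j m) :
    IsTwistedRep (j.mapMatrix.comp ρ)
      (fun σ => Units.map j.mapMatrix.toRingHom.toMonoidHom (g (π σ)))
      (fun σ τ => j (f (π σ) (π τ))) := by
  have hgal : ∀ σ (X : Matrix ι ι M), galMap σ (j.mapMatrix X) = j.mapMatrix (galMap (π σ) X) := by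
    intro σ X; ext a b
    exact (hj σ (X a b)).symm
  have hsm : ∀ (m : M) (X : Matrix ι ι M), j.mapMatrix (m • X) = j m • j.mapMatrix X := by
    intro m X; ext a b; simp
  refine ⟨⟨?_, h.1.2⟩, fun σ a => ?_, fun σ τ => ?_⟩
  · have key : ∀ X : Matrix ι ι M, j.mapMatrix X ∈
        Submodule.span M' (Set.range (j.mapMatrix.comp ρ)) := by
      intro X
      have hX : X ∈ Submodule.span M (Set.range ρ) := h.1.1 ▸ Submodule.mem_top
      induction hX using Submodule.span_induction with
      | mem x hx => obtain ⟨a, rfl⟩ := hx; exact Submodule.subset_span ⟨a, rfl⟩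
      | zero => simp
      | add x y _ _ hx hy => rw [map_add]; exact Submodule.add_mem _ hx hy
      | smul m x _ hx => rw [hsm]; exact Submodule.smul_mem _ _ hx
    rw [eq_top_iff]
    rintro X -
    rw [Matrix.matrix_eq_sum_single X]
    refine Submodule.sum_mem _ fun x _ => Submodule.sum_mem _ fun y _ => ?_
    have : Matrix.single x y (X x y) = X x y • j.mapMatrix (Matrix.single x y (1 : M)) := by
      simp [AlgHom.mapMatrix_apply, Matrix.smul_single]
    rw [this]
    exact Submodule.smul_mem _ _ (key _)
  · change j.mapMatrix (g (π σ)).val * galMap σ (j.mapMatrix (ρ a))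
      = j.mapMatrix (ρ a) * j.mapMatrix (g (π σ)).val
    rw [hgal, ← map_mul, h.2.1, map_mul]
  · change j.mapMatrix (g (π σ)).val * galMap σ (j.mapMatrix (g (π τ)).val)
      = _ • j.mapMatrix (g (π (σ * τ))).val
    rw [hgal, ← map_mul, h.2.2, hsm, map_mul]

lemma HasTwistedRep.inflate {f : G → G → M} (h : HasTwistedRep F A f) (j : M →ₐ[F] M')
    (π : G' →* G) (hj : ∀ σ m, j (π σ • m) = σ • j m) :
    HasTwistedRep F A (fun σ τ => j (f (π σ) (π τ))) := by
  obtain ⟨n, hn, ρ, g, h⟩ := h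
  exact ⟨n, hn, _, _, h.inflate j π hj⟩

end Change

section Corner

variable {F M A ι κ : Type*} [Field F] [Field M] [Algebra F M]
  [Ring A] [Algebra F A] [Fintype ι] [DecidableEq ι] [Fintype κ] [DecidableEq κ]

/-- A full representation of a matrix algebra over `A` induces one of `A`. -/
lemma IsFullRep.exists_of_matrix [Nonempty ι] [Nonempty κ]
    {ρ : Matrix κ κ A →ₐ[F] Matrix ι ι M} (h : IsFullRep ρ) :
    ∃ n : ℕ, 0 < n ∧ ∃ ρ' : A →ₐ[F] Matrix (Fin n) (Fin n) M, IsFullRep ρ' := by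
  have := h.finite
  let k : κ := Classical.arbitrary κ
  let t := (Matrix.toLinAlgEquiv' : Matrix ι ι M ≃ₐ[M] Module.End M (ι → M))
  let T : Matrix κ κ A → Module.End M (ι → M) := fun X => t (ρ X)
  have hTm : ∀ X Y, T (X * Y) = T X * T Y := fun X Y => by simp [T]
  let E : A → Matrix κ κ A := fun a => Matrix.single k k a
  have hE : ∀ a b, E a * E b = E (a * b) := fun a b => by simp [E]
  let W : Submodule M (ι → M) := LinearMap.range (T (E 1))
  have hW : ∀ v ∈ W, T (E 1) v = v := by
    rintro _ ⟨v, rfl⟩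
    rw [← Module.End.mul_apply, ← hTm, hE, one_mul]
  have hEW : ∀ a v, T (E a) v ∈ W := fun a v => by
    refine ⟨T (E a) v, ?_⟩
    rw [← Module.End.mul_apply, ← hTm, hE, one_mul]
  let ψ : A →ₐ[F] Module.End M W :=
    { toFun := fun a => (T (E a)).restrict (fun v _ => hEW a v)
      map_one' := LinearMap.ext fun v => Subtype.ext (hW v v.2)
      map_mul' := fun a b => LinearMap.ext fun v => Subtype.ext (by
        simp [LinearMap.restrict_apply, ← hE, hTm])
      map_zero' := LinearMap.ext fun v => Subtype.ext (by simp [LinearMap.restrict_apply, E, T])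
      map_add' := fun a b => LinearMap.ext fun v => Subtype.ext (by
        simp [LinearMap.restrict_apply, E, T, Matrix.single_add])
      commutes' := fun c => LinearMap.ext fun v => Subtype.ext (by
        have h1 : E (algebraMap F A c) = c • E 1 := by
          simp [E, Algebra.algebraMap_eq_smul_one]
        have h2 : T (c • E 1) = c • T (E 1) := by
          ext; simp [T, Matrix.toLinAlgEquiv'_apply, t]
        simp only [LinearMap.restrict_apply, h1, h2, LinearMap.smul_apply, hW v v.2]
        rw [Algebra.algebraMap_eq_smul_one]
        rfl) }
  have hψ : ∀ a (v : W), ((ψ a v : W) : ι → M) = T (E a) v := fun a v => rfl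
  let b := Module.finBasis M W
  let t' := LinearMap.toMatrixAlgEquiv b
  let ρ' : A →ₐ[F] Matrix (Fin (Module.finrank M W)) (Fin (Module.finrank M W)) M :=
    (t'.toAlgHom.restrictScalars F).comp ψ
  let Ψ : M ⊗[F] A →ₗ[M] Module.End M W := t'.symm.toLinearMap ∘ₗ (scalarExt ρ').toLinearMap
  have hΨ : ∀ m a, Ψ (m ⊗ₜ a) = m • ψ a := by
    intro m a
    have : t'.symm (m • t' (ψ a)) = m • ψ a := by rw [map_smul, AlgEquiv.symm_apply_apply]
    rw [← this]
    exact congrArg t'.symm (scalarExt_tmul ρ' m a)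
  let Φ : M ⊗[F] Matrix κ κ A →ₗ[M] Module.End M (ι → M) :=
    t.toLinearMap ∘ₗ (scalarExt ρ).toLinearMap
  have hΦ : ∀ m X, Φ (m ⊗ₜ X) = m • T X := by
    intro m X
    have : t (m • ρ X) = m • T X := by rw [map_smul]
    rw [← this]
    exact congrArg t (scalarExt_tmul ρ m X)
  have hΦb : Function.Bijective Φ := t.bijective.comp h.bijective
  let sg : A →ₗ[F] Matrix κ κ A := Matrix.singleLinearMap F k k
  let en : Matrix κ κ A →ₗ[F] A := Matrix.entryLinearMap F A k k
  have hin : ∀ x, Φ (sg.baseChange M x) * T (E 1) = Φ (sg.baseChange M x) := by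
    intro x
    induction x using TensorProduct.induction_on with
    | zero => simp
    | tmul m a =>
      rw [LinearMap.baseChange_tmul, hΦ, smul_mul_assoc, ← hTm]
      exact congrArg (fun Y => m • T Y) ((hE a 1).trans (congrArg E (mul_one a)))
    | add x y hx hy => rw [map_add, map_add, add_mul, hx, hy]
  have hres : ∀ x (v : W), ((Ψ x v : W) : ι → M) = Φ (sg.baseChange M x) v := by
    intro x v
    induction x using TensorProduct.induction_on with
    | zero => simp
    | tmul m a =>
      rw [LinearMap.baseChange_tmul, hΦ, hΨ]
      rfl
    | add x y hx hy => simp only [map_add, LinearMap.add_apply, Submodule.coe_add, hx, hy]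
  have hcomp : ∀ z (v : W), ((Ψ (en.baseChange M z) v : W) : ι → M) = T (E 1) (Φ z v) := by
    intro z v
    induction z using TensorProduct.induction_on with
    | zero => simp
    | tmul m X =>
      rw [LinearMap.baseChange_tmul, hΦ, hΨ]
      have e1 : E 1 * X * E 1 = E (X k k) := by simp [E]
      have e2 : T (E (X k k)) v = T (E 1) (T X v) := by
        rw [← e1, hTm, hTm, Module.End.mul_apply, Module.End.mul_apply, hW v v.2]
      simp only [LinearMap.smul_apply, map_smul, ← e2]
      rfl
    | add x y hx hy =>
      simp only [map_add, LinearMap.add_apply, Submodule.coe_add, hx, hy]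
  have hΨb : Function.Bijective Ψ := by
    constructor
    · refine (injective_iff_map_eq_zero Ψ).mpr fun x hx => ?_
      have h0 : Φ (sg.baseChange M x) = 0 := by
        rw [← hin]
        refine LinearMap.ext fun v => ?_
        have := hres x ⟨T (E 1) v, hEW 1 v⟩
        rw [hx] at this
        exact this.symm
      have h1 : sg.baseChange M x = 0 := hΦb.1 (h0.trans (map_zero Φ).symm)
      have h2 : en ∘ₗ sg = LinearMap.id := by
        ext a; simp [en, sg, Matrix.singleLinearMap]
      have h3 := congrArg (en.baseChange M) h1
      rw [map_zero, ← LinearMap.comp_apply, ← LinearMap.baseChange_comp, h2,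
        LinearMap.baseChange_id] at h3
      exact h3
    · intro S
      obtain ⟨z, hz⟩ := hΦb.2 (W.subtype ∘ₗ S ∘ₗ (T (E 1)).rangeRestrict)
      refine ⟨en.baseChange M z, LinearMap.ext fun v => Subtype.ext ?_⟩
      rw [hcomp, hz]
      have : (T (E 1)).rangeRestrict v = v := Subtype.ext (hW v v.2)
      change T (E 1) (S ((T (E 1)).rangeRestrict v)) = S v
      rw [this]
      exact hW _ (S v).2
  have hfull : IsFullRep ρ' := by
    refine IsFullRep.of_bijective ?_
    have := t'.bijective.comp hΨb
    have heq : (t' ∘ Ψ : M ⊗[F] A → _) = scalarExt ρ' := by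
      ext1 x; exact AlgEquiv.apply_symm_apply t' _
    exact heq ▸ this
  refine ⟨Module.finrank M W, Nat.pos_of_ne_zero fun h0 => ?_, ρ', hfull⟩
  have h1 := hfull.2
  have h2 := h.2
  rw [Module.finrank_matrix, h1, Fintype.card_fin, h0] at h2
  have h3 : 0 < Fintype.card ι := Fintype.card_pos
  exact (pow_pos h3 2).ne' (by rw [← h2]; simp)

end Corner

section Carry

variable {p : ℕ}

/-- The carry in the addition of two residues modulo `p`. -/
def carry (a c : ZMod p) : ℕ := (a.val + c.val) / p

lemma val_add_carry [NeZero p] (a c : ZMod p) : (a + c).val + p * carry a c = a.val + c.val := by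
  rw [ZMod.val_add, carry, Nat.mod_add_div]

lemma carry_comm (a c : ZMod p) : carry a c = carry c a := by
  rw [carry, carry, add_comm]

lemma carry_add_carry [NeZero p] (a c k : ZMod p) :
    carry a c + carry (a + c) k = carry c k + carry a (c + k) := by
  have h1 := val_add_carry a c
  have h2 := val_add_carry (a + c) k
  have h3 := val_add_carry c k
  have h4 := val_add_carry a (c + k)
  rw [add_assoc a c k] at h2
  refine Nat.eq_of_mul_eq_mul_left (Nat.pos_of_neZero p) ?_
  rw [mul_add, mul_add]
  omega

lemma carry_zero_right [NeZero p] (a : ZMod p) : carry a 0 = 0 := by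
  rw [carry, ZMod.val_zero, add_zero, Nat.div_eq_of_lt a.val_lt]

end Carry

section MonomialMatrix

variable {p : ℕ} [hp : Fact p.Prime] {M : Type*} [Field M]

/-- The monomial matrix sending the basis vector `k` to `b ^ carry k a` times the basis
vector `k + a`. -/
def shiftMatrix (b : M) (a : ZMod p) : Matrix (ZMod p) (ZMod p) M :=
  fun r k => if r = k + a then b ^ carry k a else 0

lemma shiftMatrix_mul (b : M) (a c : ZMod p) :
    shiftMatrix b a * shiftMatrix b c = b ^ carry a c • shiftMatrix b (a + c) := by
  ext r k
  rw [Matrix.mul_apply, Finset.sum_eq_single (k + c)]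
  · simp only [shiftMatrix, Matrix.smul_apply, smul_eq_mul, if_true]
    rw [show k + c + a = k + (a + c) by ring]
    split_ifs
    · rw [← pow_add, ← pow_add, add_comm, carry_add_carry, carry_comm c a, add_comm c a]
    · simp
  · intro x _ hx
    simp [shiftMatrix, hx]
  · simp

lemma shiftMatrix_zero (b : M) : shiftMatrix b (0 : ZMod p) = 1 := by
  ext r k
  simp [shiftMatrix, carry_zero_right, Matrix.one_apply]

lemma shiftMatrix_one_pow (b : M) {n : ℕ} (hn : n < p) :
    shiftMatrix b (1 : ZMod p) ^ n = shiftMatrix b (n : ZMod p) := by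
  induction n with
  | zero => simp [shiftMatrix_zero]
  | succ n ih =>
    have := Fact.mk hp.out.one_lt
    rw [pow_succ, ih (by omega), shiftMatrix_mul, carry, ZMod.val_natCast_of_lt (by omega),
      ZMod.val_one, Nat.div_eq_of_lt hn, pow_zero, one_smul, Nat.cast_succ]

lemma shiftMatrix_one_pow_val (b : M) (a : ZMod p) :
    shiftMatrix b (1 : ZMod p) ^ a.val = shiftMatrix b a := by
  rw [shiftMatrix_one_pow b a.val_lt, ZMod.natCast_zmod_val]

lemma shiftMatrix_one_pow_prime (b : M) :
    shiftMatrix b (1 : ZMod p) ^ p = algebraMap M _ b := by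
  have h1 := Fact.mk hp.out.one_lt
  obtain ⟨q, rfl⟩ : ∃ q, p = q + 1 := ⟨p - 1, by have := hp.out.pos; omega⟩
  have hq : ((q : ZMod (q + 1)) + 1) = 0 := by exact_mod_cast ZMod.natCast_self (q + 1)
  rw [pow_succ, shiftMatrix_one_pow b (Nat.lt_succ_self q), shiftMatrix_mul, carry,
    ZMod.val_natCast_of_lt (Nat.lt_succ_self q), ZMod.val_one, Nat.div_self (Nat.succ_pos q),
    pow_one, hq, shiftMatrix_zero, Algebra.algebraMap_eq_smul_one]

/-- The monomial matrix as a unit. -/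
def shiftUnit (b : M) (hb : b ≠ 0) (a : ZMod p) : (Matrix (ZMod p) (ZMod p) M)ˣ where
  val := shiftMatrix b a
  inv := (b ^ carry a (-a))⁻¹ • shiftMatrix b (-a)
  val_inv := by
    rw [mul_smul_comm, shiftMatrix_mul, smul_smul, inv_mul_cancel₀ (pow_ne_zero _ hb), one_smul,
      add_neg_cancel, shiftMatrix_zero]
  inv_val := by
    rw [smul_mul_assoc, shiftMatrix_mul, smul_smul, carry_comm,
      inv_mul_cancel₀ (pow_ne_zero _ hb), one_smul, neg_add_cancel, shiftMatrix_zero]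

variable [CharP M p]

/-- The diagonal matrix with entries `y + k`. -/
def asMatrix (y : M) : Matrix (ZMod p) (ZMod p) M :=
  Matrix.diagonal fun k => y + ZMod.castHom dvd_rfl M k

lemma shiftMatrix_mul_asMatrix (b y : M) (a : ZMod p) :
    shiftMatrix b a * asMatrix (y + ZMod.castHom dvd_rfl M a)
      = asMatrix y * shiftMatrix b a := by
  ext r k
  rw [asMatrix, asMatrix, Matrix.mul_diagonal, Matrix.diagonal_mul, shiftMatrix]
  split_ifs with h
  · rw [h, map_add]; ring
  · simp

lemma castHom_pow_prime (k : ZMod p) :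
    (ZMod.castHom dvd_rfl M k) ^ p = ZMod.castHom dvd_rfl M k := by
  rw [← map_pow, ZMod.pow_card]

lemma asMatrix_pow_sub (y : M) :
    (asMatrix y : Matrix (ZMod p) (ZMod p) M) ^ p - asMatrix y = algebraMap M _ (y ^ p - y) := by
  rw [asMatrix, Matrix.diagonal_pow, Matrix.diagonal_sub, Matrix.algebraMap_eq_diagonal]
  congr 1
  ext k
  have : (y + ZMod.castHom dvd_rfl M k) ^ p = y ^ p + ZMod.castHom dvd_rfl M k := by
    rw [add_pow_expChar_of_commute, castHom_pow_prime]
    exact Commute.all _ _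
  simp only [Pi.pow_apply, Pi.algebraMap_apply, Algebra.algebraMap_self, RingHom.id_apply] at this ⊢
  rw [this]; ring

lemma shiftMatrix_one_mul_asMatrix (b y : M) :
    shiftMatrix b (1 : ZMod p) * asMatrix y = (asMatrix y - 1) * shiftMatrix b (1 : ZMod p) := by
  have : asMatrix y - 1 = (asMatrix (y - 1) : Matrix (ZMod p) (ZMod p) M) := by
    rw [asMatrix, asMatrix, ← Matrix.diagonal_one, Matrix.diagonal_sub]
    congr 1; ext k; ring
  rw [this, ← shiftMatrix_mul_asMatrix, map_one, sub_add_cancel]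

/-- The monomial matrices and the powers of the diagonal matrix span all matrices. -/
lemma span_shiftMatrix_mul_pow {b y : M} (hb : b ≠ 0) (W : Submodule M (Matrix (ZMod p) (ZMod p) M))
    (hW : ∀ (a : ZMod p) (n : ℕ), shiftMatrix b a * asMatrix y ^ n ∈ W) : W = ⊤ := by
  have hinj : Function.Injective fun k : ZMod p => y + ZMod.castHom dvd_rfl M k := fun k l h =>
    (ZMod.castHom dvd_rfl M).injective (add_left_cancel h)
  have hpoly : ∀ (a : ZMod p) (q : Polynomial M),
      shiftMatrix b a * Polynomial.aeval (asMatrix y) q ∈ W := by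
    intro a q
    induction q using Polynomial.induction_on' with
    | add q r hq hr => rw [map_add, mul_add]; exact W.add_mem hq hr
    | monomial n c =>
      rw [Polynomial.aeval_monomial, ← Algebra.smul_def, mul_smul_comm]
      exact W.smul_mem _ (hW a n)
  have haeval : ∀ q : Polynomial M, Polynomial.aeval (asMatrix y : Matrix (ZMod p) (ZMod p) M) q
      = Matrix.diagonal fun k => q.eval (y + ZMod.castHom dvd_rfl M k) := by
    intro q
    induction q using Polynomial.induction_on' with
    | add q r hq hr => rw [map_add, hq, hr, Matrix.diagonal_add]; simp
    | monomial n c =>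
      rw [Polynomial.aeval_monomial, asMatrix, Matrix.diagonal_pow, Matrix.algebraMap_eq_diagonal,
        Matrix.diagonal_mul_diagonal]
      congr 1; ext k; simp
  have hsingle : ∀ r k : ZMod p, Matrix.single r k (1 : M) ∈ W := by
    intro r k
    have h := hpoly (r - k) (Lagrange.basis Finset.univ
      (fun k : ZMod p => y + ZMod.castHom dvd_rfl M k) k)
    rw [haeval] at h
    convert W.smul_mem (b ^ carry k (r - k))⁻¹ h using 1
    ext r' k'
    rw [Matrix.smul_apply, Matrix.mul_diagonal, shiftMatrix]
    by_cases hk : k' = k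
    · subst hk
      have h1 := Lagrange.eval_basis_self (s := Finset.univ) (i := k') hinj.injOn
        (Finset.mem_univ _)
      rw [h1]
      by_cases hr : r' = r
      · subst hr
        simp [hb]
      · have : ¬ r' = k' + (r - k') := fun h => hr (by rw [h]; ring)
        rw [if_neg this, Matrix.single_apply_of_row_ne (Ne.symm hr)]; simp
    · have h1 := Lagrange.eval_basis_of_ne (s := Finset.univ)
        (v := fun k : ZMod p => y + ZMod.castHom dvd_rfl M k) (Ne.symm hk) (Finset.mem_univ k')
      rw [h1, Matrix.single_apply_of_col_ne _ _ (Ne.symm hk)]; simp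
  rw [eq_top_iff]
  rintro X -
  rw [Matrix.matrix_eq_sum_single X]
  refine W.sum_mem fun r _ => W.sum_mem fun k _ => ?_
  have := W.smul_mem (X r k) (hsingle r k)
  rwa [Matrix.smul_single, smul_eq_mul, mul_one] at this

end MonomialMatrix

section NormalOrder

variable {p : ℕ} [hp : Fact p.Prime] {F D : Type*} [Field F] [Ring D] [Algebra F D]

lemma mem_span_pow_of_mem_adjoin {i : D} {a : F} (hi : i ^ p - i = algebraMap F D a) {x : D}
    (hx : x ∈ Algebra.adjoin F {i}) :
    x ∈ Submodule.span F (Set.range fun l : Fin p => i ^ (l : ℕ)) := by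
  have h1 := hp.out.one_lt
  set V := Submodule.span F (Set.range fun l : Fin p => i ^ (l : ℕ)) with hV
  have hmem : ∀ l < p, i ^ l ∈ V := fun l hl => Submodule.subset_span ⟨⟨l, hl⟩, rfl⟩
  have hmul : ∀ v ∈ V, i * v ∈ V := by
    intro v hv
    induction hv using Submodule.span_induction with
    | mem x hx =>
      obtain ⟨l, rfl⟩ := hx
      simp only
      rw [← pow_succ']
      rcases Nat.lt_or_ge (l + 1) p with h | h
      · exact hmem _ h
      · rw [show (l : ℕ) + 1 = p by omega, sub_eq_iff_eq_add.mp hi,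
          Algebra.algebraMap_eq_smul_one, ← pow_zero i]
        exact V.add_mem (V.smul_mem _ (hmem 0 (by omega))) (by simpa using hmem 1 h1)
    | zero => simp
    | add x y _ _ hx hy => rw [mul_add]; exact V.add_mem hx hy
    | smul c x _ hx => rw [mul_smul_comm]; exact V.smul_mem _ hx
  have key : ∀ v ∈ V, x * v ∈ V := by
    induction hx using Algebra.adjoin_induction with
    | mem x hx => rw [Set.mem_singleton_iff.mp hx]; exact hmul
    | algebraMap r => intro v hv; rw [← Algebra.smul_def]; exact V.smul_mem _ hv
    | add x y _ _ hx hy => intro v hv; rw [add_mul]; exact V.add_mem (hx v hv) (hy v hv)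
    | mul x y _ _ hx hy => intro v hv; rw [mul_assoc]; exact hx _ (hy v hv)
  simpa using key 1 (by simpa using hmem 0 (by omega))

lemma mem_span_pow_mul_pow_of_mem_adjoin {i j : D} {a b : F}
    (hi : i ^ p - i = algebraMap F D a) (hj : j ^ p = algebraMap F D b)
    (hij : j * i = (i - 1) * j) {x : D} (hx : x ∈ Algebra.adjoin F {i, j}) :
    x ∈ Submodule.span F (Set.range fun l : Fin p × Fin p => i ^ (l.1 : ℕ) * j ^ (l.2 : ℕ)) := by
  set W := Submodule.span F (Set.range fun l : Fin p × Fin p => i ^ (l.1 : ℕ) * j ^ (l.2 : ℕ))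
    with hW
  have h1 := hp.out.one_lt
  have hV : ∀ v ∈ Algebra.adjoin F {i}, ∀ k < p, v * j ^ k ∈ W := by
    intro v hv k hk
    have := mem_span_pow_of_mem_adjoin hi hv
    clear hv
    induction this using Submodule.span_induction with
    | mem x hx => obtain ⟨l, rfl⟩ := hx; exact Submodule.subset_span ⟨(l, ⟨k, hk⟩), rfl⟩
    | zero => simp
    | add x y _ _ hx hy => rw [add_mul]; exact W.add_mem hx hy
    | smul c x _ hx => rw [smul_mul_assoc]; exact W.smul_mem _ hx
  have hi1 : i ∈ Algebra.adjoin F {i} := Algebra.self_mem_adjoin_singleton F i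
  have hjpow : ∀ n : ℕ, j * i ^ n = (i - 1) ^ n * j := by
    intro n
    induction n with
    | zero => simp
    | succ n ih => rw [pow_succ, ← mul_assoc, ih, mul_assoc, hij, ← mul_assoc, ← pow_succ]
  have hmul : ∀ z ∈ ({i, j} : Set D), ∀ w ∈ W, z * w ∈ W := by
    intro z hz w hw
    induction hw using Submodule.span_induction with
    | mem x hx =>
      obtain ⟨⟨l, k⟩, rfl⟩ := hx
      rcases hz with rfl | hz
      · simp only
        rw [← mul_assoc]
        exact hV _ (mul_mem hi1 (pow_mem hi1 _)) _ k.2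
      · rw [Set.mem_singleton_iff.mp hz]
        simp only
        rw [← mul_assoc, hjpow, mul_assoc, ← pow_succ']
        have hm := pow_mem (sub_mem hi1 (one_mem _)) (l : ℕ)
        rcases Nat.lt_or_ge (k + 1) p with h | h
        · exact hV _ hm _ h
        · rw [show (k : ℕ) + 1 = p by omega, hj, ← Algebra.commutes, ← Algebra.smul_def]
          refine W.smul_mem _ ?_
          simpa using hV _ hm 0 (by omega)
    | zero => simp
    | add x y _ _ hx hy => rw [mul_add]; exact W.add_mem hx hy
    | smul c x _ hx => rw [mul_smul_comm]; exact W.smul_mem _ hx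
  have key : ∀ v ∈ W, x * v ∈ W := by
    induction hx using Algebra.adjoin_induction with
    | mem x hx => exact hmul x hx
    | algebraMap r => intro v hv; rw [← Algebra.smul_def]; exact W.smul_mem _ hv
    | add x y _ _ hx hy => intro v hv; rw [add_mul]; exact W.add_mem (hx v hv) (hy v hv)
    | mul x y _ _ hx hy => intro v hv; rw [mul_assoc]; exact hx _ (hy v hv)
  simpa using key 1 (by simpa using hV 1 (one_mem _) 0 (by omega))

/-- An algebra generated by symbol generators has dimension at most `p ^ 2`. -/
lemma finrank_adjoin_symbol_le {i j : D} {a b : F}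
    (hi : i ^ p - i = algebraMap F D a) (hj : j ^ p = algebraMap F D b)
    (hij : j * i = (i - 1) * j) :
    Module.Finite F (Algebra.adjoin F {i, j}) ∧
      Module.finrank F (Algebra.adjoin F {i, j}) ≤ p ^ 2 := by
  set W := Submodule.span F (Set.range fun l : Fin p × Fin p => i ^ (l.1 : ℕ) * j ^ (l.2 : ℕ))
  have hle : Subalgebra.toSubmodule (Algebra.adjoin F {i, j}) ≤ W := fun x hx =>
    mem_span_pow_mul_pow_of_mem_adjoin hi hj hij hx
  have hfin : Module.Finite F W := FiniteDimensional.span_of_finite F (Set.finite_range _)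
  refine ⟨Module.Finite.of_injective (Submodule.inclusion hle) (Submodule.inclusion_injective hle),
    (LinearMap.finrank_le_finrank_of_injective (Submodule.inclusion_injective hle)).trans ?_⟩
  refine (finrank_range_le_card _).trans ?_
  simp [sq]

end NormalOrder

section SymbolRep

variable {p : ℕ} [hp : Fact p.Prime] {F M G : Type*} [Field F] [Field M] [Algebra F M] [CharP M p]
  {D : Type*} [Ring D] [Algebra F D]

lemma isFullRep_of_symbol {i j : D} {b : F} (hb : b ≠ 0) {y : M}
    {ρ : D →ₐ[F] Matrix (ZMod p) (ZMod p) M} (hi : ρ i = asMatrix y)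
    (hj : ρ j = shiftMatrix (algebraMap F M b) 1) (hD : Module.finrank F D = p ^ 2) :
    IsFullRep ρ := by
  refine ⟨span_shiftMatrix_mul_pow (b := algebraMap F M b) (y := y)
    (by simpa using hb) _ fun a n => ?_, by rw [hD, ZMod.card]⟩
  refine Submodule.subset_span ⟨j ^ a.val * i ^ n, ?_⟩
  rw [map_mul, map_pow, map_pow, hi, hj, shiftMatrix_one_pow_val]

/-- The abstract symbol algebra is represented by the monomial matrices. -/
lemma exists_symbolRep {i j : D} {a b : F} (hi : i ^ p - i = algebraMap F D a)
    (hj : j ^ p = algebraMap F D b) (hij : j * i = (i - 1) * j)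
    (hD : Module.finrank F D = p ^ 2) (htop : Algebra.adjoin F {i, j} = ⊤) {y : M}
    (hy : y ^ p - y = algebraMap F M a) :
    ∃ ρ : D →ₐ[F] Matrix (ZMod p) (ZMod p) M, ρ i = asMatrix y ∧
      ρ j = shiftMatrix (algebraMap F M b) 1 := by
  let R := Matrix (ZMod p) (ZMod p) M
  let i' : D × R := (i, asMatrix y)
  let j' : D × R := (j, shiftMatrix (algebraMap F M b) 1)
  have hi' : i' ^ p - i' = algebraMap F (D × R) a := Prod.ext hi (by
    change asMatrix y ^ p - asMatrix y = algebraMap F R a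
    rw [asMatrix_pow_sub, hy, ← IsScalarTower.algebraMap_apply])
  have hj' : j' ^ p = algebraMap F (D × R) b := Prod.ext hj (by
    change shiftMatrix (algebraMap F M b) 1 ^ p = algebraMap F R b
    rw [shiftMatrix_one_pow_prime, ← IsScalarTower.algebraMap_apply])
  have hij' : j' * i' = (i' - 1) * j' := Prod.ext hij (shiftMatrix_one_mul_asMatrix _ _)
  obtain ⟨hfin, hle⟩ := finrank_adjoin_symbol_le hi' hj' hij'
  let S := Algebra.adjoin F {i', j'}
  have his : i' ∈ S := Algebra.subset_adjoin (by simp)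
  have hjs : j' ∈ S := Algebra.subset_adjoin (by simp)
  let φ : S →ₐ[F] D := (AlgHom.fst F D R).comp S.val
  have hsurj : Function.Surjective φ := by
    rw [← AlgHom.range_eq_top, eq_top_iff, ← htop, Algebra.adjoin_le_iff]
    rintro x (rfl | hx)
    · exact ⟨⟨i', his⟩, rfl⟩
    · rw [Set.mem_singleton_iff.mp hx]; exact ⟨⟨j', hjs⟩, rfl⟩
  have hDfin : Module.Finite F D := Module.finite_of_finrank_pos (by
    rw [hD]; exact pow_pos hp.out.pos 2)
  have hinj : Function.Injective φ := by
    have h1 : Module.finrank F S = Module.finrank F D :=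
      le_antisymm (hD ▸ hle) (LinearMap.finrank_le_finrank_of_surjective (f := φ.toLinearMap) hsurj)
    exact (LinearMap.injective_iff_surjective_of_finrank_eq_finrank (f := φ.toLinearMap) h1).mpr
      hsurj
  let e := AlgEquiv.ofBijective φ ⟨hinj, hsurj⟩
  have h1 : e.symm i = ⟨i', his⟩ := e.injective (by rw [AlgEquiv.apply_symm_apply]; rfl)
  have h2 : e.symm j = ⟨j', hjs⟩ := e.injective (by rw [AlgEquiv.apply_symm_apply]; rfl)
  refine ⟨((AlgHom.snd F D R).comp S.val).comp e.symm.toAlgHom, ?_, ?_⟩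
  · change ((e.symm i : S) : D × R).2 = _
    rw [h1]
  · change ((e.symm j : S) : D × R).2 = _
    rw [h2]

variable [Group G] [MulSemiringAction G M] [SMulCommClass G F M]

/-- The factor set of a symbol algebra. -/
lemma IsCyclicAlgWith.hasTwistedRep {F D : Type} [Field F] [Ring D] [Algebra F D] [Algebra F M]
    [SMulCommClass G F M] {a b : F} (h : IsCyclicAlgWith p F D a b) {y : M}
    (hy : y ^ p - y = algebraMap F M a) {χ : G → ZMod p}
    (hχ : ∀ σ, σ • y = y + ZMod.castHom dvd_rfl M (χ σ)) :
    HasTwistedRep F D fun σ τ => algebraMap F M b ^ carry (χ σ) (χ τ) := by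
  obtain ⟨hb, hD, i, j, hi, hj, hij, htop⟩ := h
  obtain ⟨ρ, hρi, hρj⟩ := exists_symbolRep hi hj hij hD htop hy
  have hb' : algebraMap F M b ≠ 0 := by simpa using hb
  have hfix : ∀ (σ : G) (c : F), σ • algebraMap F M c = algebraMap F M c := fun σ c => by
    rw [Algebra.algebraMap_eq_smul_one, smul_comm, smul_one]
  have hgal : ∀ (σ : G) (a : ZMod p), galMap σ (shiftMatrix (algebraMap F M b) a)
      = shiftMatrix (algebraMap F M b) a := by
    intro σ a; ext r k
    rw [galMap_apply, shiftMatrix]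
    split_ifs
    · rw [smul_pow', hfix]
    · simp
  have hχadd : ∀ σ τ, χ (σ * τ) = χ σ + χ τ := by
    intro σ τ
    have h1 := hχ (σ * τ)
    have h2 : σ • (ZMod.castHom dvd_rfl M (χ τ)) = ZMod.castHom dvd_rfl M (χ τ) := by
      rw [← ZMod.natCast_zmod_val (χ τ), map_natCast]
      exact map_natCast (MulSemiringAction.toRingHom G M σ) _
    rw [mul_smul, hχ τ, smul_add, hχ σ, h2, add_assoc] at h1
    apply (ZMod.castHom dvd_rfl M).injective
    rw [map_add]
    exact (add_left_cancel h1).symm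
  refine IsTwistedRep.hasTwistedRep (ρ := ρ) (g := fun σ => shiftUnit _ hb' (χ σ))
    ⟨isFullRep_of_symbol hb hρi hρj hD, fun σ x => ?_, fun σ τ => ?_⟩
  · change shiftMatrix _ _ * _ = _ * shiftMatrix _ _
    have hx : x ∈ Algebra.adjoin F {i, j} := htop ▸ Algebra.mem_top
    induction hx using Algebra.adjoin_induction with
    | mem x hx =>
      rcases hx with rfl | hx
      · rw [hρi, ← shiftMatrix_mul_asMatrix, ← hχ]
        congr 1
        ext r k
        rw [galMap_apply, asMatrix, asMatrix, Matrix.diagonal_apply, Matrix.diagonal_apply]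
        split_ifs
        · rw [smul_add]
          congr 1
          rw [← ZMod.natCast_zmod_val r, map_natCast]
          exact map_natCast (MulSemiringAction.toRingHom G M σ) _
        · simp
      · rw [Set.mem_singleton_iff.mp hx, hρj, hgal, shiftMatrix_mul, shiftMatrix_mul, carry_comm,
          add_comm]
    | algebraMap r =>
      have : galMap σ (ρ (algebraMap F D r)) = ρ (algebraMap F D r) := by
        ext k l
        simp only [galMap_apply, AlgHom.commutes, Matrix.algebraMap_matrix_apply]
        split_ifs
        · exact hfix σ r
        · simp
      rw [this, AlgHom.commutes, Algebra.commutes]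
    | add x y _ _ hx hy => rw [map_add, map_add, mul_add, hx, hy, add_mul]
    | mul x y _ _ hx hy => rw [map_mul, map_mul, ← mul_assoc, hx, mul_assoc, hy, mul_assoc]
  · change shiftMatrix _ _ * galMap σ (shiftMatrix _ _) = _ • shiftMatrix _ _
    rw [hgal, shiftMatrix_mul, hχadd]

/-- Existence of symbol algebras. -/
lemma exists_isCyclicAlgWith {F M : Type} [Field F] [Field M] [Algebra F M] [CharP M p] {a b : F}
    (hb : b ≠ 0) {y : M} (hy : y ^ p - y = algebraMap F M a) :
    ∃ (D : Type) (_ : Ring D) (_ : Algebra F D), IsCyclicAlgWith p F D a b := by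
  let R := Matrix (ZMod p) (ZMod p) M
  let i : R := asMatrix y
  let j : R := shiftMatrix (algebraMap F M b) 1
  have hi : i ^ p - i = algebraMap F R a := by
    rw [asMatrix_pow_sub, hy, ← IsScalarTower.algebraMap_apply]
  have hj : j ^ p = algebraMap F R b := by
    rw [shiftMatrix_one_pow_prime, ← IsScalarTower.algebraMap_apply]
  have hij : j * i = (i - 1) * j := shiftMatrix_one_mul_asMatrix _ _
  obtain ⟨hfin, hle⟩ := finrank_adjoin_symbol_le hi hj hij
  let S := Algebra.adjoin F {i, j}
  have his : i ∈ S := Algebra.subset_adjoin (by simp)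
  have hjs : j ∈ S := Algebra.subset_adjoin (by simp)
  have hspan : Submodule.span M (Set.range S.val) = ⊤ :=
    span_shiftMatrix_mul_pow (b := algebraMap F M b) (y := y) (by simpa using hb) _ fun a n =>
      Submodule.subset_span ⟨⟨j, hjs⟩ ^ a.val * ⟨i, his⟩ ^ n, by
        rw [map_mul, map_pow, map_pow, ← shiftMatrix_one_pow_val]; rfl⟩
  have hge : p ^ 2 ≤ Module.finrank F S := by
    have hsurj : Function.Surjective (scalarExt S.val) := by
      have : LinearMap.range (scalarExt S.val).toLinearMap = ⊤ := by
        rw [eq_top_iff, ← hspan, Submodule.span_le]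
        rintro _ ⟨s, rfl⟩
        exact ⟨1 ⊗ₜ s, by simp [scalarExt_tmul]⟩
      exact LinearMap.range_eq_top.mp this
    have := LinearMap.finrank_le_finrank_of_surjective (f := (scalarExt S.val).toLinearMap) hsurj
    rw [Module.finrank_baseChange, Module.finrank_matrix] at this
    simpa [ZMod.card, sq] using this
  refine ⟨S, inferInstance, inferInstance, hb, le_antisymm hle hge, ⟨i, his⟩, ⟨j, hjs⟩,
    Subtype.ext hi, Subtype.ext hj, Subtype.ext hij, ?_⟩
  have hpre : ({⟨i, his⟩, ⟨j, hjs⟩} : Set S) = Subtype.val ⁻¹' {i, j} := by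
    ext ⟨x, hx⟩
    simp [Subtype.ext_iff]
  rw [hpre]
  exact Algebra.adjoin_adjoin_coe_preimage (R := F) (s := ({i, j} : Set R))

end SymbolRep

section FieldExtension

lemma exists_castHom_eq {p : ℕ} [Fact p.Prime] {M : Type*} [Field M] [CharP M p] {x : M}
    (hx : x ^ p = x) : ∃ k : ZMod p, ZMod.castHom dvd_rfl M k = x := by
  have h := (Subfield.mem_bot_iff_pow_eq_self M p).mpr hx
  rw [← ZMod.fieldRange_castHom_eq_bot p] at h
  exact h

/-- A Galois group acts on an Artin-Schreier root through an additive character. -/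
lemma exists_character {p : ℕ} [Fact p.Prime] {F M G : Type*} [Field F] [Field M] [Algebra F M]
    [CharP M p] [Group G] [MulSemiringAction G M] [SMulCommClass G F M] {y : M} {a : F}
    (hy : y ^ p - y = algebraMap F M a) :
    ∃ χ : G → ZMod p, ∀ σ, σ • y = y + ZMod.castHom dvd_rfl M (χ σ) := by
  have h : ∀ σ : G, ∃ k : ZMod p, ZMod.castHom dvd_rfl M k = σ • y - y := by
    intro σ
    apply exists_castHom_eq
    have h1 : σ • (y ^ p - y) = y ^ p - y := by
      rw [hy, Algebra.algebraMap_eq_smul_one, smul_comm, smul_one]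
    rw [smul_sub, smul_pow'] at h1
    rw [sub_pow_expChar]
    linear_combination h1
  choose χ hχ using h
  exact ⟨χ, fun σ => by rw [hχ]; ring⟩

open Polynomial in
lemma isSeparable_of_artinSchreier {p : ℕ} [Fact p.Prime] {E Ω : Type*} [Field E] [Field Ω]
    [Algebra E Ω] [CharP E p] {x : E} {y : Ω} (h : y ^ p - y = algebraMap E Ω x) :
    IsSeparable E y := by
  have hsep : (X ^ p - X - C x : E[X]).Separable := by
    rw [separable_def']
    refine ⟨0, -1, ?_⟩
    simp [derivative_pow]
  refine hsep.of_dvd (minpoly.dvd E y ?_)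
  simp [h]

/-- Finite separable extensions embed into finite Galois extensions containing
prescribed Artin-Schreier roots. -/
lemma exists_isGalois_artinSchreier (p : ℕ) [hp : Fact p.Prime] {F E : Type} {ι : Type*} [Finite ι]
    [Field F] [Field E]
    [Algebra F E] [FiniteDimensional F E] [Algebra.IsSeparable F E] [CharP E p] (x : ι → E) :
    ∃ (M : Type) (_ : Field M) (_ : Algebra F M) (_ : Algebra E M),
      IsScalarTower F E M ∧ FiniteDimensional F M ∧ IsGalois F M ∧
      ∃ y : ι → M, ∀ i, y i ^ p - y i = algebraMap E M (x i) := by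
  have hroot : ∀ i, ∃ y : AlgebraicClosure E, y ^ p - y = algebraMap E _ (x i) := by
    intro i
    have hdeg : (Polynomial.X ^ p - Polynomial.X - Polynomial.C (algebraMap E (AlgebraicClosure E)
        (x i))).degree ≠ 0 := by
      rw [Polynomial.degree_sub_C, Polynomial.degree_eq_natDegree
        (FiniteField.X_pow_card_sub_X_ne_zero _ hp.out.one_lt),
        FiniteField.X_pow_card_sub_X_natDegree_eq _ hp.out.one_lt]
      · exact_mod_cast hp.out.ne_zero
      · rw [Polynomial.degree_eq_natDegree
          (FiniteField.X_pow_card_sub_X_ne_zero _ hp.out.one_lt),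
          FiniteField.X_pow_card_sub_X_natDegree_eq _ hp.out.one_lt]
        exact_mod_cast hp.out.pos
    obtain ⟨y, hy⟩ := IsAlgClosed.exists_root _ hdeg
    refine ⟨y, ?_⟩
    simpa [sub_eq_zero] using hy
  choose y hy using hroot
  have halg : Algebra.IsAlgebraic F (AlgebraicClosure E) := Algebra.IsAlgebraic.trans F E _
  have hnorm : Normal F (AlgebraicClosure E) := normal_iff.mpr fun z =>
    ⟨halg.isIntegral.isIntegral z, IsAlgClosed.splits _⟩
  let K := separableClosure F (AlgebraicClosure E)
  have hKy : ∀ i, y i ∈ K := fun i => mem_separableClosure_iff.mpr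
    (IsSeparable.of_algebra_isSeparable_of_isSeparable F (isSeparable_of_artinSchreier (hy i)))
  have hKE : ∀ e : E, algebraMap E (AlgebraicClosure E) e ∈ K := fun e =>
    mem_separableClosure_iff.mpr ((Algebra.IsSeparable.isSeparable F e).map
      (IsScalarTower.toAlgHom F E (AlgebraicClosure E)) (RingHom.injective _))
  let φ : E →ₐ[F] K := (IsScalarTower.toAlgHom F E (AlgebraicClosure E)).codRestrict
    K.toSubalgebra hKE
  let N : IntermediateField F K := φ.fieldRange ⊔
    IntermediateField.adjoin F (Set.range fun i => (⟨y i, hKy i⟩ : K))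
  have h1 : FiniteDimensional F (IntermediateField.adjoin F
      (Set.range fun i => (⟨y i, hKy i⟩ : K))) :=
    IntermediateField.finiteDimensional_adjoin fun z _ => Algebra.IsIntegral.isIntegral z
  have h2 : FiniteDimensional F φ.fieldRange :=
    (inferInstance : FiniteDimensional F φ.toLinearMap.range)
  have h3 : FiniteDimensional F N := IntermediateField.finiteDimensional_sup _ _
  let M := IntermediateField.normalClosure F N K
  have hNM : N ≤ M := IntermediateField.le_normalClosure N
  let ψ : E →ₐ[F] M := φ.codRestrict M.toSubalgebra fun e =>
    hNM ((le_sup_left : φ.fieldRange ≤ N) ⟨e, rfl⟩)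
  let _ : Algebra E M := ψ.toRingHom.toAlgebra
  refine ⟨M, inferInstance, inferInstance, inferInstance,
    IsScalarTower.of_algebraMap_eq fun c => (ψ.commutes c).symm, inferInstance, inferInstance,
    fun i => ⟨⟨y i, hKy i⟩, hNM ((le_sup_right : _ ≤ N)
      (IntermediateField.subset_adjoin _ _ ⟨i, rfl⟩))⟩, fun i => ?_⟩
  exact Subtype.ext (Subtype.ext (hy i))

end FieldExtension

section LogDerivation

variable {p : ℕ} [hp : Fact p.Prime] {E K : Type*} [Field E] [Field K] [Algebra E K]

open Polynomial in
/-- On an inseparable extension of degree `p` generated by `c` there is a derivation with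
`D c = c` whose constants are the elements of the base field. -/
lemma exists_derivation [CharP E p] {c : K} {e : E} (hc : c ^ p = algebraMap E K e)
    (hcE : c ∉ Set.range (algebraMap E K)) (hgen : Algebra.adjoin E {c} = ⊤) :
    ∃ D : Derivation E K K, D c = c ∧ ∀ k, D k = 0 → k ∈ Set.range (algebraMap E K) := by
  have hK : CharP K p := charP_of_injective_algebraMap (algebraMap E K).injective p
  have hirr : Irreducible (X ^ p - C e : E[X]) := by
    refine X_pow_sub_C_irreducible_of_prime hp.out fun b hb => hcE ⟨b, ?_⟩
    apply frobenius_inj K p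
    rw [frobenius_def, frobenius_def, ← map_pow, hb, hc]
  have hmin : minpoly E c = X ^ p - C e :=
    (minpoly.eq_of_irreducible_of_monic hirr (by simp [hc])
      (monic_X_pow_sub_C e hp.out.ne_zero)).symm
  have hder : derivative (minpoly E c) = 0 := by
    rw [hmin]; simp [derivative_pow]
  have hsurj : Function.Surjective (aeval c : E[X] →ₐ[E] K) := by
    rw [← AlgHom.range_eq_top, ← Algebra.adjoin_singleton_eq_range_aeval, hgen]
  have hd : ∀ q : E[X], aeval c q = 0 → aeval c (((X : E[X]) • derivative') q) = 0 := by
    intro q hq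
    obtain ⟨r, rfl⟩ := minpoly.dvd E c hq
    simp [hder]
  refine ⟨Derivation.liftOfSurjective hsurj hd, ?_, fun k hk => ?_⟩
  · have := Derivation.liftOfSurjective_apply hsurj hd X
    simpa using this
  · obtain ⟨q, rfl⟩ := hsurj k
    have hmonic : (minpoly E c).Monic := hmin ▸ monic_X_pow_sub_C e hp.out.ne_zero
    have hmod : aeval c (q %ₘ minpoly E c) = aeval c q := by
      conv_rhs => rw [← modByMonic_add_div q (minpoly E c)]
      simp
    rw [← hmod] at hk ⊢
    set r := q %ₘ minpoly E c with hr
    have hdeg : r.degree < (p : ℕ) := by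
      have : r.degree < (minpoly E c).degree := degree_modByMonic_lt q hmonic
      rwa [hmin, degree_X_pow_sub_C hp.out.pos] at this
    rw [Derivation.liftOfSurjective_apply] at hk
    have h0 : X * derivative r = 0 := by
      by_contra hne
      have hlt : (X * derivative r).degree < (minpoly E c).degree := by
        rw [hmin, degree_X_pow_sub_C hp.out.pos]
        rw [degree_lt_iff_coeff_zero] at hdeg ⊢
        intro m hm
        cases m with
        | zero => simp
        | succ m => rw [coeff_X_mul, coeff_derivative, hdeg _ hm, zero_mul]
      exact hne (by_contra fun h => absurd hlt (not_lt.mpr (minpoly.degree_le_of_ne_zero E c h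
        (by simpa using hk))))
    have h1 : derivative r = 0 := (mul_eq_zero.mp h0).resolve_left X_ne_zero
    have h2 : r = C (r.coeff 0) := by
      ext n
      rcases Nat.eq_zero_or_pos n with rfl | hn
      · simp
      · rw [coeff_C_of_ne_zero hn.ne']
        rcases Nat.lt_or_ge n p with hnp | hnp
        · have h3 := congrArg (fun s => coeff s (n - 1)) h1
          simp only [coeff_derivative, coeff_zero] at h3
          rw [Nat.sub_add_cancel hn] at h3
          refine (mul_eq_zero.mp h3).resolve_right fun h4 => ?_
          rw [← Nat.cast_succ, Nat.succ_eq_add_one, Nat.sub_add_cancel hn,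
            CharP.cast_eq_zero_iff E p] at h4
          exact absurd (Nat.le_of_dvd hn h4) (not_le.mpr hnp)
        · exact coeff_eq_zero_of_degree_lt (lt_of_lt_of_le hdeg (by exact_mod_cast hnp))
    rw [h2, aeval_C]
    exact ⟨_, rfl⟩

/-- The operator `x ↦ D x + η x`. -/
def conn (D : Derivation E K K) (η : K) : Module.End E K :=
  D.toLinearMap + LinearMap.mulLeft E η

lemma conn_apply (D : Derivation E K K) (η x : K) : conn D η x = D x + η * x := rfl

lemma conn_pow_map {E' K' : Type*} [Field E'] [Field K'] [Algebra E' K'] {D : Derivation E K K}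
    {D' : Derivation E' K' K'} {s : K →+* K'} (hs : ∀ k, D' (s k) = s (D k)) (η x : K) (n : ℕ) :
    (conn D' (s η) ^ n) (s x) = s ((conn D η ^ n) x) := by
  induction n with
  | zero => simp
  | succ n ih =>
    rw [pow_succ', pow_succ', Module.End.mul_apply, Module.End.mul_apply, ih, conn_apply,
      conn_apply, hs, map_add, map_mul]

lemma mul_conn_pow {D : Derivation E K K} {l η η' : K} (hη : l * (η' - η) = D l) (x : K) (n : ℕ) :
    l * (conn D η' ^ n) x = (conn D η ^ n) (l * x) := by
  induction n with
  | zero => simp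
  | succ n ih =>
    rw [pow_succ', pow_succ', Module.End.mul_apply, Module.End.mul_apply, ← ih, conn_apply,
      conn_apply, Derivation.leibniz, smul_eq_mul, smul_eq_mul, ← hη]
    ring

/-- The `p`-curvature of the operator `conn D η`. -/
def pCurv (p : ℕ) (D : Derivation E K K) (η : K) : K := (conn D η ^ p - conn D η) 1

lemma pCurv_map {p : ℕ} {E K : Type*} [Field E] [Field K] [Algebra E K] {E' K' : Type*} [Field E'] [Field K']
    [Algebra E' K'] {D : Derivation E K K} {D' : Derivation E' K' K'} {s : K →+* K'}
    (hs : ∀ k, D' (s k) = s (D k)) (η : K) :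
    pCurv p D' (s η) = s (pCurv p D η) := by
  have h1 := conn_pow_map hs η 1 p
  have h2 := conn_pow_map hs η 1 1
  rw [map_one] at h1 h2
  rw [pow_one, pow_one] at h2
  rw [pCurv, pCurv, LinearMap.sub_apply, LinearMap.sub_apply, h1, h2, map_sub]

variable [CharP E p] {c : K} {D : Derivation E K K}

lemma add_pow_end {f g : Module.End E K} (h : Commute f g) : (f + g) ^ p = f ^ p + g ^ p := by
  have : CharP (Module.End E K) p :=
    charP_of_injective_algebraMap (algebraMap E (Module.End E K)).injective p
  exact add_pow_expChar_of_commute p h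

lemma conn_pow_sub_apply (hgen : Algebra.adjoin E {c} = ⊤) (hc : D c = c) (η x : K) :
    (conn D η ^ p - conn D η) x = x * pCurv p D η := by
  set f := conn D η with hf
  have h1 : f * LinearMap.mulLeft E c = LinearMap.mulLeft E c * (f + 1) := by
    ext x
    simp only [hf, Module.End.mul_apply, LinearMap.mulLeft_apply, conn_apply, LinearMap.add_apply,
      Derivation.leibniz, smul_eq_mul, hc, Module.End.one_apply]
    ring
  have h2 : ∀ n, f ^ n * LinearMap.mulLeft E c = LinearMap.mulLeft E c * (f + 1) ^ n := by
    intro n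
    induction n with
    | zero => simp
    | succ n ih => rw [pow_succ, mul_assoc, h1, ← mul_assoc, ih, mul_assoc, ← pow_succ]
  have h3 : Commute (f ^ p - f) (LinearMap.mulLeft E c) := by
    rw [Commute, SemiconjBy, sub_mul, h2, h1, add_pow_end (Commute.one_right f), one_pow, ← mul_sub,
      add_sub_add_right_eq_sub]
  have h4 : ∀ x, Commute (f ^ p - f) (LinearMap.mulLeft E x) := by
    intro x
    have hx : x ∈ Algebra.adjoin E {c} := hgen ▸ Algebra.mem_top
    induction hx using Algebra.adjoin_induction with
    | mem x hx => rw [Set.mem_singleton_iff.mp hx]; exact h3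
    | algebraMap r =>
      have : LinearMap.mulLeft E (algebraMap E K r) = algebraMap E (Module.End E K) r := by
        ext x; simp [Algebra.smul_def]
      rw [this]
      exact Algebra.commutes' r _ |>.symm
    | add x y _ _ hx hy =>
      have : LinearMap.mulLeft E (x + y) = LinearMap.mulLeft E x + LinearMap.mulLeft E y := by
        ext z; simp [add_mul]
      rw [this]; exact hx.add_right hy
    | mul x y _ _ hx hy =>
      rw [LinearMap.mulLeft_mul]; exact hx.mul_right hy
  have h5 := LinearMap.congr_fun (h4 x).eq 1
  simpa [pCurv] using h5

lemma derivation_pCurv (hgen : Algebra.adjoin E {c} = ⊤) (hc : D c = c) (η : K) :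
    D (pCurv p D η) = 0 := by
  have hcomm : Commute (conn D η ^ p - conn D η) (conn D η) :=
    ((Commute.refl _).pow_left p).sub_left (Commute.refl _)
  have h := LinearMap.congr_fun hcomm.eq 1
  rw [Module.End.mul_apply, Module.End.mul_apply, conn_pow_sub_apply hgen hc,
    conn_pow_sub_apply hgen hc, conn_apply, conn_apply] at h
  simp only [Derivation.map_one_eq_zero, one_mul, zero_add, mul_one] at h
  exact add_eq_right.mp h.symm

lemma commute_conn_mulLeft {η z : K} (hz : D z = 0) :
    Commute (conn D η) (LinearMap.mulLeft E z) := by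
  ext x
  simp only [Module.End.mul_apply, LinearMap.mulLeft_apply, conn_apply, Derivation.leibniz, hz,
    smul_eq_mul]
  ring

lemma conn_add_pow_sub {η z : K} (hz : D z = 0) :
    conn D (η + z) ^ p - conn D (η + z)
      = (conn D η ^ p - conn D η) + LinearMap.mulLeft E (z ^ p - z) := by
  have h : conn D (η + z) = conn D η + LinearMap.mulLeft E z := by
    ext x; simp [conn_apply]; ring
  have h2 : LinearMap.mulLeft E (z ^ p - z)
      = LinearMap.mulLeft E z ^ p - LinearMap.mulLeft E z := by
    rw [LinearMap.pow_mulLeft]; ext x; simp [sub_mul]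
  rw [h, add_pow_end (commute_conn_mulLeft hz), h2]
  abel

lemma pCurv_add {η z : K} (hz : D z = 0) :
    pCurv p D (η + z) = pCurv p D η + (z ^ p - z) := by
  rw [pCurv, conn_add_pow_sub hz, LinearMap.add_apply, LinearMap.mulLeft_apply, mul_one, pCurv]

/-- Invariance of the `p`-curvature under gauge transformations. -/
lemma map_pCurv_eq_self (hgen : Algebra.adjoin E {c} = ⊤) (hc : D c = c) {s : K →+* K}
    (hs : ∀ k, D (s k) = s (D k)) {l η : K} (hl : l ≠ 0) (hη : l * (s η - η) = D l) :
    s (pCurv p D η) = pCurv p D η := by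
  rw [← pCurv_map hs]
  apply mul_left_cancel₀ hl
  have h1 := mul_conn_pow hη 1 p
  have h2 := mul_conn_pow hη 1 1
  rw [pow_one, pow_one, mul_one] at h2
  rw [mul_one] at h1
  rw [pCurv, LinearMap.sub_apply, mul_sub, h1, h2, ← LinearMap.sub_apply,
    conn_pow_sub_apply hgen hc]

open Polynomial in
lemma exists_eigenvector_of_pow_eq {f : Module.End E K} (hf : f ^ p = f) :
    ∃ (k : ZMod p) (v : K), v ≠ 0 ∧ f v = ZMod.castHom dvd_rfl E k • v := by
  have key : ∀ s : Multiset E, aeval f (s.map fun a => X - C a).prod = 0 →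
      ∃ a ∈ s, ∃ v : K, v ≠ 0 ∧ f v = a • v := by
    intro s
    induction s using Multiset.induction with
    | empty => intro h; simp at h
    | cons a s ih =>
      intro h
      rw [Multiset.map_cons, Multiset.prod_cons, map_mul] at h
      by_cases h0 : aeval f (s.map fun a => X - C a).prod = 0
      · obtain ⟨b, hb, hv⟩ := ih h0
        exact ⟨b, Multiset.mem_cons_of_mem hb, hv⟩
      · obtain ⟨x, hx⟩ : ∃ x, aeval f (s.map fun a => X - C a).prod x ≠ 0 := by
          by_contra! hcon
          exact h0 (LinearMap.ext hcon)
        refine ⟨a, Multiset.mem_cons_self a s, _, hx, ?_⟩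
        have := LinearMap.congr_fun h x
        simpa [sub_eq_zero] using this
  have hprod : ((X ^ p - X : (ZMod p)[X]).roots.map fun a => X - C a).prod = X ^ p - X := by
    have hdeg := FiniteField.X_pow_card_sub_X_natDegree_eq (ZMod p) hp.out.one_lt
    apply prod_multiset_X_sub_C_of_monic_of_roots_card_eq
    · exact monic_X_pow_sub (by rw [degree_X]; exact_mod_cast hp.out.one_lt)
    · have := FiniteField.roots_X_pow_card_sub_X (ZMod p)
      rw [ZMod.card] at this
      rw [this, hdeg]; simp [ZMod.card]
  obtain ⟨a, ha, v, hv, hfv⟩ := key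
    ((X ^ p - X : (ZMod p)[X]).roots.map (ZMod.castHom dvd_rfl E)) (by
      have h2 := congrArg (Polynomial.map (ZMod.castHom dvd_rfl E)) hprod
      rw [Polynomial.map_multiset_prod, Multiset.map_map] at h2
      have h3 : (((X ^ p - X : (ZMod p)[X]).roots.map (ZMod.castHom dvd_rfl E)).map
          fun a => X - C a).prod = X ^ p - X := by
        rw [Multiset.map_map]
        refine Eq.trans ?_ (h2.trans (by
          rw [Polynomial.map_sub, Polynomial.map_pow, Polynomial.map_X]))
        congr 2
        ext1 a
        simp
      rw [h3]; simp [hf])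
  obtain ⟨k, -, rfl⟩ := Multiset.mem_map.mp ha
  exact ⟨k, v, hv, hfv⟩

/-- A solution of a first order linear equation with trivialised `p`-curvature. -/
lemma exists_horizontal (hgen : Algebra.adjoin E {c} = ⊤) (hc0 : c ≠ 0) (hc : D c = c) {η Y : K}
    (hY : D Y = 0) (h : Y ^ p - Y = pCurv p D η) : ∃ v : K, v ≠ 0 ∧ D v + η * v = Y * v := by
  have hK : CharP K p := charP_of_injective_algebraMap (algebraMap E K).injective p
  have hf : conn D (η + -Y) ^ p = conn D (η + -Y) := by
    rw [← sub_eq_zero, conn_add_pow_sub (by simp [hY])]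
    ext x
    have hn : (-Y) ^ p = -(Y ^ p) := by
      have := sub_pow_expChar (p := p) (0 : K) Y
      simpa [zero_pow hp.out.ne_zero] using this
    rw [LinearMap.add_apply, conn_pow_sub_apply hgen hc, ← h, LinearMap.mulLeft_apply, hn]
    simp only [LinearMap.zero_apply]; ring
  obtain ⟨k, v, hv, hkv⟩ := exists_eigenvector_of_pow_eq hf
  refine ⟨v * c ^ (-k).val, mul_ne_zero hv (pow_ne_zero _ hc0), ?_⟩
  have hDc : D (c ^ (-k).val) = -(algebraMap E K (ZMod.castHom dvd_rfl E k)) * c ^ (-k).val := by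
    have h1 : ((-k).val : K) = -(algebraMap E K (ZMod.castHom dvd_rfl E k)) := by
      rw [← map_neg, ← map_neg]
      conv_rhs => rw [← ZMod.natCast_zmod_val (-k)]
      rw [map_natCast, map_natCast]
    rw [← h1, Derivation.leibniz_pow, hc, smul_eq_mul, nsmul_eq_mul]
    rcases Nat.eq_zero_or_pos (-k).val with h0 | h0
    · simp [h0]
    · conv_rhs => rw [← Nat.sub_add_cancel h0, pow_succ]
      rw [Nat.sub_add_cancel h0]
  rw [conn_apply, Algebra.smul_def] at hkv
  rw [Derivation.leibniz, hDc, smul_eq_mul, smul_eq_mul]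
  linear_combination c ^ (-k).val * hkv

end LogDerivation

section Gauge

variable {p : ℕ} [hp : Fact p.Prime] {E K : Type*} [Field E] [Field K] [Algebra E K]

lemma derivation_map_comm {E' K' : Type*} [Field E'] [Field K'] [Algebra E' K']
    {D : Derivation E K K} {D' : Derivation E' K' K'} {c : K} (hgen : Algebra.adjoin E {c} = ⊤)
    {s : K →+* K'} (hc : D' (s c) = s (D c)) (hs : ∀ r : E, D' (s (algebraMap E K r)) = 0) (k : K) :
    D' (s k) = s (D k) := by
  have hk : k ∈ Algebra.adjoin E {c} := hgen ▸ Algebra.mem_top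
  induction hk using Algebra.adjoin_induction with
  | mem x hx => rw [Set.mem_singleton_iff.mp hx, hc]
  | algebraMap r => rw [hs, Derivation.map_algebraMap, map_zero]
  | add x y _ _ hx hy => simp only [map_add, hx, hy]
  | mul x y _ _ hx hy => simp only [map_mul, Derivation.leibniz, smul_eq_mul, map_add, hx, hy]

variable [CharP E p] {c : K} {D : Derivation E K K} {G : Type*} [Group G] [MulSemiringAction G K]

lemma exists_gauge [Fintype G] (hgen : Algebra.adjoin E {c} = ⊤) (hc : D c = c)
    (hD : ∀ (σ : G) (k : K), D (σ • k) = σ • D k) {l : G → K} (hl : ∀ σ, l σ ≠ 0)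
    {f : G → G → K} (hf : ∀ σ τ, D (f σ τ) = 0) (hfl : ∀ σ τ, f σ τ * l (σ * τ) = l σ * σ • l τ)
    {θ : K} (hθ : ∑ τ : G, τ • θ = 1) :
    ∃ η ξ : K, (∀ σ, l σ * (σ • η - η) = D (l σ)) ∧ (∀ σ : G, σ • ξ = ξ) ∧ D ξ = 0 ∧
      pCurv p D η = ξ ^ p := by
  have hu : ∀ σ τ, D (l (σ * τ)) / l (σ * τ) = D (l σ) / l σ + σ • (D (l τ) / l τ) := by
    intro σ τ
    have hσl : σ • l τ ≠ 0 := (smul_ne_zero_iff_ne σ).mpr (hl τ)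
    have hf0 : f σ τ ≠ 0 := fun h => by
      have := hfl σ τ
      rw [h, zero_mul] at this
      exact mul_ne_zero (hl σ) hσl this.symm
    have h1 := congrArg D (hfl σ τ)
    rw [Derivation.leibniz, Derivation.leibniz, hf, smul_zero, add_zero, hD] at h1
    simp only [smul_eq_mul] at h1
    rw [smul_div₀', div_add_div _ _ (hl σ) hσl, div_eq_div_iff (hl _) (mul_ne_zero (hl σ) hσl),
      ← hfl]
    apply mul_left_cancel₀ hf0
    linear_combination (f σ τ * l (σ * τ)) * h1
  set η₀ := -∑ τ : G, D (l τ) / l τ * τ • θ with hη₀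
  have hη : ∀ σ, l σ * (σ • η₀ - η₀) = D (l σ) := by
    intro σ
    have h1 : σ • η₀ = η₀ + D (l σ) / l σ := by
      have h2 : ∑ τ : G, D (l τ) / l τ * τ • θ
          = ∑ τ : G, D (l (σ * τ)) / l (σ * τ) * (σ * τ) • θ :=
        (Equiv.sum_comp (Equiv.mulLeft σ) fun τ => D (l τ) / l τ * τ • θ).symm
      have h3 : ∑ τ : G, (σ * τ) • θ = 1 := by
        rw [← hθ]; exact Equiv.sum_comp (Equiv.mulLeft σ) fun τ => τ • θ
      have h4 : ∑ τ : G, D (l τ) / l τ * τ • θ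
          = D (l σ) / l σ + σ • ∑ τ : G, D (l τ) / l τ * τ • θ := by
        refine h2.trans ?_
        simp only [hu, add_mul, Finset.sum_add_distrib]
        rw [← Finset.mul_sum, h3, mul_one, Finset.smul_sum]
        simp only [smul_mul', mul_smul]
      rw [hη₀, smul_neg]
      linear_combination h4
    rw [h1, add_sub_cancel_left, mul_div_cancel₀ _ (hl σ)]
  set ξ := pCurv p D η₀ with hξ
  have hDξ : D ξ = 0 := derivation_pCurv hgen hc η₀
  have hσξ : ∀ σ : G, σ • ξ = ξ := fun σ =>
    map_pCurv_eq_self hgen hc (s := MulSemiringAction.toRingHom G K σ) (hD σ) (hl σ) (hη σ)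
  refine ⟨η₀ + ξ, ξ, fun σ => ?_, hσξ, hDξ, ?_⟩
  · rw [smul_add, hσξ, add_sub_add_right_eq_sub, hη]
  · rw [pCurv_add hDξ, ← hξ]; ring

lemma exists_gauge_eq (hgen : Algebra.adjoin E {c} = ⊤) (hc0 : c ≠ 0) (hc : D c = c) [CharP K p]
    (hD : ∀ (σ : G) (k : K), D (σ • k) = σ • D k) {l : G → K} (hl : ∀ σ, l σ ≠ 0) {η Y : K}
    (hη : ∀ σ, l σ * (σ • η - η) = D (l σ)) (hY : D Y = 0) (hYη : Y ^ p - Y = pCurv p D η)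
    {χ : G → ZMod p} (hχ : ∀ σ, σ • Y = Y + ZMod.castHom dvd_rfl K (χ σ)) :
    ∃ v : K, v ≠ 0 ∧ ∃ ν : G → K, (∀ σ, ν σ ≠ 0) ∧ (∀ σ, D (ν σ) = 0) ∧
      ∀ σ, l σ * σ • v = v * c ^ (χ σ).val * ν σ := by
  obtain ⟨v, hv, hDv⟩ := exists_horizontal hgen hc0 hc hY hYη
  have hσv : ∀ σ : G, σ • v ≠ 0 := fun σ => (smul_ne_zero_iff_ne σ).mpr hv
  have hQ : ∀ σ, v * c ^ (χ σ).val ≠ 0 := fun σ => mul_ne_zero hv (pow_ne_zero _ hc0)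
  refine ⟨v, hv, fun σ => l σ * σ • v / (v * c ^ (χ σ).val),
    fun σ => div_ne_zero (mul_ne_zero (hl σ) (hσv σ)) (hQ σ), fun σ => ?_, fun σ => ?_⟩
  · have hDc : D (c ^ (χ σ).val) = ZMod.castHom dvd_rfl K (χ σ) * c ^ (χ σ).val := by
      have h1 : ZMod.castHom dvd_rfl K (χ σ) = ((χ σ).val : K) := by
        conv_lhs => rw [← ZMod.natCast_zmod_val (χ σ)]
        rw [map_natCast]
      rw [h1, Derivation.leibniz_pow, hc, smul_eq_mul, nsmul_eq_mul]
      rcases Nat.eq_zero_or_pos (χ σ).val with h0 | h0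
      · simp [h0]
      · conv_rhs => rw [← Nat.sub_add_cancel h0, pow_succ]
        rw [Nat.sub_add_cancel h0]
    have hDv' : D v = Y * v - η * v := by linear_combination hDv
    rw [Derivation.leibniz_div, Derivation.leibniz, Derivation.leibniz, hD, hDv', hDc, ← hη]
    simp only [smul_eq_mul, smul_sub, smul_mul', hχ]
    ring
  · rw [mul_div_cancel₀ _ (hQ σ)]

end Gauge

section SubfieldAlgebra

variable {M : Type*} [Field M] {R R' : Subfield M} [h : Fact (R ≤ R')]

instance subfieldAlgebra : Algebra R R' := (Subfield.inclusion h.out).toAlgebra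

lemma mem_range_algebraMap_subfield {x : R'} :
    x ∈ Set.range (algebraMap R R') ↔ (x : M) ∈ R :=
  ⟨fun ⟨y, hy⟩ => hy ▸ y.2, fun h => ⟨⟨x, h⟩, Subtype.ext rfl⟩⟩

lemma derivation_eq_zero_of_mem (D : Derivation R R' R') {k : R'} (hk : (k : M) ∈ R) :
    D k = 0 := by
  obtain ⟨y, rfl⟩ := mem_range_algebraMap_subfield.mpr hk
  exact D.map_algebraMap y

variable {M' : Type*} [Field M'] {Q Q' : Subfield M'} [h' : Fact (Q ≤ Q')]

def subfieldMap (j : M →+* M') (hj : ∀ x ∈ R', j x ∈ Q') : R' →+* Q' :=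
  (j.comp R'.subtype).codRestrict Q' fun x => hj x x.2

lemma derivation_subfieldMap {D : Derivation R R' R'} {D' : Derivation Q Q' Q'} {c : R'}
    (hgen : Algebra.adjoin R {c} = ⊤) (hD : D c = c) {j : M →+* M'} (hj : ∀ x ∈ R', j x ∈ Q')
    (hj' : ∀ x ∈ R, j x ∈ Q) (hD' : D' (subfieldMap j hj c) = subfieldMap j hj c) (k : R') :
    D' (subfieldMap j hj k) = subfieldMap j hj (D k) :=
  derivation_map_comm hgen (hD'.trans (by rw [hD]))
    (fun r => derivation_eq_zero_of_mem D' (hj' r r.2)) k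

end SubfieldAlgebra

section PthField

variable (p : ℕ) {F : Type*} [Field F] (M : Type*) [Field M] [Algebra F M]

/-- The subfield of `M` generated by the `p`-th powers of `M` and a set of elements of `F`. -/
def pthField (S : Set F) : Subfield M :=
  Subfield.closure (Set.range (fun x : M => x ^ p) ∪ algebraMap F M '' S)

variable {M} {S T : Set F}

lemma pow_mem_pthField (x : M) : x ^ p ∈ pthField p M S :=
  Subfield.subset_closure (Or.inl ⟨x, rfl⟩)

lemma algebraMap_mem_pthField {c : F} (hc : c ∈ S) : algebraMap F M c ∈ pthField p M S :=
  Subfield.subset_closure (Or.inr ⟨c, hc, rfl⟩)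

variable {p}

lemma pthField_le {R : Subfield M} (h1 : ∀ x : M, x ^ p ∈ R) (h2 : ∀ c ∈ S, algebraMap F M c ∈ R) :
    pthField p M S ≤ R := by
  refine Subfield.closure_le.mpr ?_
  rintro _ (⟨x, rfl⟩ | ⟨c, hc, rfl⟩)
  exacts [h1 x, h2 c hc]

lemma pthField_mono (h : S ⊆ T) : pthField p M S ≤ pthField p M T :=
  pthField_le (pow_mem_pthField p) fun _ hc => algebraMap_mem_pthField p (h hc)

lemma pthField_insert_of_mem {c : F} (h : algebraMap F M c ∈ pthField p M S) :
    pthField p M (insert c S) = pthField p M S := by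
  refine le_antisymm (pthField_le (pow_mem_pthField p) ?_) (pthField_mono (Set.subset_insert c S))
  rintro d (rfl | hd)
  exacts [h, algebraMap_mem_pthField p hd]

lemma map_mem_pthField {M' : Type*} [Field M'] [Algebra F M'] (j : M →ₐ[F] M') {x : M}
    (hx : x ∈ pthField p M S) : j x ∈ pthField p M' S := by
  have : pthField p M S ≤ (pthField p M' S).comap (j : M →+* M') := by
    refine pthField_le (fun x => ?_) fun c hc => ?_
    · simp [Subfield.mem_comap, pow_mem_pthField]
    · simp [Subfield.mem_comap, algebraMap_mem_pthField p hc]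
  exact this hx

lemma mem_pthField_empty [Fact p.Prime] [CharP M p] {x : M} (hx : x ∈ pthField p M (∅ : Set F)) :
    ∃ y, y ^ p = x := by
  have : pthField p M (∅ : Set F) ≤ (frobenius M p).fieldRange :=
    pthField_le (fun x => ⟨x, rfl⟩) fun c hc => hc.elim
  exact this hx

instance {G : Type*} [Group G] [MulSemiringAction G M] [SMulCommClass G F M] :
    IsInvariantSubfield G (pthField p M S) where
  smul_mem := by
    intro σ x hx
    have : pthField p M S ≤ (pthField p M S).comap (MulSemiringAction.toRingHom G M σ) := by
      refine pthField_le (fun x => ?_) fun c hc => ?_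
      · simp [Subfield.mem_comap, pow_mem_pthField]
      · simp [Subfield.mem_comap, algebraMap_mem_pthField p hc]
    exact this hx

variable {c : F}

instance : Fact (pthField p M S ≤ pthField p M (insert c S)) :=
  ⟨pthField_mono (Set.subset_insert c S)⟩

variable (p M S c) in
/-- The adjoined element as an element of the larger field. -/
def pthGen : pthField p M (insert c S) :=
  ⟨algebraMap F M c, algebraMap_mem_pthField p (Set.mem_insert c S)⟩

lemma adjoin_pthGen [hp : Fact p.Prime] :
    Algebra.adjoin (pthField p M S) {pthGen p M S c} = ⊤ := by
  set B := Algebra.adjoin (pthField p M S) {pthGen p M S c} with hB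
  have hlow : ∀ x : pthField p M (insert c S), (x : M) ∈ pthField p M S → x ∈ B := by
    intro x hx
    obtain ⟨y, rfl⟩ := mem_range_algebraMap_subfield.mpr hx
    exact B.algebraMap_mem y
  rw [eq_top_iff]
  rintro ⟨x, hx⟩ -
  unfold pthField at hx
  induction hx using Subfield.closure_induction with
  | mem x hx =>
    obtain ⟨z, rfl⟩ | ⟨d, rfl | hd, rfl⟩ := hx
    · exact hlow _ (pow_mem_pthField p z)
    · exact Algebra.subset_adjoin (Set.mem_singleton _)
    · exact hlow _ (algebraMap_mem_pthField p hd)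
  | one => exact B.one_mem
  | add x y hx hy h1 h2 => exact B.add_mem h1 h2
  | neg x hx h => exact B.neg_mem h
  | mul x y hx hy h1 h2 => exact B.mul_mem h1 h2
  | inv x hx h =>
    have h3 : (⟨x⁻¹, inv_mem hx⟩ : pthField p M (insert c S))
        = ⟨x, hx⟩ ^ (p - 1) * ⟨x⁻¹ ^ p, pow_mem_pthField p _⟩ := by
      apply Subtype.ext
      change x⁻¹ = x ^ (p - 1) * x⁻¹ ^ p
      by_cases hx0 : x = 0
      · simp [hx0, hp.out.ne_zero]
      · obtain ⟨q, hq⟩ : ∃ q, p = q + 1 := ⟨p - 1, (Nat.sub_add_cancel hp.out.one_le).symm⟩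
        rw [hq, Nat.add_sub_cancel, pow_succ, ← mul_assoc, ← mul_pow, mul_inv_cancel₀ hx0, one_pow,
          one_mul]
    rw [h3]
    exact B.mul_mem (B.pow_mem h _) (hlow _ (pow_mem_pthField p _))

lemma exists_derivation_pthField [Fact p.Prime] [CharP M p]
    (h : algebraMap F M c ∉ pthField p M S) :
    ∃ D : Derivation (pthField p M S) (pthField p M (insert c S)) (pthField p M (insert c S)),
      D (pthGen p M S c) = pthGen p M S c ∧ ∀ k, D k = 0 → (k : M) ∈ pthField p M S := by
  obtain ⟨D, h1, h2⟩ := exists_derivation (p := p) (c := pthGen p M S c)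
    (e := (⟨algebraMap F M c ^ p, pow_mem_pthField p _⟩ : pthField p M S)) rfl
    (fun h' => h (mem_range_algebraMap_subfield.mp h')) adjoin_pthGen
  exact ⟨D, h1, fun k hk => mem_range_algebraMap_subfield.mp (h2 k hk)⟩

section Map

variable {M' : Type*} [Field M'] [Algebra F M']

variable (p S) in
/-- The map on `pthField` induced by a homomorphism. -/
def pthMap (j : M →ₐ[F] M') : pthField p M S →+* pthField p M' S :=
  subfieldMap j.toRingHom fun _ => map_mem_pthField j

lemma coe_pthMap (j : M →ₐ[F] M') (x : pthField p M S) : (pthMap p S j x : M') = j x := rfl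

lemma pthMap_pthGen (j : M →ₐ[F] M') :
    pthMap p (insert c S) j (pthGen p M S c) = pthGen p M' S c := by
  apply Subtype.ext
  rw [coe_pthMap, pthGen, pthGen]
  exact j.commutes c

lemma derivation_pthMap [Fact p.Prime] (j : M →ₐ[F] M')
    {D : Derivation (pthField p M S) (pthField p M (insert c S)) (pthField p M (insert c S))}
    {D' : Derivation (pthField p M' S) (pthField p M' (insert c S)) (pthField p M' (insert c S))}
    (hD : D (pthGen p M S c) = pthGen p M S c) (hD' : D' (pthGen p M' S c) = pthGen p M' S c)
    (k : pthField p M (insert c S)) :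
    D' (pthMap p (insert c S) j k) = pthMap p (insert c S) j (D k) := by
  have h := pthMap_pthGen (p := p) (S := S) (c := c) j
  rw [← h] at hD'
  exact derivation_subfieldMap adjoin_pthGen hD _ (fun _ => map_mem_pthField j) hD' k

end Map

lemma derivation_smul_pthField [Fact p.Prime] {G : Type*} [Group G] [MulSemiringAction G M]
    [SMulCommClass G F M]
    {D : Derivation (pthField p M S) (pthField p M (insert c S)) (pthField p M (insert c S))}
    (hD : D (pthGen p M S c) = pthGen p M S c) (σ : G) (k : pthField p M (insert c S)) :
    D (σ • k) = σ • D k := by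
  have h1 : ∀ k : pthField p M (insert c S),
      pthMap p (insert c S) (MulSemiringAction.toAlgHom F M σ) k = σ • k := fun k => Subtype.ext rfl
  rw [← h1, ← h1]
  exact derivation_pthMap _ hD hD k

end PthField

/-- After a finite Galois enlargement of `M`, the cocycle `f` is cohomologous to the product of the
cocycles of symbols with second slots `c`. -/
def BecomesSymbolic (p : ℕ) {F M : Type} [Field F] [Field M] [Algebra F M] {n : ℕ} (c : Fin n → F)
    (f : (M ≃ₐ[F] M) → (M ≃ₐ[F] M) → M) : Prop :=
  ∃ (M' : Type) (_ : Field M') (_ : Algebra F M') (_ : FiniteDimensional F M') (_ : IsGalois F M')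
    (_ : CharP M' p) (j : M →ₐ[F] M') (π : (M' ≃ₐ[F] M') →* (M ≃ₐ[F] M)) (y : Fin n → M')
    (a : Fin n → F) (χ : Fin n → (M' ≃ₐ[F] M') → ZMod p) (μ : (M' ≃ₐ[F] M') → M'),
    (∀ σ m, j (π σ • m) = σ • j m) ∧ (∀ s, y s ^ p - y s = algebraMap F M' (a s)) ∧
    (∀ s σ, σ • y s = y s + ZMod.castHom dvd_rfl M' (χ s σ)) ∧ (∀ σ, μ σ ≠ 0) ∧
    ∀ σ τ, j (f (π σ) (π τ)) * μ (σ * τ)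
      = (μ σ * σ • μ τ) * ∏ s, algebraMap F M' (c s) ^ carry (χ s σ) (χ s τ)

section Albert

variable {p : ℕ} {F M : Type} [Field F] [Field M] [Algebra F M]
  {n : ℕ} {c : Fin n → F} {f : (M ≃ₐ[F] M) → (M ≃ₐ[F] M) → M}

lemma BecomesSymbolic.of_extension {M₁ : Type} [Field M₁] [Algebra F M₁] (j : M →ₐ[F] M₁)
    (π : (M₁ ≃ₐ[F] M₁) →* (M ≃ₐ[F] M)) (hj : ∀ σ m, j (π σ • m) = σ • j m)
    (h : BecomesSymbolic p c fun σ τ => j (f (π σ) (π τ))) : BecomesSymbolic p c f := by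
  obtain ⟨M', i1, i2, i3, i4, i5, j', π', y, a, χ, μ, h1, h2, h3, h4, h5⟩ := h
  exact ⟨M', i1, i2, i3, i4, i5, j'.comp j, π.comp π', y, a, χ, μ,
    fun σ m => by rw [AlgHom.comp_apply, MonoidHom.comp_apply, hj, h1, AlgHom.comp_apply],
    h2, h3, h4, h5⟩

lemma BecomesSymbolic.cons [CharP M p] {c₀ a₀ : F} {y₀ : M}
    (hy : y₀ ^ p - y₀ = algebraMap F M a₀) {χ₀ : (M ≃ₐ[F] M) → ZMod p}
    (hχ : ∀ σ, σ • y₀ = y₀ + ZMod.castHom dvd_rfl M (χ₀ σ))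
    {f' : (M ≃ₐ[F] M) → (M ≃ₐ[F] M) → M}
    (hf : ∀ σ τ, f σ τ = f' σ τ * algebraMap F M c₀ ^ carry (χ₀ σ) (χ₀ τ))
    (h : BecomesSymbolic p c f') : BecomesSymbolic p (Fin.cons c₀ c : Fin (n + 1) → F) f := by
  obtain ⟨M', i1, i2, i3, i4, i5, j, π, y, a, χ, μ, h1, h2, h3, h4, h5⟩ := h
  refine ⟨M', i1, i2, i3, i4, i5, j, π, Fin.cons (j y₀) y, Fin.cons a₀ a,
    Fin.cons (fun σ => χ₀ (π σ)) χ, μ, h1, fun s => ?_, fun s σ => ?_, h4, fun σ τ => ?_⟩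
  · refine Fin.cases ?_ (fun s => ?_) s
    · rw [Fin.cons_zero, Fin.cons_zero, ← map_pow, ← map_sub, hy, j.commutes]
    · simpa using h2 s
  · refine Fin.cases ?_ (fun s => ?_) s
    · rw [Fin.cons_zero, Fin.cons_zero, ← h1, hχ, map_add]
      congr 1
      exact congrFun (congrArg DFunLike.coe
        (Subsingleton.elim ((j : M →+* M').comp (ZMod.castHom dvd_rfl M)) _)) _
    · simpa using h3 s σ
  · rw [Fin.prod_univ_succ]
    simp only [Fin.cons_zero, Fin.cons_succ]
    rw [hf, map_mul, map_pow, j.commutes]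
    linear_combination (algebraMap F M' c₀ ^ carry (χ₀ (π σ)) (χ₀ (π τ))) * h5 σ τ

lemma character_mul [CharP M p] {G : Type*} [Group G] [MulSemiringAction G M] {y : M}
    {χ : G → ZMod p} (hχ : ∀ σ, σ • y = y + ZMod.castHom dvd_rfl M (χ σ)) (σ τ : G) :
    χ (σ * τ) = χ σ + χ τ := by
  have hfix : ∀ k : ZMod p, σ • (ZMod.castHom dvd_rfl M k) = ZMod.castHom dvd_rfl M k := fun k =>
    congrFun (congrArg DFunLike.coe (Subsingleton.elim
      ((MulSemiringAction.toRingHom G M σ).comp (ZMod.castHom dvd_rfl M)) _)) k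
  apply ZMod.castHom_injective M
  rw [map_add]
  have h := hχ (σ * τ)
  rw [mul_smul, hχ τ, smul_add, hχ σ, hfix] at h
  linear_combination -h

variable [hp : Fact p.Prime]

lemma exists_pthField_gauge [CharP M p] [FiniteDimensional F M] [IsGalois F M] {S : Set F} {c : F}
    {D : Derivation (pthField p M S) (pthField p M (insert c S)) (pthField p M (insert c S))}
    (hD : D (pthGen p M S c) = pthGen p M S c)
    {l : (M ≃ₐ[F] M) → pthField p M (insert c S)} (hl0 : ∀ σ, l σ ≠ 0)
    (hfl : ∀ σ τ, f σ τ ^ p * (l (σ * τ) : M) = l σ * σ • (l τ : M)) :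
    ∃ (η : pthField p M (insert c S)) (x : F), (∀ σ, l σ * (σ • η - η) = D (l σ)) ∧
      ((pCurv p D η : pthField p M (insert c S)) : M) = algebraMap F M x ^ p := by
  obtain ⟨θ, hθ⟩ := Algebra.trace_surjective F M 1
  have hθ' : ∑ τ : M ≃ₐ[F] M, τ • θ = 1 := by
    have := trace_eq_sum_automorphisms (K := F) θ
    rw [hθ, map_one] at this
    exact this.symm
  obtain ⟨η, ξ, h1, h2, h3, h4⟩ := exists_gauge (p := p) (G := M ≃ₐ[F] M) adjoin_pthGen hD
    (derivation_smul_pthField hD) hl0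
    (f := fun σ τ => (⟨f σ τ ^ p, pow_mem_pthField p _⟩ : pthField p M (insert c S)))
    (fun σ τ => derivation_eq_zero_of_mem D (pow_mem_pthField p _))
    (fun σ τ => Subtype.ext (hfl σ τ))
    (θ := (⟨θ ^ p, pow_mem_pthField p _⟩ : pthField p M (insert c S))) (by
      apply Subtype.ext
      have h5 : ((∑ τ : M ≃ₐ[F] M, τ • (⟨θ ^ p, pow_mem_pthField p _⟩ :
          pthField p M (insert c S)) : pthField p M (insert c S)) : M)
          = ∑ τ : M ≃ₐ[F] M, τ • θ ^ p := by
        rw [AddSubmonoidClass.coe_finsetSum]; rfl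
      rw [h5]
      simp only [smul_pow']
      rw [← sum_pow_char p, hθ', one_pow]
      rfl)
  obtain ⟨x, hx⟩ := (IsGalois.mem_range_algebraMap_iff_fixed (F := F) (ξ : M)).mpr fun σ =>
    congrArg Subtype.val (h2 σ)
  refine ⟨η, x, h1, ?_⟩
  rw [h4, hx]
  rfl

/-- If `f ^ p` is the coboundary of a cochain with values in the field generated by the `p`-th
powers and the `c s`, then `f` is eventually a product of symbol cocycles. -/
theorem becomesSymbolic_of_mem_pthField [CharP F p] (n : ℕ) :
    ∀ (M : Type) [Field M] [Algebra F M] [FiniteDimensional F M] [IsGalois F M] (c : Fin n → F)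
      (_ : ∀ s, c s ≠ 0) (f : (M ≃ₐ[F] M) → (M ≃ₐ[F] M) → M) (l : (M ≃ₐ[F] M) → M)
      (_ : ∀ σ, l σ ≠ 0) (_ : ∀ σ, l σ ∈ pthField p M (Set.range c))
      (_ : ∀ σ τ, f σ τ ^ p * l (σ * τ) = l σ * σ • l τ), BecomesSymbolic p c f := by
  induction n with
  | zero =>
    intro M _ _ _ _ c _ f l hl0 hl hfl
    have hM : CharP M p := charP_of_injective_algebraMap (algebraMap F M).injective p
    have hl' : ∀ σ, ∃ μ, μ ^ p = l σ := fun σ => mem_pthField_empty (F := F) (by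
      have := hl σ
      rwa [Set.range_eq_empty] at this)
    choose μ hμ using hl'
    refine ⟨M, inferInstance, inferInstance, inferInstance, inferInstance, hM, AlgHom.id F M,
      MonoidHom.id _, fun s => 0, c, fun s => 0, μ, fun σ m => rfl, fun s => s.elim0,
      fun s => s.elim0, fun σ h => hl0 σ ?_, fun σ τ => ?_⟩
    · rw [← hμ, h, zero_pow hp.out.ne_zero]
    · rw [Finset.univ_eq_empty, Finset.prod_empty, mul_one]
      apply frobenius_inj M p
      simp only [frobenius_def, mul_pow, ← smul_pow', hμ]
      exact hfl σ τ
  | succ n ih =>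
    have skip : ∀ (M : Type) [Field M] [Algebra F M] [FiniteDimensional F M] [IsGalois F M]
        (c : Fin (n + 1) → F) (_ : ∀ s, c s ≠ 0) (f : (M ≃ₐ[F] M) → (M ≃ₐ[F] M) → M)
        (l : (M ≃ₐ[F] M) → M) (_ : ∀ σ, l σ ≠ 0) (_ : ∀ σ, l σ ∈ pthField p M (Set.range c))
        (_ : ∀ σ τ, f σ τ ^ p * l (σ * τ) = l σ * σ • l τ)
        (_ : algebraMap F M (c 0) ∈ pthField p M (Set.range (Fin.tail c))),
        BecomesSymbolic p c f := by
      intro M _ _ _ _ c hc0 f l hl0 hl hfl hmem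
      have hM : CharP M p := charP_of_injective_algebraMap (algebraMap F M).injective p
      have hr : Set.range c = insert (c 0) (Set.range (Fin.tail c)) := by
        conv_lhs => rw [← Fin.cons_self_tail c, Fin.range_cons]
      rw [hr, pthField_insert_of_mem hmem] at hl
      rw [← Fin.cons_self_tail c]
      refine (ih M (Fin.tail c) (fun s => hc0 _) f l hl0 hl hfl).cons (y₀ := 0) (a₀ := 0)
        (χ₀ := fun _ => 0) ?_ (fun σ => ?_) (fun σ τ => ?_)
      · rw [zero_pow hp.out.ne_zero, sub_zero, map_zero]
      · rw [smul_zero, map_zero, add_zero]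
      · rw [carry_zero_right, pow_zero, mul_one]
    intro M _ _ _ _ c hc0 f l hl0 hl hfl
    have hM : CharP M p := charP_of_injective_algebraMap (algebraMap F M).injective p
    by_cases hmem : algebraMap F M (c 0) ∈ pthField p M (Set.range (Fin.tail c))
    · exact skip M c hc0 f l hl0 hl hfl hmem
    have hr : Set.range c = insert (c 0) (Set.range (Fin.tail c)) := by
      conv_lhs => rw [← Fin.cons_self_tail c, Fin.range_cons]
    obtain ⟨D, hDc, -⟩ := exists_derivation_pthField hmem
    obtain ⟨η, x, hη, hx⟩ := exists_pthField_gauge hDc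
      (l := fun σ => ⟨l σ, hr ▸ hl σ⟩) (fun σ h => hl0 σ (congrArg Subtype.val h)) hfl
    obtain ⟨M₁, _, _, _, _, _, _, y, hy⟩ := exists_isGalois_artinSchreier (F := F) (E := M) p
      (fun _ : Unit => algebraMap F M x)
    have hM₁ : CharP M₁ p := charP_of_injective_algebraMap (algebraMap F M₁).injective p
    set j : M →ₐ[F] M₁ := IsScalarTower.toAlgHom F M M₁ with hj
    set π : (M₁ ≃ₐ[F] M₁) →* (M ≃ₐ[F] M) := AlgEquiv.restrictNormalHom M with hπ
    have hjπ : ∀ σ m, j (π σ • m) = σ • j m := fun σ m =>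
      AlgEquiv.restrictNormal_commutes σ M m
    have hl0' : ∀ σ, j (l (π σ)) ≠ 0 := fun σ h =>
      hl0 (π σ) (j.injective (h.trans (map_zero j).symm))
    have hl' : ∀ σ, j (l (π σ)) ∈ pthField p M₁ (Set.range c) := fun σ => map_mem_pthField j (hl _)
    have hfl' : ∀ σ τ, j (f (π σ) (π τ)) ^ p * j (l (π (σ * τ)))
        = j (l (π σ)) * σ • j (l (π τ)) := by
      intro σ τ
      rw [← hjπ, ← map_pow, ← map_mul, ← map_mul, map_mul π, hfl]
    refine BecomesSymbolic.of_extension j π hjπ ?_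
    by_cases hmem' : algebraMap F M₁ (c 0) ∈ pthField p M₁ (Set.range (Fin.tail c))
    · exact skip M₁ c hc0 _ _ hl0' hl' hfl' hmem'
    obtain ⟨D', hDc', hD'0⟩ := exists_derivation_pthField hmem'
    have hy' : y () ^ p - y () = algebraMap F M₁ x := by
      rw [hy, ← IsScalarTower.algebraMap_apply]
    obtain ⟨χ, hχ⟩ := exists_character (G := M₁ ≃ₐ[F] M₁) hy'
    rw [hr] at hl'
    let K := pthField p M₁ (insert (c 0) (Set.range (Fin.tail c)))
    have hpow : ∀ m : M₁, m ^ p ∈ pthField p M₁ (Set.range (Fin.tail c)) := pow_mem_pthField p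
    have hcomm := derivation_pthMap j hDc hDc'
    have hsmul : ∀ (σ : M₁ ≃ₐ[F] M₁) (k : pthField p M (insert (c 0) (Set.range (Fin.tail c)))),
        pthMap p _ j (π σ • k) = σ • pthMap p _ j k := fun σ k => Subtype.ext (hjπ σ k)
    have hl₁ : ∀ σ, (⟨j (l (π σ)), hl' σ⟩ : K)
        = pthMap p _ j ⟨l (π σ), hr ▸ hl (π σ)⟩ := fun σ => Subtype.ext rfl
    obtain ⟨v, hv0, ν, hν0, hν, hlν⟩ := exists_gauge_eq (p := p) (G := M₁ ≃ₐ[F] M₁)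
      (D := D') (c := pthGen p M₁ (Set.range (Fin.tail c)) (c 0)) adjoin_pthGen
      (fun h => hmem' (by
        have h1 : algebraMap F M₁ (c 0) = 0 := congrArg Subtype.val h
        rw [h1]; exact zero_mem _)) hDc' (derivation_smul_pthField hDc')
      (l := fun σ => ⟨j (l (π σ)), hl' σ⟩) (fun σ h => hl0' σ (congrArg Subtype.val h))
      (η := pthMap p _ j η) (Y := ⟨y () ^ p, pow_mem_pthField p _⟩)
      (fun σ => by
        rw [hl₁, ← hsmul, ← map_sub, ← map_mul, hη, hcomm])
      (derivation_eq_zero_of_mem D' (hpow _))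
      (by
        rw [pCurv_map hcomm]
        apply Subtype.ext
        rw [coe_pthMap, hx, map_pow, j.commutes, ← hy', sub_pow_char]
        rfl)
      (χ := χ) (fun σ => by
        apply Subtype.ext
        have h1 : ((ZMod.castHom dvd_rfl K (χ σ) : K) : M₁) = ZMod.castHom dvd_rfl M₁ (χ σ) :=
          congrFun (congrArg DFunLike.coe
            (Subsingleton.elim (K.subtype.comp (ZMod.castHom dvd_rfl K)) _)) _
        change σ • (y () ^ p) = y () ^ p + ((ZMod.castHom dvd_rfl K (χ σ) : K) : M₁)
        rw [h1, smul_pow', hχ, add_pow_char, ← map_pow, ZMod.pow_card])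
    have hc1 : algebraMap F M₁ (c 0) ≠ 0 := by simpa using hc0 0
    have hlν' : ∀ σ, j (l (π σ)) * σ • (v : M₁)
        = v * algebraMap F M₁ (c 0) ^ (χ σ).val * (ν σ : M₁) := fun σ =>
      congrArg Subtype.val (hlν σ)
    have hfix : ∀ σ : M₁ ≃ₐ[F] M₁, σ • algebraMap F M₁ (c 0) = algebraMap F M₁ (c 0) := fun σ =>
      σ.commutes _
    have hv0' : ∀ σ : M₁ ≃ₐ[F] M₁, σ • (v : M₁) ≠ 0 := fun σ =>
      (smul_ne_zero_iff_ne σ).mpr fun h => hv0 (Subtype.ext h)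
    rw [← Fin.cons_self_tail c]
    refine BecomesSymbolic.cons hy' hχ (f' := fun σ τ => j (f (π σ) (π τ))
        / algebraMap F M₁ (c 0) ^ carry (χ σ) (χ τ))
      (fun σ τ => (div_mul_cancel₀ _ (pow_ne_zero _ hc1)).symm)
      (ih M₁ (Fin.tail c) (fun s => hc0 _) _ (fun σ => (ν σ : M₁))
        (fun σ h => hν0 σ (Subtype.ext h)) (fun σ => hD'0 _ (hν σ)) fun σ τ => ?_)
    rw [div_pow, ← pow_mul, div_mul_eq_mul_div, div_eq_iff (pow_ne_zero _ hc1)]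
    have e1 := hlν' (σ * τ)
    have e2 := hlν' σ
    have e3 := congrArg (σ • ·) (hlν' τ)
    simp only [smul_mul', smul_pow', hfix, ← mul_smul] at e3
    have e4 := val_add_carry (χ σ) (χ τ)
    rw [← character_mul hχ] at e4
    have e5 : algebraMap F M₁ (c 0) ^ (χ (σ * τ)).val
        * algebraMap F M₁ (c 0) ^ (p * carry (χ σ) (χ τ))
        = algebraMap F M₁ (c 0) ^ (χ σ).val * algebraMap F M₁ (c 0) ^ (χ τ).val := by
      rw [← pow_add, e4, pow_add]
    rw [mul_comm (carry _ _) p]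
    have e6 := hfl' σ τ
    have hv : (v : M₁) ≠ 0 := fun h => hv0 (Subtype.ext h)
    set C := algebraMap F M₁ (c 0)
    set f0 := j (f (π σ) (π τ)) ^ p
    apply mul_left_cancel₀ (mul_ne_zero (mul_ne_zero hv (hv0' σ)) (pow_ne_zero (χ (σ * τ)).val hc1))
    rw [mul_smul] at e1 e3
    linear_combination -(f0 * σ • (v : M₁)) * e1 + (σ • (v : M₁) * σ • τ • (v : M₁)) * e6
      + (σ • j (l (π τ)) * σ • τ • (v : M₁)) * e2 + ((v : M₁) * C ^ (χ σ).val * (ν σ : M₁)) * e3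
      - ((v : M₁) * σ • (v : M₁) * (ν σ : M₁) * σ • (ν τ : M₁)) * e5

end Albert

section CyclicStep

open Polynomial in
lemma mem_or_eq_of_prod_mem {p : ℕ} [hp : Fact p.Prime] {M : Type*} [Field M] [CharP M p]
    {E : Subfield M} {x : ℕ → M} (hx : ∀ k, x k ∈ E) {z : M} (hz : z ^ p ∈ E)
    (hprod : ∏ k ∈ Finset.range p, (z + x k) ∈ E) :
    z ∈ E ∨ ∀ k < p, x k = x 0 := by
  by_cases hzE : z ∈ E
  · exact Or.inl hzE
  refine Or.inr ?_
  have hirr : Irreducible (X ^ p - C ⟨z ^ p, hz⟩ : E[X]) := by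
    refine X_pow_sub_C_irreducible_of_prime hp.out fun b hb => hzE ?_
    have h1 : (b : M) ^ p = z ^ p := congrArg Subtype.val hb
    rw [← show (b : M) = z from frobenius_inj M p h1]
    exact b.2
  have hmin : minpoly E z = X ^ p - C ⟨z ^ p, hz⟩ := by
    refine (minpoly.eq_of_irreducible_of_monic hirr ?_
      (monic_X_pow_sub_C _ hp.out.ne_zero)).symm
    simp only [map_sub, map_pow, aeval_X, aeval_C]
    exact sub_self _
  set Q : E[X] := ∏ k ∈ Finset.range p, (X + C ⟨x k, hx k⟩) with hQ
  have hQm : Q.Monic := monic_prod_of_monic _ _ fun k _ => monic_X_add_C _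
  have hQd : Q.natDegree = p := by
    rw [hQ, natDegree_prod_of_monic _ _ fun k _ => monic_X_add_C _]
    simp
  have hdvd : minpoly E z ∣ Q - C ⟨_, hprod⟩ := by
    refine minpoly.dvd E z ?_
    rw [map_sub, aeval_C, hQ, map_prod]
    simp only [map_add, aeval_X, aeval_C]
    exact sub_self _
  have hdeg : (C ⟨_, hprod⟩ : E[X]).degree < Q.degree := by
    rw [degree_eq_natDegree hQm.ne_zero, hQd]
    exact degree_C_lt.trans_le (by exact_mod_cast hp.out.pos)
  have heq : minpoly E z = Q - C ⟨_, hprod⟩ := by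
    refine Eq.symm <| eq_of_monic_of_dvd_of_natDegree_le (hmin ▸ monic_X_pow_sub_C _ hp.out.ne_zero)
      (hQm.sub_of_left hdeg) hdvd ?_
    rw [natDegree_sub_C, hQd, hmin, natDegree_X_pow_sub_C]
  have hroot : ∀ k < p, (-x k) ^ p = z ^ p - ∏ k ∈ Finset.range p, (z + x k) := by
    intro k hk
    have h := congrArg (aeval (-x k)) (hmin.symm.trans heq)
    have h0 : ∏ k' ∈ Finset.range p, (-x k + algebraMap E M ⟨x k', hx k'⟩) = 0 :=
      Finset.prod_eq_zero (Finset.mem_range.mpr hk) (neg_add_cancel _)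
    simp only [map_sub, map_pow, aeval_X, aeval_C, hQ, map_prod, map_add] at h
    rw [h0] at h
    change (-x k) ^ p - z ^ p = 0 - ∏ k ∈ Finset.range p, (z + x k) at h
    linear_combination h
  intro k hk
  exact neg_injective (frobenius_inj M p ((hroot k hk).trans (hroot 0 hp.out.pos).symm))

lemma exists_pow_decomposition {p : ℕ} [hp : Fact p.Prime] {F L : Type*} [Field F] [Field L]
    [Algebra F L] [CharP F p] [Algebra.IsSeparable F L] (hd : Module.finrank F L = p) :
    ∃ β : Fin (p - 1) → L,
      (∀ z : L, ∃ (z₀ : F) (w : Fin (p - 1) → F), z = algebraMap F L z₀ + ∑ k, w k • β k ^ p) ∧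
      ∀ (x : F) (w : Fin (p - 1) → F), ∑ k, w k • β k ^ p = algebraMap F L x → ∀ k, w k = 0 := by
  have hfin : FiniteDimensional F L := Module.finite_of_finrank_pos (hd ▸ hp.out.pos)
  obtain ⟨q, rfl⟩ : ∃ q, p = q + 1 := ⟨p - 1, (Nat.sub_add_cancel hp.out.one_le).symm⟩
  set pb := Field.powerBasisOfFiniteOfSeparable F L
  have hdim : pb.dim = q + 1 := by rw [← pb.finrank, hd]
  let b : Module.Basis (Fin (q + 1)) F L := pb.basis.reindex (finCongr hdim)
  have hb : ∀ k, b k = pb.gen ^ (k : ℕ) := fun k => by simp [b]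
  have hli : LinearIndependent F fun k => b k ^ (q + 1) := by
    have := b.linearIndependent.map_pow_expChar_pow_of_isSeparable (q + 1) 1
    simpa using this
  have h0 : b 0 ^ (q + 1) = 1 := by rw [hb]; simp
  let b' : Module.Basis (Fin (q + 1)) F L :=
    basisOfLinearIndependentOfCardEqFinrank hli (by simp [hd])
  have hb' : ∀ k, b' k = b k ^ (q + 1) := fun k => by simp [b']
  refine ⟨fun k => b k.succ, fun z => ⟨b'.repr z 0, fun k => b'.repr z k.succ, ?_⟩,
    fun x w hw k => ?_⟩
  · conv_lhs => rw [← b'.sum_repr z]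
    rw [Fin.sum_univ_succ, hb', h0, Algebra.algebraMap_eq_smul_one]
    simp only [hb']
    rfl
  · have h1 : ∑ k, (Fin.cons (-x) w : Fin (q + 1) → F) k • b k ^ (q + 1) = 0 := by
      rw [Fin.sum_univ_succ]
      simp only [Fin.cons_zero, Fin.cons_succ]
      rw [h0, neg_smul, ← Algebra.algebraMap_eq_smul_one, ← hw]
      exact neg_add_cancel _
    have := Fintype.linearIndependent_iff.mp hli _ h1 (Fin.succ k)
    simpa using this

lemma exists_lift_generator {p : ℕ} {F L M : Type*} [Field F] [Field L] [Field M] [Algebra F L]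
    [Algebra F M] [Algebra L M] [IsScalarTower F L M] [FiniteDimensional F M] [IsGalois F M]
    [FiniteDimensional F L] [IsGalois F L] [IsCyclic (L ≃ₐ[F] L)] (hd : Module.finrank F L = p) :
    ∃ s : M ≃ₐ[F] M,
      (∀ σ : M ≃ₐ[F] M, ∃ (k : ℕ) (τ : M ≃ₐ[L] M), σ = s ^ k * τ.restrictScalars F) ∧
      (∃ τ : M ≃ₐ[L] M, s ^ p = τ.restrictScalars F) ∧
      (∀ τ : M ≃ₐ[L] M, ∃ τ' : M ≃ₐ[L] M,
        τ.restrictScalars F * s = s * τ'.restrictScalars F) ∧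
      ∀ x : L, s • algebraMap L M x = algebraMap L M x → ∃ y : F, x = algebraMap F L y := by
  set π : (M ≃ₐ[F] M) →* (L ≃ₐ[F] L) := AlgEquiv.restrictNormalHom L with hπ
  have hcomm : ∀ (σ : M ≃ₐ[F] M) (x : L), algebraMap L M (π σ x) = σ • algebraMap L M x :=
    fun σ x => AlgEquiv.restrictNormal_commutes σ L x
  have hker : ∀ σ, π σ = 1 → ∃ τ : M ≃ₐ[L] M, σ = τ.restrictScalars F := by
    intro σ hσ
    refine ⟨AlgEquiv.ofRingEquiv (f := σ.toRingEquiv) fun x => ?_, AlgEquiv.ext fun _ => rfl⟩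
    have h := hcomm σ x
    rw [hσ] at h
    exact h.symm
  have hker' : ∀ τ : M ≃ₐ[L] M, π (τ.restrictScalars F) = 1 := by
    intro τ
    ext x
    apply (algebraMap L M).injective
    rw [hcomm]
    exact τ.commutes x
  obtain ⟨g, hg⟩ := IsCyclic.exists_generator (α := L ≃ₐ[F] L)
  obtain ⟨s, hs⟩ := AlgEquiv.restrictNormalHom_surjective (F := F) (K₁ := L) (E := M) g
  change π s = g at hs
  refine ⟨s, fun σ => ?_, hker _ ?_, fun τ => ?_, fun x hx => ?_⟩
  · have hmem : π σ ∈ Submonoid.powers g := mem_powers_iff_mem_zpowers.mpr (hg _)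
    obtain ⟨k, hk⟩ := hmem
    obtain ⟨τ, hτ⟩ := hker ((s ^ k)⁻¹ * σ) (by
      rw [map_mul, map_inv, map_pow, hs]
      exact (congrArg _ hk.symm).trans (inv_mul_cancel _))
    exact ⟨k, τ, by rw [← hτ, mul_inv_cancel_left]⟩
  · rw [map_pow, hs, ← hd, ← IsGalois.card_aut_eq_finrank, pow_card_eq_one']
  · obtain ⟨τ', hτ'⟩ := hker (s⁻¹ * (τ.restrictScalars F * s)) (by
      rw [map_mul, map_mul, hker', one_mul, map_inv, inv_mul_cancel])
    exact ⟨τ', by rw [← hτ', mul_inv_cancel_left]⟩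
  · have hgx : g x = x := by
      apply (algebraMap L M).injective
      rw [← hs, hcomm, hx]
    obtain ⟨y, hy⟩ := (IsGalois.mem_range_algebraMap_iff_fixed (F := F) x).mpr fun σ => by
      obtain ⟨k, hk⟩ : σ ∈ Submonoid.powers g := mem_powers_iff_mem_zpowers.mpr (hg σ)
      have hk' : g ^ k = σ := hk
      rw [← hk']
      clear hk hk'
      induction k with
      | zero => rfl
      | succ k ih => rw [pow_succ, AlgEquiv.mul_apply, hgx, ih]
    exact ⟨y, hy.symm⟩


end CyclicStep

section CyclicStep

variable {p : ℕ} [hp : Fact p.Prime] {F L M : Type} [Field F] [Field L] [Field M] [Algebra L M]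

lemma exists_sum_smul_pow_ne_zero [FiniteDimensional L M] [CharP M p] {l : M} (hl : l ≠ 0) :
    ∃ t : M, ∑ τ : M ≃ₐ[L] M, τ • (l * t ^ p) ≠ 0 := by
  by_contra! h
  have hinj : Function.Injective
      (fun τ : M ≃ₐ[L] M => ((frobenius M p).comp (τ : M →+* M) : M →* M)) := by
    intro τ τ' hτ
    ext x
    exact frobenius_inj M p (DFunLike.congr_fun hτ x)
  have hli := (linearIndependent_monoidHom M M).comp _ hinj
  have h0 := Fintype.linearIndependent_iff.mp hli (fun τ => τ • l) (by
    ext t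
    have := h t
    simp only [smul_mul', smul_pow'] at this
    simpa [frobenius_def] using this) 1
  exact hl (by simpa using h0)

variable [Algebra F L] [Algebra F M] [IsScalarTower F L M] [FiniteDimensional F M]

lemma exists_cochain_extending {g : (M ≃ₐ[F] M) → (M ≃ₐ[F] M) → M} {l : (M ≃ₐ[F] M) → M}
    (hl0 : ∀ σ, l σ ≠ 0) (hgl : ∀ σ τ, g σ τ * l (σ * τ) = l σ * σ • l τ)
    {κ : (M ≃ₐ[L] M) → M} (hκ0 : ∀ τ, κ τ ≠ 0)
    (hgκ : ∀ σ τ : M ≃ₐ[L] M, g (σ.restrictScalars F) (τ.restrictScalars F) * κ (σ * τ)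
      = κ σ * σ • κ τ) :
    ∃ l' : (M ≃ₐ[F] M) → M, (∀ σ, l' σ ≠ 0) ∧ (∀ σ τ, g σ τ * l' (σ * τ) = l' σ * σ • l' τ) ∧
      ∀ τ : M ≃ₐ[L] M, l' (τ.restrictScalars F) = κ τ := by
  have : FiniteDimensional L M := FiniteDimensional.right F L M
  let ψ : (M ≃ₐ[L] M) → Mˣ := fun τ =>
    Units.mk0 (κ τ) (hκ0 τ) / Units.mk0 (l (τ.restrictScalars F)) (hl0 _)
  have hψ : groupCohomology.IsMulCocycle₁ ψ := by
    intro σ τ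
    ext
    have h1 := hgκ σ τ
    have h2 := hgl (σ.restrictScalars F) (τ.restrictScalars F)
    have h3 : ((σ • ψ τ : Mˣ) : M) = σ • κ τ / σ • l (τ.restrictScalars F) := by
      change σ • (((Units.mk0 (κ τ) (hκ0 τ) / Units.mk0 (l (τ.restrictScalars F)) (hl0 _) :
        Mˣ)) : M)
        = _
      rw [Units.val_div_eq_div_val, smul_div₀']
      rfl
    rw [Units.val_mul, h3]
    simp only [ψ, Units.val_div_eq_div_val, Units.val_mk0]
    have e0 : ((σ * τ).restrictScalars F : M ≃ₐ[F] M)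
      = σ.restrictScalars F * τ.restrictScalars F := rfl
    have e1 : (σ.restrictScalars F : M ≃ₐ[F] M) • l (τ.restrictScalars F)
      = σ • l (τ.restrictScalars F) := rfl
    rw [e0]
    rw [e1] at h2
    have hσ : σ • l (τ.restrictScalars F) ≠ 0 := (smul_ne_zero_iff_ne σ).mpr (hl0 _)
    rw [div_mul_div_comm, div_eq_div_iff (hl0 _) (mul_ne_zero hσ (hl0 _))]
    have hg0 : g (σ.restrictScalars F) (τ.restrictScalars F) ≠ 0 := fun h => by
      rw [h, zero_mul] at h2
      exact mul_ne_zero (hl0 _) hσ h2.symm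
    apply mul_left_cancel₀ hg0
    linear_combination (σ • l (τ.restrictScalars F) * l (σ.restrictScalars F)) * h1
      - (κ σ * σ • κ τ) * h2
  obtain ⟨t, ht⟩ := groupCohomology.isMulCoboundary₁_of_isMulCocycle₁_of_aut_to_units ψ hψ
  have ht0 : ∀ σ : M ≃ₐ[F] M, σ • (t : M) ≠ 0 := fun σ => (smul_ne_zero_iff_ne σ).mpr t.ne_zero
  refine ⟨fun σ => l σ * (σ • (t : M) / t), fun σ => mul_ne_zero (hl0 σ)
    (div_ne_zero (ht0 σ) t.ne_zero), fun σ τ => ?_, fun τ => ?_⟩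
  · rw [smul_mul', smul_div₀', ← mul_smul]
    have := ht0 σ
    have := t.ne_zero
    field_simp
    exact hgl σ τ
  · have h := congrArg Units.val (ht τ)
    simp only [ψ, Units.val_div_eq_div_val, Units.val_mk0] at h
    change τ • (t : M) / t = _ at h
    change l (τ.restrictScalars F) * (τ • (t : M) / t) = κ τ
    rw [h, mul_div_cancel₀ _ (hl0 _)]

/-- A cochain whose restriction to `Gal(M/L)` and whose coboundary take values in `pthField p M S`
takes values in such a field after adjoining `p - 1` further elements. -/
theorem exists_generators [CharP F p] [IsGalois F M] [IsGalois F L] [IsCyclic (L ≃ₐ[F] L)]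
    (hd : Module.finrank F L = p) {S : Set F} {g : (M ≃ₐ[F] M) → (M ≃ₐ[F] M) → M}
    (hg : ∀ σ τ, g σ τ ∈ pthField p M S) {l : (M ≃ₐ[F] M) → M}
    (hl0 : ∀ σ, l σ ≠ 0) (hgl : ∀ σ τ, g σ τ * l (σ * τ) = l σ * σ • l τ)
    (hlL : ∀ τ : M ≃ₐ[L] M, l (τ.restrictScalars F) ∈ pthField p M S) :
    ∃ w : Fin (p - 1) → F, ∀ σ, l σ ∈ pthField p M (S ∪ Set.range w) := by
  have hM : CharP M p := charP_of_injective_algebraMap (algebraMap F M).injective p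
  have hfL : FiniteDimensional F L := Module.finite_of_finrank_pos (hd ▸ hp.out.pos)
  have : FiniteDimensional L M := FiniteDimensional.right F L M
  have : IsGalois L M := IsGalois.tower_top_of_isGalois F L M
  obtain ⟨s, hs1, ⟨τp, hτp⟩, hs2, hs4⟩ := exists_lift_generator (M := M) (L := L) hd
  have hσl0 : ∀ σ τ : M ≃ₐ[F] M, σ • l τ ≠ 0 := fun σ τ => (smul_ne_zero_iff_ne σ).mpr (hl0 τ)
  have hg0 : ∀ σ τ, g σ τ ≠ 0 := fun σ τ h => by
    have := hgl σ τ
    rw [h, zero_mul] at this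
    exact mul_ne_zero (hl0 σ) (hσl0 σ τ) this.symm
  have hsmul : ∀ (T : Set F) (σ : M ≃ₐ[F] M) {x : M}, x ∈ pthField p M T →
      σ • x ∈ pthField p M T := fun T σ _ hx => IsInvariantSubfield.smul_mem σ hx
  -- values on `τ • l s`, for `τ` fixing `L`
  have hτ : ∀ τ : M ≃ₐ[L] M, ∃ e ∈ pthField p M S, τ • l s = l s * e := by
    intro τ
    obtain ⟨τ', hτ'⟩ := hs2 τ
    have h1 := hgl (τ.restrictScalars F) s
    have h2 := hgl s (τ'.restrictScalars F)
    rw [hτ'] at h1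
    refine ⟨g (τ.restrictScalars F) s * s • l (τ'.restrictScalars F)
      / (g s (τ'.restrictScalars F) * l (τ.restrictScalars F)),
      div_mem (mul_mem (hg _ _) (hsmul S s (hlL τ'))) (mul_mem (hg _ _) (hlL τ)), ?_⟩
    rw [← mul_div_assoc, eq_div_iff (mul_ne_zero (hg0 _ _) (hl0 _))]
    have h3 : (τ.restrictScalars F : M ≃ₐ[F] M) • l s = τ • l s := rfl
    rw [h3] at h1
    linear_combination (-g s (τ'.restrictScalars F)) * h1 + g (τ.restrictScalars F) s * h2
  choose e heE he using hτ
  obtain ⟨t, ht⟩ := exists_sum_smul_pow_ne_zero (p := p) (L := L) (hl0 s)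
  set z := ∑ τ : M ≃ₐ[L] M, τ • (l s * t ^ p) with hz
  obtain ⟨zL, hzL⟩ := (IsGalois.mem_range_algebraMap_iff_fixed (F := L) z).mpr fun σ => by
    change σ • z = z
    rw [hz, Finset.smul_sum]
    simp only [← mul_smul]
    exact Equiv.sum_comp (Equiv.mulLeft σ) fun τ => τ • (l s * t ^ p)
  obtain ⟨u, huE, hu⟩ : ∃ u ∈ pthField p M S, z = l s * u := by
    refine ⟨∑ τ : M ≃ₐ[L] M, e τ * (τ • t) ^ p,
      sum_mem fun τ _ => mul_mem (heE τ) (pow_mem_pthField p _), ?_⟩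
    rw [hz, Finset.mul_sum]
    refine Finset.sum_congr rfl fun τ _ => ?_
    rw [smul_mul', he, smul_pow', mul_assoc]
  have hu0 : u ≠ 0 := fun h => ht (by rw [hu, h, mul_zero])
  -- values on powers of `s`
  have hpow : ∀ k : ℕ, ∃ e ∈ pthField p M S, e ≠ 0 ∧
      l (s ^ k) = e * ∏ i ∈ Finset.range k, s ^ i • z := by
    intro k
    induction k with
    | zero =>
      refine ⟨l (s ^ 0), ?_, hl0 _, by simp⟩
      have : (s ^ 0 : M ≃ₐ[F] M) = (1 : M ≃ₐ[L] M).restrictScalars F := rfl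
      rw [this]
      exact hlL 1
    | succ k ih =>
      obtain ⟨e', he'E, he'0, he'⟩ := ih
      have hsu0 : s ^ k • u ≠ 0 := (smul_ne_zero_iff_ne _).mpr hu0
      refine ⟨e' / (g (s ^ k) s * s ^ k • u), div_mem he'E (mul_mem (hg _ _) (hsmul S _ huE)),
        div_ne_zero he'0 (mul_ne_zero (hg0 _ _) hsu0), ?_⟩
      have h1 := hgl (s ^ k) s
      rw [Finset.prod_range_succ, div_mul_eq_mul_div, eq_div_iff (mul_ne_zero (hg0 _ _) hsu0),
        pow_succ]
      have h2 : s ^ k • z = s ^ k • l s * s ^ k • u := by rw [hu, smul_mul']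
      rw [h2, ← mul_assoc, ← mul_assoc, ← he']
      linear_combination (s ^ k • u) * h1
  have hN : ∏ i ∈ Finset.range p, s ^ i • z ∈ pthField p M S := by
    obtain ⟨e', he'E, he'0, he'⟩ := hpow p
    have h1 : l (s ^ p) ∈ pthField p M S := hτp ▸ hlL τp
    have h2 : ∏ i ∈ Finset.range p, s ^ i • z = l (s ^ p) / e' := by
      rw [he', mul_div_cancel_left₀ _ he'0]
    rw [h2]
    exact div_mem h1 he'E
  suffices h : ∃ w : Fin (p - 1) → F, z ∈ pthField p M (S ∪ Set.range w) by
    obtain ⟨w, hw⟩ := h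
    have hle : pthField p M S ≤ pthField p M (S ∪ Set.range w) :=
      pthField_mono Set.subset_union_left
    refine ⟨w, fun σ => ?_⟩
    obtain ⟨k, τ, rfl⟩ := hs1 σ
    obtain ⟨e', he'E, -, he'⟩ := hpow k
    have h1 := hgl (s ^ k) (τ.restrictScalars F)
    have h2 : l (s ^ k) ∈ pthField p M (S ∪ Set.range w) := by
      rw [he']
      exact mul_mem (hle he'E) (prod_mem fun i _ => hsmul _ _ hw)
    rw [mul_comm, ← eq_div_iff (hg0 _ _)] at h1
    rw [h1]
    exact div_mem (mul_mem h2 (hsmul _ _ (hle (hlL τ)))) (hle (hg _ _))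
  obtain ⟨β, hβ1, hβ2⟩ := exists_pow_decomposition (F := F) (L := L) hd
  obtain ⟨z₀, w, hzw⟩ := hβ1 zL
  set ξ : M := algebraMap L M (∑ k, w k • β k ^ p) with hξ
  have hzξ : z = algebraMap F M z₀ + ξ := by
    rw [← hzL, hzw, map_add, ← IsScalarTower.algebraMap_apply]
  have hξE : ξ ∈ pthField p M (S ∪ Set.range w) := by
    rw [hξ, map_sum]
    refine sum_mem fun k _ => ?_
    rw [Algebra.smul_def, map_mul, ← IsScalarTower.algebraMap_apply, map_pow]
    exact mul_mem (algebraMap_mem_pthField p (Or.inr ⟨k, rfl⟩)) (pow_mem_pthField p _)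
  have hsz : ∀ i : ℕ, s ^ i • z = algebraMap F M z₀ + s ^ i • ξ := fun i => by
    rw [hzξ, smul_add]
    congr 1
    exact AlgEquiv.commutes _ _
  rcases mem_or_eq_of_prod_mem (p := p) (E := pthField p M (S ∪ Set.range w))
    (x := fun i => s ^ i • ξ) (z := algebraMap F M z₀) (fun k => hsmul _ _ hξE)
    (pow_mem_pthField p _) (by
      simp only [← hsz]
      exact pthField_mono Set.subset_union_left hN) with h | h
  · exact ⟨w, hzξ ▸ add_mem h hξE⟩
  · have h1 := h 1 hp.out.one_lt
    simp only [pow_one, pow_zero, one_smul] at h1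
    obtain ⟨x, hx⟩ := hs4 _ h1
    have hw0 := hβ2 x w hx
    have hξ0 : ξ = 0 := by rw [hξ]; simp [hw0]
    refine ⟨fun _ => z₀, ?_⟩
    rw [hzξ, hξ0, add_zero]
    exact algebraMap_mem_pthField p (Or.inr ⟨⟨0, Nat.sub_pos_of_lt hp.out.one_lt⟩, rfl⟩)

end CyclicStep

section Assembly

variable {p : ℕ} [hp : Fact p.Prime] {F L M : Type} [Field F] [Field L] [Field M]
  [Algebra F M]

theorem HasTwistedRep.symbolLengthLE {B : Type} [Ring B] [Algebra F B] {n : ℕ} {c : Fin n → F}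
    {f : (M ≃ₐ[F] M) → (M ≃ₐ[F] M) → M} (h : HasTwistedRep F B f) (hc0 : ∀ s, c s ≠ 0)
    (hc : BecomesSymbolic p c f) : SymbolLengthLE p F B n := by
  obtain ⟨M', _, _, _, _, _, j, π, y, a, χ, μ, hj, hy, hχ, hμ, hf⟩ := hc
  choose D i1 i2 hD using fun s => exists_isCyclicAlgWith (hc0 s) (hy s)
  have h1 := HasTwistedRep.pi fun s => (hD s).hasTwistedRep (hy s) (hχ s)
  have h2 := h.inflate j π hj
  refine ⟨n, le_rfl, D, i1, i2, fun s => ⟨a s, c s, hD s⟩, ?_⟩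
  refine h2.exists_matrix_algEquiv_matrix (h1.of_coboundary hμ fun σ τ => ?_)
  rw [hf, mul_comm]

variable [Algebra L M]

lemma pow_mul_prod_pow_val {k : ℕ} {b : Fin k → L} {χ : Fin k → (M ≃ₐ[L] M) → ZMod p}
    (hχ : ∀ s σ τ, χ s (σ * τ) = χ s σ + χ s τ) {f : (M ≃ₐ[L] M) → (M ≃ₐ[L] M) → M}
    {ν : (M ≃ₐ[L] M) → M}
    (hf : ∀ σ τ, f σ τ * ν (σ * τ)
      = (ν σ * σ • ν τ) * ∏ s, algebraMap L M (b s) ^ carry (χ s σ) (χ s τ))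
    (σ τ : M ≃ₐ[L] M) :
    f σ τ ^ p * (ν (σ * τ) ^ p * ∏ s, algebraMap L M (b s) ^ (χ s (σ * τ)).val)
      = (ν σ ^ p * ∏ s, algebraMap L M (b s) ^ (χ s σ).val)
        * σ • (ν τ ^ p * ∏ s, algebraMap L M (b s) ^ (χ s τ).val) := by
  have hb : ∀ s, σ • algebraMap L M (b s) = algebraMap L M (b s) := fun s => σ.commutes _
  rw [← mul_assoc, ← mul_pow, hf, smul_mul', smul_pow', Finset.smul_prod', mul_pow, mul_pow,
    ← Finset.prod_pow]
  simp only [smul_pow', hb, ← pow_mul]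
  have : ∏ s, algebraMap L M (b s) ^ (carry (χ s σ) (χ s τ) * p)
      * algebraMap L M (b s) ^ (χ s (σ * τ)).val
      = (∏ s, algebraMap L M (b s) ^ (χ s σ).val) * ∏ s, algebraMap L M (b s) ^ (χ s τ).val := by
    rw [← Finset.prod_mul_distrib]
    refine Finset.prod_congr rfl fun s _ => ?_
    rw [← pow_add, ← pow_add, hχ, mul_comm, add_comm, val_add_carry]
  rw [Finset.prod_mul_distrib] at this
  linear_combination (ν σ ^ p * (σ • ν τ) ^ p) * this

variable [Algebra F L] [IsScalarTower F L M] [FiniteDimensional F M] [IsGalois F M] [CharP F p]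

lemma becomesSymbolic_of_mem_pthField_range {ι : Type} [Fintype ι] {n : ℕ}
    (hn : Fintype.card ι = n) {w : ι → F} {f : (M ≃ₐ[F] M) → (M ≃ₐ[F] M) → M}
    {l : (M ≃ₐ[F] M) → M} (hl0 : ∀ σ, l σ ≠ 0)
    (hl : ∀ σ, l σ ∈ pthField p M (Set.range w))
    (hfl : ∀ σ τ, f σ τ ^ p * l (σ * τ) = l σ * σ • l τ) :
    ∃ c : Fin n → F, (∀ s, c s ≠ 0) ∧ BecomesSymbolic p c f := by
  classical
  set c : Fin n → F := fun s => if w ((Fintype.equivFinOfCardEq hn).symm s) = 0 then 1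
    else w ((Fintype.equivFinOfCardEq hn).symm s) with hc
  have hc0 : ∀ s, c s ≠ 0 := fun s => by
    simp only [hc]
    split_ifs with h
    · exact one_ne_zero
    · exact h
  refine ⟨c, hc0, becomesSymbolic_of_mem_pthField n M c hc0 f l hl0 (fun σ => ?_) hfl⟩
  refine pthField_le (fun x => pow_mem_pthField p x) ?_ (hl σ)
  rintro _ ⟨i, rfl⟩
  by_cases h : w i = 0
  · rw [h, map_zero]; exact zero_mem _
  · exact algebraMap_mem_pthField p ⟨Fintype.equivFinOfCardEq hn i, by simp [hc, h]⟩

variable {k : ℕ} {b : Fin k → L} {χ : Fin k → (M ≃ₐ[L] M) → ZMod p}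
  {f : (M ≃ₐ[F] M) → (M ≃ₐ[F] M) → M} {ν : (M ≃ₐ[L] M) → M}

lemma becomesSymbolic_of_bijective (hL : Function.Bijective (algebraMap F L))
    (hb : ∀ s, b s ≠ 0) (hχ : ∀ s σ τ, χ s (σ * τ) = χ s σ + χ s τ) (hν : ∀ σ, ν σ ≠ 0)
    (hf : ∀ σ τ, f (σ.restrictScalars F) (τ.restrictScalars F) * ν (σ * τ)
      = (ν σ * σ • ν τ) * ∏ s, algebraMap L M (b s) ^ carry (χ s σ) (χ s τ)) :
    ∃ c : Fin k → F, (∀ s, c s ≠ 0) ∧ BecomesSymbolic p c f := by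
  choose w hw using fun s => hL.2 (b s)
  have hu : ∀ σ : M ≃ₐ[F] M, ∃ τ : M ≃ₐ[L] M, τ.restrictScalars F = σ := fun σ =>
    ⟨AlgEquiv.ofRingEquiv (f := σ.toRingEquiv) fun x => by
      obtain ⟨y, rfl⟩ := hL.2 x
      rw [← IsScalarTower.algebraMap_apply]
      exact σ.commutes y, by ext; rfl⟩
  choose u hu using hu
  have hmul : ∀ σ τ, u (σ * τ) = u σ * u τ := fun σ τ =>
    AlgEquiv.restrictScalars_injective F ((hu _).trans (congrArg₂ (· * ·) (hu σ) (hu τ)).symm)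
  refine becomesSymbolic_of_mem_pthField_range (by simp) (w := w)
    (l := fun σ => ν (u σ) ^ p * ∏ s, algebraMap L M (b s) ^ (χ s (u σ)).val)
    (fun σ => ?_) (fun σ => ?_) fun σ τ => ?_
  · exact mul_ne_zero (pow_ne_zero _ (hν _)) (Finset.prod_ne_zero_iff.mpr fun s _ =>
      pow_ne_zero _ (by simpa using hb s))
  · refine mul_mem (pow_mem_pthField p _) (prod_mem fun s _ => pow_mem ?_ _)
    rw [← hw, ← IsScalarTower.algebraMap_apply]
    exact algebraMap_mem_pthField p ⟨s, rfl⟩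
  · have := pow_mul_prod_pow_val hχ hf (u σ) (u τ)
    rw [hu, hu, ← hmul] at this
    rw [this]
    congr 1
    conv_rhs => rw [← hu σ]
    rfl

lemma becomesSymbolic_of_isCyclic [IsGalois F L] [IsCyclic (L ≃ₐ[F] L)]
    (hd : Module.finrank F L = p) {l : (M ≃ₐ[F] M) → M} (hl0 : ∀ σ, l σ ≠ 0)
    (hfl : ∀ σ τ, f σ τ ^ p * l (σ * τ) = l σ * σ • l τ)
    (hb : ∀ s, b s ≠ 0) (hχ : ∀ s σ τ, χ s (σ * τ) = χ s σ + χ s τ) (hν : ∀ σ, ν σ ≠ 0)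
    (hf : ∀ σ τ, f (σ.restrictScalars F) (τ.restrictScalars F) * ν (σ * τ)
      = (ν σ * σ • ν τ) * ∏ s, algebraMap L M (b s) ^ carry (χ s σ) (χ s τ)) :
    ∃ c : Fin ((k + 1) * p - 1) → F, (∀ s, c s ≠ 0) ∧ BecomesSymbolic p c f := by
  obtain ⟨β, hβ, -⟩ := exists_pow_decomposition (p := p) (F := F) (L := L) hd
  choose z₀ w hw using hβ
  set W : Fin k × Option (Fin (p - 1)) → F := fun i => i.2.elim (z₀ (b i.1)) (w (b i.1)) with hW
  have hbW : ∀ s, algebraMap L M (b s) ∈ pthField p M (Set.range W) := fun s => by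
    rw [hw (b s), map_add, ← IsScalarTower.algebraMap_apply, map_sum]
    refine add_mem (algebraMap_mem_pthField p ⟨(s, none), rfl⟩) (sum_mem fun i _ => ?_)
    rw [Algebra.smul_def, map_mul, ← IsScalarTower.algebraMap_apply, map_pow]
    exact mul_mem (algebraMap_mem_pthField p ⟨(s, some i), rfl⟩) (pow_mem_pthField p _)
  obtain ⟨l', hl'0, hfl', hl'⟩ := exists_cochain_extending (L := L)
    (g := fun σ τ => f σ τ ^ p) hl0 hfl
    (κ := fun σ => ν σ ^ p * ∏ s, algebraMap L M (b s) ^ (χ s σ).val)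
    (fun σ => mul_ne_zero (pow_ne_zero _ (hν _)) (Finset.prod_ne_zero_iff.mpr fun s _ =>
      pow_ne_zero _ (by simpa using hb s))) (pow_mul_prod_pow_val hχ hf)
  obtain ⟨v, hv⟩ := exists_generators (L := L) hd (S := Set.range W)
    (fun σ τ => pow_mem_pthField p (f σ τ)) hl'0 hfl' fun τ => by
      rw [hl']
      exact mul_mem (pow_mem_pthField p _) (prod_mem fun s _ => pow_mem (hbW s) _)
  refine becomesSymbolic_of_mem_pthField_range (w := Sum.elim W v) ?_ hl'0
    (fun σ => by rw [Set.Sum.elim_range]; exact hv σ) hfl'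
  have := hp.out.one_lt
  simp only [Fintype.card_sum, Fintype.card_prod, Fintype.card_option, Fintype.card_fin]
  rw [Nat.sub_add_cancel this.le, add_mul, one_mul]
  omega

end Assembly

section Descent

lemma SymbolLengthLE.mono {p : ℕ} {F B : Type} [Field F] [Ring B] [Algebra F B] {m n : ℕ}
    (h : SymbolLengthLE p F B m) (hmn : m ≤ n) : SymbolLengthLE p F B n :=
  let ⟨k, hk, hB⟩ := h
  ⟨k, hk.trans hmn, hB⟩

variable {p : ℕ} [hp : Fact p.Prime] {F₀ F L A : Type} [Field F₀] [Field F] [Field L]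
  [Algebra F₀ F] [Algebra F₀ L] [Algebra F L] [IsScalarTower F₀ F L]
  [Ring A] [Algebra F₀ A] [CharP F p]

lemma SymbolLengthLE.exists_cocycle [FiniteDimensional F L] [Algebra.IsSeparable F L]
    (hA : IsSplitAlg F₀ (⨂[F₀] _ : Fin p, A)) {m : ℕ}
    (h : SymbolLengthLE p L (L ⊗[F₀] A) m) :
    ∃ (M : Type) (_ : Field M) (_ : Algebra F M) (_ : Algebra L M) (_ : IsScalarTower F L M)
      (_ : FiniteDimensional F M) (_ : IsGalois F M) (f : (M ≃ₐ[F] M) → (M ≃ₐ[F] M) → M)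
      (l : (M ≃ₐ[F] M) → M) (k : ℕ) (b : Fin k → L) (χ : Fin k → (M ≃ₐ[L] M) → ZMod p)
      (ν : (M ≃ₐ[L] M) → M), k ≤ m ∧ HasTwistedRep F (F ⊗[F₀] A) f ∧ (∀ σ, l σ ≠ 0) ∧
      (∀ σ τ, f σ τ ^ p * l (σ * τ) = l σ * σ • l τ) ∧ (∀ s, b s ≠ 0) ∧
      (∀ s σ τ, χ s (σ * τ) = χ s σ + χ s τ) ∧ (∀ σ, ν σ ≠ 0) ∧
      ∀ σ τ, f (σ.restrictScalars F) (τ.restrictScalars F) * ν (σ * τ)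
        = (ν σ * σ • ν τ) * ∏ s, algebraMap L M (b s) ^ carry (χ s σ) (χ s τ) := by
  obtain ⟨k, hk, D, _, _, hD, r, s, hr, hs, ⟨e⟩⟩ := h
  choose a b hab using hD
  have : CharP L p := charP_of_injective_algebraMap (algebraMap F L).injective p
  obtain ⟨M, _, _, _, _, _, _, y, hy⟩ := exists_isGalois_artinSchreier (F := F) p a
  have : CharP M p := charP_of_injective_algebraMap (algebraMap L M).injective p
  let _ : Algebra F₀ M := ((algebraMap F M).comp (algebraMap F₀ F)).toAlgebra
  have : IsScalarTower F₀ F M := .of_algebraMap_eq fun _ => rfl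
  have : IsScalarTower F₀ L M := .of_algebraMap_eq fun x => by
    rw [IsScalarTower.algebraMap_apply F₀ F L, ← IsScalarTower.algebraMap_apply F L M]
    exact IsScalarTower.algebraMap_apply F₀ F M x
  have : SMulCommClass (M ≃ₐ[F] M) F₀ M := ⟨fun σ c x => by
    rw [← algebraMap_smul F c x, ← algebraMap_smul F c (σ • x), smul_comm]⟩
  choose χ hχ using fun i => exists_character (G := M ≃ₐ[L] M) (hy i)
  have : Nonempty (Fin r) := ⟨⟨0, hr⟩⟩
  have : Nonempty (Fin s) := ⟨⟨0, hs⟩⟩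
  have hDrep : HasTwistedRep L (Matrix (Fin r) (Fin r) (L ⊗[F₀] A)) _ :=
    ((HasTwistedRep.pi fun i => (hab i).hasTwistedRep (hy i) (hχ i)).matrix (ι := Fin s)).congr
      e.symm
  obtain ⟨n, hn, ρ, _, hρ⟩ := id hDrep
  have : Nonempty (Fin n) := ⟨⟨0, hn⟩⟩
  obtain ⟨n', hn', ρ', hρ'⟩ := hρ.1.exists_of_matrix
  have : Nonempty (Fin n') := ⟨⟨0, hn'⟩⟩
  obtain ⟨g, f, hgf⟩ := hρ'.comp_includeRight.exists_isTwistedRep (M ≃ₐ[F] M)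
  have hgf' : IsTwistedRep ((ρ'.restrictScalars F₀).comp Algebra.TensorProduct.includeRight)
      (fun σ : M ≃ₐ[L] M => g (σ.restrictScalars F))
      fun σ τ => f (σ.restrictScalars F) (τ.restrictScalars F) :=
    ⟨hgf.1, fun σ => hgf.2.1 (σ.restrictScalars F),
      fun σ τ => hgf.2.2 (σ.restrictScalars F) (τ.restrictScalars F)⟩
  obtain ⟨ν, hν, hfν⟩ := hDrep.exists_coboundary
    ((hgf'.baseRep (F := L)).hasTwistedRep.matrix (ι := Fin r))
  obtain ⟨t, ht, ⟨e'⟩⟩ := hA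
  have : Nonempty (Fin t) := ⟨⟨0, ht⟩⟩
  obtain ⟨l, hl, hfl⟩ := ((hasTwistedRep_matrix (ι := Fin t)).congr e'.symm).exists_coboundary
    (HasTwistedRep.pi fun _ : Fin p => hgf.hasTwistedRep)
  refine ⟨M, _, _, _, inferInstance, inferInstance, inferInstance, f, l, k, b, χ, ν, hk,
    (hgf.baseRep (F := F)).hasTwistedRep, hl, fun σ τ => ?_, fun i => (hab i).1,
    fun i => character_mul (hχ i), hν, fun σ τ => ?_⟩
  · have := hfl σ τ
    rwa [Finset.prod_const, Finset.card_univ, Fintype.card_fin, one_mul] at this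
  · rw [hfν, mul_comm]

theorem SymbolLengthLE.of_bijective (hA : IsSplitAlg F₀ (⨂[F₀] _ : Fin p, A)) {m : ℕ}
    (hL : Function.Bijective (algebraMap F L)) (h : SymbolLengthLE p L (L ⊗[F₀] A) m) :
    SymbolLengthLE p F (F ⊗[F₀] A) m := by
  let e : F ≃ₐ[F] L := AlgEquiv.ofBijective (Algebra.ofId F L) hL
  have : FiniteDimensional F L := Module.Finite.equiv e.toLinearEquiv
  have : Algebra.IsSeparable F L := AlgEquiv.Algebra.isSeparable e
  obtain ⟨M, _, _, _, _, _, _, f, l, k, b, χ, ν, hk, hf, -, -, hb, hχ, hν, hfν⟩ :=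
    h.exists_cocycle (F := F) hA
  obtain ⟨c, hc, hfc⟩ := becomesSymbolic_of_bijective hL hb hχ hν hfν
  exact (hf.symbolLengthLE hc hfc).mono hk

theorem SymbolLengthLE.of_isCyclic [IsGalois F L] [IsCyclic (L ≃ₐ[F] L)]
    (hA : IsSplitAlg F₀ (⨂[F₀] _ : Fin p, A)) {m : ℕ} (hd : Module.finrank F L = p)
    (h : SymbolLengthLE p L (L ⊗[F₀] A) m) :
    SymbolLengthLE p F (F ⊗[F₀] A) ((m + 1) * p - 1) := by
  have : FiniteDimensional F L := Module.finite_of_finrank_pos (hd ▸ hp.out.pos)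
  obtain ⟨M, _, _, _, _, _, _, f, l, k, b, χ, ν, hk, hf, hl, hfl, hb, hχ, hν, hfν⟩ :=
    h.exists_cocycle (F := F) hA
  obtain ⟨c, hc, hfc⟩ := becomesSymbolic_of_isCyclic hd hl hfl hb hχ hν hfν
  exact (hf.symbolLengthLE hc hfc).mono
    (Nat.sub_le_sub_right (Nat.mul_le_mul_right p (Nat.succ_le_succ hk)) 1)

end Descent

theorem SymbolLengthLE.of_isPExtension {p : ℕ} [hp : Fact p.Prime] {F L A : Type} [Field F]
    [CharP F p] [Ring A] [Algebra F A] [Field L] [Algebra F L] (hL : IsPExtension p F L)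
    (hA : IsSplitAlg F (⨂[F] _ : Fin p, A)) {m : ℕ} (h : SymbolLengthLE p L (L ⊗[F] A) m) :
    SymbolLengthLE p F (F ⊗[F] A) ((m + 1) * Module.finrank F L - 1) := by
  obtain ⟨n, T, h0, hn, hT⟩ := hL
  have hchar : ∀ i, CharP (T i) p := fun i =>
    charP_of_injective_algebraMap (algebraMap F (T i)).injective p
  have key : ∀ i, 0 < Module.finrank (T i) L ∧
      SymbolLengthLE p (T i) (T i ⊗[F] A) ((m + 1) * Module.finrank (T i) L - 1) := by
    intro i
    induction i using Fin.reverseInduction with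
    | last =>
      have hb : Function.Bijective (algebraMap (T (Fin.last n)) L) :=
        ⟨(algebraMap (T (Fin.last n)) L).injective, fun x => ⟨⟨x, by rw [hn]; trivial⟩, rfl⟩⟩
      have h1 : Module.finrank (T (Fin.last n)) L = 1 := by
        let e := AlgEquiv.ofBijective (Algebra.ofId (T (Fin.last n)) L) hb
        rw [← Module.finrank_self (T (Fin.last n)), e.toLinearEquiv.finrank_eq]
      rw [h1, mul_one, Nat.add_sub_cancel]
      exact ⟨one_pos, h.of_bijective hA hb⟩
    | cast i ih =>
      obtain ⟨hle, _, _, hd⟩ := hT i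
      let K := IntermediateField.extendScalars hle
      have ih' : 0 < Module.finrank K L ∧
        SymbolLengthLE p K (K ⊗[F] A) ((m + 1) * Module.finrank K L - 1) := ih
      have h1 := ih'.2.of_isCyclic hA hd
      have h2 : Module.finrank (T i.castSucc) L = Module.finrank K L * p := by
        rw [← Module.finrank_mul_finrank (T i.castSucc) K L, hd, mul_comm]
      rw [Nat.sub_add_cancel (Nat.mul_pos m.succ_pos ih'.1), mul_assoc, ← h2] at h1
      exact ⟨h2 ▸ Nat.mul_pos ih'.1 hp.out.pos, h1⟩
  have hb : Function.Bijective (algebraMap F (T 0)) := by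
    refine ⟨(algebraMap F (T 0)).injective, fun x => ?_⟩
    obtain ⟨y, hy⟩ := IntermediateField.mem_bot.mp (h0.le x.2)
    exact ⟨y, Subtype.ext hy⟩
  have h1 : Module.finrank (T 0) L = Module.finrank F L := by
    rw [h0, IntermediateField.finrank_bot']
  rw [← h1]
  exact (key 0).2.of_bijective hA hb

/-- If `A` is central simple of exponent `p` over `F` of characteristic `p`
and `L/F` is a `p`-extension, then `λ_p(A) ≤ (λ_p(A_L) + 1) * [L:F] - 1`. -/
theorem statement12 (p : ℕ) (hp : p.Prime) (F : Type) [Field F] [CharP F p]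
    (A : Type) [Ring A] [Algebra F A] (hA : IsCSA F A) (hexp : HasExponent F A p)
    (L : Type) [Field L] [Algebra F L] (hL : IsPExtension p F L)
    (m : ℕ) (h : SymbolLengthLE p L (L ⊗[F] A) m) :
    SymbolLengthLE p F A ((m + 1) * Module.finrank F L - 1) := by
  have : Fact p.Prime := ⟨hp⟩
  obtain ⟨k, hk, D, _, _, hD, n, r, hn, hr, ⟨e⟩⟩ := h.of_isPExtension hL hexp.2.1
  exact ⟨k, hk, D, _, _, hD, n, r, hn, hr,
    ⟨(Algebra.TensorProduct.lid F A).symm.mapMatrix.trans e⟩⟩
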